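/- arXiv:1305.6053 — 2 statements merged into one kernel-verified Lean document; each statement's English description precedes it below -/
import Mathlib

section
/- The function f satisfies the partial differential equation ∂f/∂s (s,x) = −(1/2) ∂²f/∂x² (s,x) − 2x f(s,x) for all s ∈ ℝ and x < 0. Moreover 0 ≤ f(s,x) ≤ e^{−2sx−(2/3)s³} for all s ∈ ℝ, x < 0, and the following boundary behavior holds: lim_{x↑0} f(s,x) = e^{−(2/3)s³} for every s ∈ ℝ; lim_{s→∞} f(s,x) = 0 for every x < 0; and lim_{x→−∞} e^{2sx} f(s,x) = 0 for every s ∈ ℝ. -/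
open MeasureTheory ProbabilityTheory Filter Set

noncomputable section

/-- `Ai, Bi` form the standard pair of Airy functions: entire solutions of `w'' = z·w`,
real on the real axis, normalized there by the classical improper integral representations
`Ai x = (1/π) ∫₀^∞ cos(t³/3 + xt) dt` and
`Bi x = (1/π) ∫₀^∞ (exp(-t³/3 + xt) + sin(t³/3 + xt)) dt`. -/
def IsAiry (Ai Bi : ℂ → ℂ) : Prop :=
  Differentiable ℂ Ai ∧ Differentiable ℂ Bi ∧
  (∀ z : ℂ, deriv (deriv Ai) z = z * Ai z) ∧
  (∀ z : ℂ, deriv (deriv Bi) z = z * Bi z) ∧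
  (∀ x : ℝ, (Ai (x : ℂ)).im = 0) ∧
  (∀ x : ℝ, (Bi (x : ℂ)).im = 0) ∧
  (∀ x : ℝ, Tendsto (fun R : ℝ => ∫ t in (0:ℝ)..R, Real.cos (t ^ 3 / 3 + x * t))
      atTop (nhds (Real.pi * (Ai (x : ℂ)).re))) ∧
  (∀ x : ℝ, Tendsto
      (fun R : ℝ => ∫ t in (0:ℝ)..R,
        (Real.exp (-(t ^ 3) / 3 + x * t) + Real.sin (t ^ 3 / 3 + x * t)))
      atTop (nhds (Real.pi * (Bi (x : ℂ)).re)))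

/-- The real and imaginary parts of a solution of `w'' = (2 l + 4 y) w`, with `l = α + i β`, that
tends to zero at `+∞`. -/
structure DecayingSolution (α β : ℝ) (p q p' q' : ℝ → ℝ) : Prop where
  nonneg : 0 ≤ α
  hp : ∀ y, HasDerivAt p (p' y) y
  hq : ∀ y, HasDerivAt q (q' y) y
  hp' : ∀ y, HasDerivAt p' ((2 * α + 4 * y) * p y - 2 * β * q y) y
  hq' : ∀ y, HasDerivAt q' ((2 * α + 4 * y) * q y + 2 * β * p y) y
  tendsto : Tendsto (fun y => p y ^ 2 + q y ^ 2) atTop (nhds 0)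

namespace DecayingSolution

variable {α β : ℝ} {p q p' q' : ℝ → ℝ}

theorem hasDerivAt_sq (h : DecayingSolution α β p q p' q') (y : ℝ) :
    HasDerivAt (fun y => p y ^ 2 + q y ^ 2) (2 * (p y * p' y + q y * q' y)) y := by
  refine (((h.hp y).pow 2).add ((h.hq y).pow 2)).congr_deriv ?_
  push_cast; ring

theorem hasDerivAt_re (h : DecayingSolution α β p q p' q') (y : ℝ) :
    HasDerivAt (fun y => p y * p' y + q y * q' y)
      (p' y ^ 2 + q' y ^ 2 + (2 * α + 4 * y) * (p y ^ 2 + q y ^ 2)) y := by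
  refine (((h.hp y).mul (h.hp' y)).add ((h.hq y).mul (h.hq' y))).congr_deriv ?_
  ring

theorem hasDerivAt_im (h : DecayingSolution α β p q p' q') (y : ℝ) :
    HasDerivAt (fun y => p y * q' y - q y * p' y) (2 * β * (p y ^ 2 + q y ^ 2)) y := by
  refine (((h.hp y).mul (h.hq' y)).sub ((h.hq y).mul (h.hp' y))).congr_deriv ?_
  ring

theorem shift (h : DecayingSolution α β p q p' q') {b : ℝ} (hb : 0 ≤ b) :
    DecayingSolution (α + 2 * b) β (fun y => p (y + b)) (fun y => q (y + b))
      (fun y => p' (y + b)) (fun y => q' (y + b)) where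
  nonneg := by linarith [h.nonneg]
  hp y := (h.hp (y + b)).comp_add_const y b
  hq y := (h.hq (y + b)).comp_add_const y b
  hp' y := by
    refine ((h.hp' (y + b)).comp_add_const y b).congr_deriv ?_
    ring
  hq' y := by
    refine ((h.hq' (y + b)).comp_add_const y b).congr_deriv ?_
    ring
  tendsto := h.tendsto.comp (tendsto_atTop_add_const_right _ b tendsto_id)

theorem monotoneOn_re (h : DecayingSolution α β p q p' q') :
    MonotoneOn (fun y => p y * p' y + q y * q' y) (Ici 0) := by
  apply monotoneOn_of_deriv_nonneg (convex_Ici 0)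
  · exact fun y _ => (h.hasDerivAt_re y).continuousAt.continuousWithinAt
  · exact fun y _ => (h.hasDerivAt_re y).differentiableAt.differentiableWithinAt
  · intro y hy
    rw [interior_Ici, mem_Ioi] at hy
    rw [(h.hasDerivAt_re y).deriv]
    have := h.nonneg
    positivity

theorem re_nonpos (h : DecayingSolution α β p q p' q') {y : ℝ} (hy : 0 ≤ y) :
    p y * p' y + q y * q' y ≤ 0 := by
  by_contra! hA
  have hm : MonotoneOn (fun t => p t ^ 2 + q t ^ 2 - 2 * (p y * p' y + q y * q' y) * t)
      (Ici y) := by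
    have hd : ∀ t, HasDerivAt (fun t => p t ^ 2 + q t ^ 2 - 2 * (p y * p' y + q y * q' y) * t)
        (2 * (p t * p' t + q t * q' t) - 2 * (p y * p' y + q y * q' y) * 1) t :=
      fun t => (h.hasDerivAt_sq t).sub ((hasDerivAt_id t).const_mul _)
    apply monotoneOn_of_deriv_nonneg (convex_Ici y)
    · exact fun t _ => (hd t).continuousAt.continuousWithinAt
    · exact fun t _ => (hd t).differentiableAt.differentiableWithinAt
    · intro t ht
      rw [interior_Ici, mem_Ioi] at ht
      rw [(hd t).deriv]
      have := h.monotoneOn_re (mem_Ici.2 hy) (mem_Ici.2 (hy.trans ht.le)) ht.le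
      simp only at this
      linarith
  set A := p y * p' y + q y * q' y
  have h1 : ∀ᶠ t in atTop, p t ^ 2 + q t ^ 2 < 1 := h.tendsto.eventually_lt_const one_pos
  obtain ⟨t, ht1, ht2, ht3⟩ := (h1.and ((eventually_ge_atTop (y + 1 / (2 * A))).and
    (eventually_ge_atTop y))).exists
  have := hm (mem_Ici.2 le_rfl) (mem_Ici.2 ht3) ht3
  simp only at this
  have h3 : 1 ≤ 2 * A * (t - y) := by
    have : 1 / (2 * A) ≤ t - y := by linarith
    rw [div_le_iff₀ (by positivity)] at this
    linarith
  nlinarith [sq_nonneg (p y), sq_nonneg (q y)]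

theorem antitoneOn_sq (h : DecayingSolution α β p q p' q') :
    AntitoneOn (fun y => p y ^ 2 + q y ^ 2) (Ici 0) := by
  apply antitoneOn_of_deriv_nonpos (convex_Ici 0)
  · exact fun y _ => (h.hasDerivAt_sq y).continuousAt.continuousWithinAt
  · exact fun y _ => (h.hasDerivAt_sq y).differentiableAt.differentiableWithinAt
  · intro y hy
    rw [interior_Ici, mem_Ioi] at hy
    rw [(h.hasDerivAt_sq y).deriv]
    linarith [h.re_nonpos hy.le]

theorem neg_re_mul_le (h : DecayingSolution α β p q p' q') {y : ℝ} (hy : 0 < y) :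
    -(p y * p' y + q y * q' y) * (2 * y) ≤ p 0 ^ 2 + q 0 ^ 2 := by
  obtain ⟨t, ht, hte⟩ := exists_hasDerivAt_eq_slope _ _ hy
    (fun t _ => (h.hasDerivAt_sq t).continuousAt.continuousWithinAt) fun t _ => h.hasDerivAt_sq t
  have h1 := h.monotoneOn_re (mem_Ici.2 ht.1.le) (mem_Ici.2 hy.le) ht.2.le
  simp only at h1
  rw [eq_div_iff (by linarith)] at hte
  nlinarith [sq_nonneg (p y), sq_nonneg (q y)]

/-- A point of the interval `(b, b + d)` at which the energy density is controlled. -/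
theorem exists_energy_le (h : DecayingSolution α β p q p' q') {b d : ℝ} (hd : 0 < d)
    (hb : d ≤ b) :
    ∃ t ∈ Ioo b (b + d), (p' t ^ 2 + q' t ^ 2 + (2 * α + 4 * t) * (p t ^ 2 + q t ^ 2)) *
      (2 * d ^ 2) ≤ p 0 ^ 2 + q 0 ^ 2 := by
  obtain ⟨t, ht, hte⟩ := exists_hasDerivAt_eq_slope _ _ (show b < b + d by linarith)
    (fun t _ => (h.hasDerivAt_re t).continuousAt.continuousWithinAt) fun t _ => h.hasDerivAt_re t
  refine ⟨t, ht, ?_⟩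
  rw [eq_div_iff (by linarith)] at hte
  have h1 := h.neg_re_mul_le (show 0 < b by linarith)
  have h2 := h.re_nonpos (show 0 ≤ b + d by linarith)
  have h3 := h.re_nonpos (show 0 ≤ b by linarith)
  have h4 : -(p b * p' b + q b * q' b) * (2 * d) ≤ -(p b * p' b + q b * q' b) * (2 * b) := by
    apply mul_le_mul_of_nonneg_left <;> linarith
  have h5 : (p' t ^ 2 + q' t ^ 2 + (2 * α + 4 * t) * (p t ^ 2 + q t ^ 2)) * (2 * d ^ 2) =
     (p' t ^ 2 + q' t ^ 2 + (2 * α + 4 * t) * (p t ^ 2 + q t ^ 2)) * (b + d - b) * (2 * d) := by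
    ring
  rw [h5, hte]
  nlinarith

theorem mul_sq_le (h : DecayingSolution α β p q p' q') {d : ℝ} (hd : 0 < d) :
    (α + |β|) * d ^ 2 * (p (4 * d) ^ 2 + q (4 * d) ^ 2) ≤ p 0 ^ 2 + q 0 ^ 2 := by
  obtain ⟨b, hb, hbe⟩ := h.exists_energy_le hd le_rfl
  obtain ⟨e, he, hee⟩ := h.exists_energy_le hd (show d ≤ 3 * d by linarith)
  simp only [mem_Ioo] at hb he
  have hα := h.nonneg
  have hb0 : 0 ≤ b := by linarith
  have he0 : 0 ≤ e := by linarith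
  have hanti : ∀ {s t : ℝ}, 0 ≤ s → s ≤ t → p t ^ 2 + q t ^ 2 ≤ p s ^ 2 + q s ^ 2 :=
    fun hs hst => h.antitoneOn_sq (mem_Ici.2 hs) (mem_Ici.2 (hs.trans hst)) hst
  set φ4 := p (4 * d) ^ 2 + q (4 * d) ^ 2 with hφ4
  set φ0 := p 0 ^ 2 + q 0 ^ 2 with hφ0
  have hφ4n : 0 ≤ φ4 := by positivity
  have hφ0n : 0 ≤ φ0 := by positivity
  have him : ∀ t, 0 ≤ t → (p' t ^ 2 + q' t ^ 2 + (2 * α + 4 * t) * (p t ^ 2 + q t ^ 2)) *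
      (2 * d ^ 2) ≤ φ0 → |p t * q' t - q t * p' t| * d ≤ 3 / 4 * φ0 := by
    intro t ht hE
    have h1 := hanti le_rfl ht
    have h2 : (p' t ^ 2 + q' t ^ 2) * (2 * d ^ 2) ≤ φ0 := by
      refine le_trans ?_ hE
      have : 0 ≤ (2 * α + 4 * t) * (p t ^ 2 + q t ^ 2) := by positivity
      have : 0 ≤ d ^ 2 := by positivity
      nlinarith
    rw [show |p t * q' t - q t * p' t| * d = |(p t * q' t - q t * p' t) * d| by
      rw [abs_mul, abs_of_pos hd], abs_le]
    constructor
    · linarith [sq_nonneg (p t + q' t * d), sq_nonneg (q t - p' t * d)]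
    · linarith [sq_nonneg (p t - q' t * d), sq_nonneg (q t + p' t * d)]
  have hbI := him b hb0 hbe
  have heI := him e he0 hee
  obtain ⟨r, hr, hre⟩ := exists_hasDerivAt_eq_slope _ _ (show b < e by linarith)
    (fun t _ => (h.hasDerivAt_im t).continuousAt.continuousWithinAt) fun t _ => h.hasDerivAt_im t
  rw [eq_div_iff (by linarith)] at hre
  simp only [mem_Ioo] at hr
  have h1 : φ4 ≤ p r ^ 2 + q r ^ 2 := hanti (by linarith) (by linarith)
  have h2 : φ4 ≤ p b ^ 2 + q b ^ 2 := hanti (by linarith) (by linarith)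
  have h3 : 2 * |β| * (p r ^ 2 + q r ^ 2) * (e - b) * d ≤ 3 / 2 * φ0 := by
    have : 2 * |β| * (p r ^ 2 + q r ^ 2) * (e - b) =
        |(p e * q' e - q e * p' e) - (p b * q' b - q b * p' b)| := by
      rw [← hre, abs_mul, abs_mul, abs_mul, abs_of_pos (show 0 < e - b by linarith), abs_two,
        abs_of_nonneg (show 0 ≤ p r ^ 2 + q r ^ 2 by positivity)]
    rw [this]
    have := mul_le_mul_of_nonneg_right
      (abs_sub (p e * q' e - q e * p' e) (p b * q' b - q b * p' b)) hd.le
    linarith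
  have h4 : 2 * |β| * φ4 * d * d ≤ 2 * |β| * (p r ^ 2 + q r ^ 2) * (e - b) * d := by
    gcongr
    linarith
  have h5 : 2 * α * φ4 * (2 * d ^ 2) ≤ φ0 := by
    refine le_trans ?_ hbe
    gcongr
    have : 2 * α * φ4 ≤ (2 * α + 4 * b) * (p b ^ 2 + q b ^ 2) := by
      gcongr
      linarith
    have : 0 ≤ p' b ^ 2 + q' b ^ 2 := by positivity
    linarith
  linarith

theorem one_add_mul_sq_le (h : DecayingSolution α β p q p' q') {d : ℝ} (hd : 0 < d) :
    (1 + α + |β|) * (p (4 * d) ^ 2 + q (4 * d) ^ 2) ≤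
      (1 + 1 / d ^ 2) * (p 0 ^ 2 + q 0 ^ 2) := by
  have h1 := h.mul_sq_le hd
  have h2 : p (4 * d) ^ 2 + q (4 * d) ^ 2 ≤ p 0 ^ 2 + q 0 ^ 2 :=
    h.antitoneOn_sq (mem_Ici.2 le_rfl) (mem_Ici.2 (by linarith)) (by linarith)
  have h3 : (α + |β|) * (p (4 * d) ^ 2 + q (4 * d) ^ 2) ≤ 1 / d ^ 2 * (p 0 ^ 2 + q 0 ^ 2) := by
    rw [div_mul_eq_mul_div, le_div_iff₀ (by positivity)]
    linarith
  linarith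

theorem one_add_pow_mul_sq_le (n : ℕ) {d : ℝ} (hd : 0 < d) :
    ∀ {α β : ℝ} {p q p' q' : ℝ → ℝ}, DecayingSolution α β p q p' q' →
    (1 + α + |β|) ^ n * (p (n * (4 * d)) ^ 2 + q (n * (4 * d)) ^ 2) ≤
      (1 + 1 / d ^ 2) ^ n * (p 0 ^ 2 + q 0 ^ 2) := by
  induction n with
  | zero => intro α β p q p' q' _; simp
  | succ n ih =>
    intro α β p q p' q' h
    have h1 := ih (h.shift (show 0 ≤ 4 * d by linarith))
    have h2 := h.one_add_mul_sq_le hd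
    have hα := h.nonneg
    simp only [zero_add] at h1
    rw [show ((n + 1 : ℕ) : ℝ) * (4 * d) = n * (4 * d) + 4 * d by push_cast; ring]
    calc (1 + α + |β|) ^ (n + 1) * (p (n * (4 * d) + 4 * d) ^ 2 + q (n * (4 * d) + 4 * d) ^ 2)
        = (1 + α + |β|) * ((1 + α + |β|) ^ n *
          (p (n * (4 * d) + 4 * d) ^ 2 + q (n * (4 * d) + 4 * d) ^ 2)) := by ring
      _ ≤ (1 + α + |β|) * ((1 + (α + 2 * (4 * d)) + |β|) ^ n *
          (p (n * (4 * d) + 4 * d) ^ 2 + q (n * (4 * d) + 4 * d) ^ 2)) := by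
        gcongr
        linarith
      _ ≤ (1 + α + |β|) * ((1 + 1 / d ^ 2) ^ n * (p (4 * d) ^ 2 + q (4 * d) ^ 2)) := by
        gcongr
      _ = (1 + 1 / d ^ 2) ^ n * ((1 + α + |β|) * (p (4 * d) ^ 2 + q (4 * d) ^ 2)) := by ring
      _ ≤ (1 + 1 / d ^ 2) ^ n * ((1 + 1 / d ^ 2) * (p 0 ^ 2 + q 0 ^ 2)) := by gcongr
      _ = _ := by ring

theorem antitoneOn_exp_mul_sq (h : DecayingSolution α β p q p' q') {K : ℝ} (hK : 0 ≤ K) :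
    AntitoneOn (fun y => Real.exp (K * y) * (p y ^ 2 + q y ^ 2)) (Ici (K ^ 2)) := by
  have hexp : ∀ c y : ℝ, HasDerivAt (fun y => Real.exp (c * y)) (Real.exp (c * y) * (c * 1)) y :=
    fun c y => ((hasDerivAt_id y).const_mul c).exp
  have hg : ∀ y, HasDerivAt (fun y => Real.exp (-K * y) *
      (K * (p y ^ 2 + q y ^ 2) + 2 * (p y * p' y + q y * q' y)))
      (Real.exp (-K * y) * (2 * (p' y ^ 2 + q' y ^ 2) +
        (2 * (2 * α + 4 * y) - K ^ 2) * (p y ^ 2 + q y ^ 2))) y := by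
    intro y
    refine ((hexp (-K) y).mul (((h.hasDerivAt_sq y).const_mul K).add
      ((h.hasDerivAt_re y).const_mul 2))).congr_deriv ?_
    simp only [Pi.add_apply]
    ring
  have hmono : MonotoneOn (fun y => Real.exp (-K * y) *
      (K * (p y ^ 2 + q y ^ 2) + 2 * (p y * p' y + q y * q' y))) (Ici (K ^ 2)) := by
    apply monotoneOn_of_deriv_nonneg (convex_Ici _)
    · exact fun y _ => (hg y).continuousAt.continuousWithinAt
    · exact fun y _ => (hg y).differentiableAt.differentiableWithinAt
    · intro y hy
      rw [interior_Ici, mem_Ioi] at hy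
      rw [(hg y).deriv]
      have : 0 ≤ 2 * (2 * α + 4 * y) - K ^ 2 := by nlinarith [h.nonneg, sq_nonneg K]
      positivity
  have hle : ∀ y, K ^ 2 ≤ y → K * (p y ^ 2 + q y ^ 2) + 2 * (p y * p' y + q y * q' y) ≤ 0 := by
    intro y hy
    have hlim : Tendsto (fun t => K * (p t ^ 2 + q t ^ 2)) atTop (nhds 0) := by
      simpa using h.tendsto.const_mul K
    have : Real.exp (-K * y) * (K * (p y ^ 2 + q y ^ 2) + 2 * (p y * p' y + q y * q' y)) ≤ 0 := by
      refine ge_of_tendsto hlim ?_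
      filter_upwards [eventually_ge_atTop y] with t ht
      refine (hmono (mem_Ici.2 hy) (mem_Ici.2 (hy.trans ht)) ht).trans ?_
      have ht0 : 0 ≤ t := (sq_nonneg K).trans (hy.trans ht)
      have h1 := h.re_nonpos ht0
      have h2 : Real.exp (-K * t) ≤ 1 := Real.exp_le_one_iff.2 (by nlinarith)
      have h3 : 0 ≤ K * (p t ^ 2 + q t ^ 2) := by positivity
      have h4 := Real.exp_pos (-K * t)
      simp only
      nlinarith
    by_contra! hc
    exact absurd this (not_le.2 (mul_pos (Real.exp_pos _) hc))
  have hd : ∀ y, HasDerivAt (fun y => Real.exp (K * y) * (p y ^ 2 + q y ^ 2))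
      (Real.exp (K * y) * (K * (p y ^ 2 + q y ^ 2) + 2 * (p y * p' y + q y * q' y))) y := by
    intro y
    refine ((hexp K y).mul (h.hasDerivAt_sq y)).congr_deriv ?_
    ring
  apply antitoneOn_of_deriv_nonpos (convex_Ici _)
  · exact fun y _ => (hd y).continuousAt.continuousWithinAt
  · exact fun y _ => (hd y).differentiableAt.differentiableWithinAt
  · intro y hy
    rw [interior_Ici, mem_Ioi] at hy
    rw [(hd y).deriv]
    exact mul_nonpos_of_nonneg_of_nonpos (Real.exp_pos _).le (hle y hy.le)

theorem exists_bound (n : ℕ) {b K : ℝ} (hb : 0 < b) (hK : 0 ≤ K) :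
    ∃ C : ℝ, 0 ≤ C ∧ ∀ {α β : ℝ} {p q p' q' : ℝ → ℝ}, DecayingSolution α β p q p' q' →
      ∀ y, b ≤ y → (1 + α + |β|) ^ n * (p y ^ 2 + q y ^ 2) ≤
        C * Real.exp (-(K * y)) * (p 0 ^ 2 + q 0 ^ 2) := by
  set d := b / (4 * (n + 1)) with hd
  have hd0 : 0 < d := by positivity
  have hnd : n * (4 * d) ≤ b := by
    rw [hd]
    field_simp
    linarith
  refine ⟨(1 + 1 / d ^ 2) ^ n * Real.exp (K * (b + K ^ 2)), by positivity, ?_⟩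
  intro α β p q p' q' h y hy
  have hα := h.nonneg
  have h1 := one_add_pow_mul_sq_le n hd0 h
  have hfirst : ∀ t, b ≤ t → (1 + α + |β|) ^ n * (p t ^ 2 + q t ^ 2) ≤
      (1 + 1 / d ^ 2) ^ n * (p 0 ^ 2 + q 0 ^ 2) := by
    intro t ht
    refine le_trans ?_ h1
    refine mul_le_mul_of_nonneg_left ?_ (by positivity)
    exact h.antitoneOn_sq (mem_Ici.2 (by positivity)) (mem_Ici.2 (by linarith)) (by linarith)
  have hexp : Real.exp (K * y) * (p y ^ 2 + q y ^ 2) * (1 + α + |β|) ^ n ≤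
      (1 + 1 / d ^ 2) ^ n * Real.exp (K * (b + K ^ 2)) * (p 0 ^ 2 + q 0 ^ 2) := by
    rcases le_total y (b + K ^ 2) with hyY | hyY
    · calc Real.exp (K * y) * (p y ^ 2 + q y ^ 2) * (1 + α + |β|) ^ n
          = Real.exp (K * y) * ((1 + α + |β|) ^ n * (p y ^ 2 + q y ^ 2)) := by ring
        _ ≤ Real.exp (K * (b + K ^ 2)) * ((1 + 1 / d ^ 2) ^ n * (p 0 ^ 2 + q 0 ^ 2)) := by
          refine mul_le_mul (Real.exp_le_exp.2 ?_) (hfirst y hy) (by positivity) (by positivity)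
          gcongr
        _ = _ := by ring
    · have h2 := h.antitoneOn_exp_mul_sq hK (mem_Ici.2 (by linarith : K ^ 2 ≤ b + K ^ 2))
        (mem_Ici.2 (by linarith : K ^ 2 ≤ y)) hyY
      simp only at h2
      calc Real.exp (K * y) * (p y ^ 2 + q y ^ 2) * (1 + α + |β|) ^ n
          ≤ Real.exp (K * (b + K ^ 2)) * (p (b + K ^ 2) ^ 2 + q (b + K ^ 2) ^ 2) *
            (1 + α + |β|) ^ n := by gcongr
        _ = Real.exp (K * (b + K ^ 2)) *
            ((1 + α + |β|) ^ n * (p (b + K ^ 2) ^ 2 + q (b + K ^ 2) ^ 2)) := by ring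
        _ ≤ Real.exp (K * (b + K ^ 2)) * ((1 + 1 / d ^ 2) ^ n * (p 0 ^ 2 + q 0 ^ 2)) := by
          exact mul_le_mul_of_nonneg_left (hfirst _ (by nlinarith [sq_nonneg K])) (by positivity)
        _ = _ := by ring
  rw [Real.exp_neg]
  have he := Real.exp_pos (K * y)
  calc (1 + α + |β|) ^ n * (p y ^ 2 + q y ^ 2)
      = (Real.exp (K * y) * (p y ^ 2 + q y ^ 2) * (1 + α + |β|) ^ n) * (Real.exp (K * y))⁻¹ := by
        field_simp
    _ ≤ ((1 + 1 / d ^ 2) ^ n * Real.exp (K * (b + K ^ 2)) * (p 0 ^ 2 + q 0 ^ 2)) *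
        (Real.exp (K * y))⁻¹ := by gcongr
    _ = _ := by ring

end DecayingSolution

/-- The exponential `exp (i (ζ³ / 3 + z ζ))` of the Airy integral. -/
def airyExp (z ζ : ℂ) : ℂ := Complex.exp (Complex.I * (ζ ^ 3 / 3 + z * ζ))

/-- The Airy integral over the horizontal line through `i`. -/
def airyContour (z : ℂ) : ℂ := ∫ t : ℝ, airyExp z (t + Complex.I)

theorem norm_airyExp (z ζ : ℂ) :
    ‖airyExp z ζ‖ =
      Real.exp (-(ζ.re ^ 2 * ζ.im) + ζ.im ^ 3 / 3 - z.im * ζ.re - z.re * ζ.im) := by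
  rw [airyExp, Complex.norm_exp]
  congr 1
  have h3 : ζ ^ 3 / 3 = ((1 / 3 : ℝ) : ℂ) * (ζ * ζ * ζ) := by push_cast; ring
  rw [h3]
  simp only [Complex.mul_re, Complex.add_re, Complex.add_im, Complex.mul_im, Complex.I_re,
    Complex.I_im, Complex.ofReal_re, Complex.ofReal_im]
  ring

theorem norm_airyExp_add_I (z : ℂ) (t : ℝ) :
    ‖airyExp z (t + Complex.I)‖ = Real.exp (-t ^ 2 - z.im * t + (1 / 3 - z.re)) := by
  rw [norm_airyExp]
  congr 1
  simp
  ring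

theorem norm_airyExp_add_I_le {z : ℂ} {b : ℝ} (hb : |z.im| ≤ b) (t : ℝ) :
    ‖airyExp z (t + Complex.I)‖ ≤
      Real.exp (b ^ 2 / 2 + (1 / 3 - z.re)) * Real.exp (-(1 / 2) * t ^ 2) := by
  rw [norm_airyExp_add_I, ← Real.exp_add]
  apply Real.exp_le_exp.2
  have h1 : z.im ^ 2 ≤ b ^ 2 := by
    rw [← sq_abs z.im]
    gcongr
  nlinarith [sq_nonneg (t + z.im)]

theorem continuous_airyExp (z : ℂ) : Continuous (airyExp z) := by
  unfold airyExp
  fun_prop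

theorem continuous_airyExp_add_I (z : ℂ) : Continuous fun t : ℝ => airyExp z (t + Complex.I) :=
  (continuous_airyExp z).comp (by fun_prop)

theorem integrable_airyExp_add_I (z : ℂ) : Integrable fun t : ℝ => airyExp z (t + Complex.I) :=
  ((integrable_exp_neg_mul_sq (by norm_num : (0 : ℝ) < 1 / 2)).const_mul _).mono'
    (continuous_airyExp_add_I z).aestronglyMeasurable
    (Eventually.of_forall fun t => norm_airyExp_add_I_le le_rfl t)

theorem norm_airyContour_le (z : ℂ) :
    ‖airyContour z‖ ≤ Real.exp (z.im ^ 2 / 2 + (1 / 3 - z.re)) *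
      ∫ t : ℝ, Real.exp (-(1 / 2) * t ^ 2) := by
  rw [← integral_const_mul]
  refine norm_integral_le_of_norm_le
    ((integrable_exp_neg_mul_sq (by norm_num : (0 : ℝ) < 1 / 2)).const_mul _)
    (Eventually.of_forall fun t => ?_)
  simpa using norm_airyExp_add_I_le (z := z) le_rfl t

theorem tendsto_airyContour (z : ℂ) :
    Tendsto (fun y : ℝ => airyContour (z + y)) atTop (nhds 0) := by
  refine squeeze_zero_norm (fun y => norm_airyContour_le (z + y)) ?_
  rw [← zero_mul (∫ t : ℝ, Real.exp (-(1 / 2) * t ^ 2))]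
  refine Tendsto.mul_const _ (Real.tendsto_exp_atBot.comp ?_)
  have : Tendsto (fun y : ℝ => (z.im ^ 2 / 2 + (1 / 3 - z.re)) + -y) atTop atBot :=
    tendsto_atBot_add_const_left _ _ tendsto_neg_atTop_atBot
  refine this.congr fun y => ?_
  simp
  ring

theorem differentiable_airyContour : Differentiable ℂ airyContour := by
  intro z
  set b := |z.im| + 1 with hb
  have hd : ∀ (t : ℝ) (x : ℂ), HasDerivAt (fun x => airyExp x (t + Complex.I))
      (airyExp x (t + Complex.I) * (Complex.I * (t + Complex.I))) x := by
    intro t x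
    refine (((((hasDerivAt_id x).mul_const ((t : ℂ) + Complex.I)).const_add
      (((t : ℂ) + Complex.I) ^ 3 / 3)).const_mul Complex.I).cexp).congr_deriv ?_
    simp [airyExp]
  refine ((hasDerivAt_integral_of_dominated_loc_of_deriv_le (μ := volume)
    (F := fun (x : ℂ) (t : ℝ) => airyExp x (t + Complex.I))
    (F' := fun (x : ℂ) (t : ℝ) => airyExp x (t + Complex.I) * (Complex.I * (t + Complex.I)))
    (bound := fun t : ℝ => Real.exp (b ^ 2 / 2 + (1 / 3 - z.re) + 1 + 2) *
      Real.exp (-(1 / 4) * t ^ 2))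
    (Metric.ball_mem_nhds z one_pos) ?_ (integrable_airyExp_add_I z) ?_ ?_ ?_ ?_).2).differentiableAt
  · exact Eventually.of_forall fun x => (continuous_airyExp_add_I x).aestronglyMeasurable
  · exact ((continuous_airyExp_add_I z).mul (by fun_prop)).aestronglyMeasurable
  · refine Eventually.of_forall fun t x hx => ?_
    rw [Metric.mem_ball, dist_eq_norm] at hx
    have h1 : |x.im| ≤ b := by
      have := (Complex.abs_im_le_norm (x - z)).trans hx.le
      rw [Complex.sub_im] at this
      have h2 := abs_sub_abs_le_abs_sub x.im z.im
      linarith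
    have h2 : z.re - 1 ≤ x.re := by
      have := (Complex.abs_re_le_norm (x - z)).trans hx.le
      rw [Complex.sub_re, abs_le] at this
      linarith
    have h3 : ‖Complex.I * ((t : ℂ) + Complex.I)‖ ≤ Real.exp (2 + 1 / 4 * t ^ 2) := by
      rw [norm_mul, Complex.norm_I, one_mul]
      refine (norm_add_le _ _).trans ?_
      rw [Complex.norm_I, Complex.norm_real, Real.norm_eq_abs]
      refine le_trans ?_ (Real.add_one_le_exp _)
      nlinarith [sq_nonneg (|t| - 2), sq_abs t]
    rw [norm_mul]
    calc _ ≤ Real.exp (b ^ 2 / 2 + (1 / 3 - x.re)) * Real.exp (-(1 / 2) * t ^ 2) *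
          Real.exp (2 + 1 / 4 * t ^ 2) :=
          mul_le_mul (norm_airyExp_add_I_le h1 t) h3 (norm_nonneg _) (by positivity)
      _ ≤ _ := by
        rw [← Real.exp_add, ← Real.exp_add, ← Real.exp_add]
        apply Real.exp_le_exp.2
        linarith
  · exact (integrable_exp_neg_mul_sq (by norm_num : (0 : ℝ) < 1 / 4)).const_mul _
  · exact Eventually.of_forall fun t x _ => hd t x

theorem tendsto_integral_airyExp_vertical (x : ℝ) {R : ℝ → ℝ}
    (hR : Tendsto (fun r => R r ^ 2) atTop atTop) :
    Tendsto (fun r => ∫ y in (0 : ℝ)..1, airyExp x (R r + y * Complex.I)) atTop (nhds 0) := by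
  have hn : ∀ r y : ℝ, ‖airyExp x (R r + y * Complex.I)‖ =
      Real.exp (-(R r ^ 2) * y) * Real.exp (y ^ 3 / 3 - x * y) := by
    intro r y
    rw [norm_airyExp, ← Real.exp_add]
    congr 1
    simp
    ring
  have := intervalIntegral.tendsto_integral_filter_of_dominated_convergence (μ := volume)
    (a := (0 : ℝ)) (b := 1) (l := atTop) (F := fun r y => airyExp x (R r + y * Complex.I))
    (f := fun _ => 0)
    (fun _ => Real.exp (1 / 3 + |x|)) ?_ ?_ ?_ ?_
  · simpa using this
  · exact Eventually.of_forall fun r =>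
      ((continuous_airyExp x).comp (by fun_prop)).aestronglyMeasurable
  · refine Eventually.of_forall fun r => Eventually.of_forall fun y hy => ?_
    rw [uIoc_of_le zero_le_one, mem_Ioc] at hy
    rw [hn, ← Real.exp_add]
    apply Real.exp_le_exp.2
    have h1 : y ^ 3 ≤ 1 := pow_le_one₀ hy.1.le hy.2
    have h2 : -(x * y) ≤ |x| := by
      have : |x * y| ≤ |x| := by
        rw [abs_mul, abs_of_pos hy.1]
        exact mul_le_of_le_one_right (abs_nonneg x) hy.2
      linarith [neg_abs_le (x * y)]
    have h3 : 0 ≤ R r ^ 2 * y := by have := hy.1; positivity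
    linarith
  · exact intervalIntegrable_const
  · refine Eventually.of_forall fun y hy => ?_
    rw [uIoc_of_le zero_le_one, mem_Ioc] at hy
    rw [tendsto_zero_iff_norm_tendsto_zero]
    simp only [hn]
    rw [← zero_mul (Real.exp (y ^ 3 / 3 - x * y))]
    refine Tendsto.mul_const _ (Real.tendsto_exp_atBot.comp ?_)
    exact (tendsto_neg_atTop_atBot.comp hR).atBot_mul_const hy.1

theorem tendsto_integral_airyExp (x : ℝ) :
    Tendsto (fun r : ℝ => ∫ t in (-r)..r, airyExp x t) atTop (nhds (airyContour x)) := by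
  have hrect : ∀ r : ℝ, (∫ t in (-r)..r, airyExp x t) =
      (∫ t in (-r)..r, airyExp x (t + Complex.I)) -
      Complex.I • (∫ y in (0 : ℝ)..1, airyExp x ((r : ℝ) + y * Complex.I)) +
      Complex.I • (∫ y in (0 : ℝ)..1, airyExp x (((-r : ℝ) : ℂ) + y * Complex.I)) := by
    intro r
    have := Complex.integral_boundary_rect_eq_zero_of_differentiableOn (airyExp x)
      ((-r : ℝ) : ℂ) (r + Complex.I) (by unfold airyExp; fun_prop)
    simp only [Complex.ofReal_re, Complex.ofReal_im, Complex.add_re, Complex.I_re, Complex.add_im,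
      Complex.I_im, add_zero, zero_add, Complex.ofReal_zero, zero_mul, Complex.ofReal_one,
      one_mul] at this
    linear_combination this
  simp only [hrect]
  have h1 : Tendsto (fun r : ℝ => ∫ t in (-r)..r, airyExp x (t + Complex.I)) atTop
      (nhds (airyContour x)) :=
    intervalIntegral_tendsto_integral (integrable_airyExp_add_I x) tendsto_neg_atTop_atBot
      tendsto_id
  have h2 := tendsto_integral_airyExp_vertical x (R := fun r => r)
    (tendsto_pow_atTop two_ne_zero)
  have h3 := tendsto_integral_airyExp_vertical x (R := fun r => -r)
    (by simp)
  simpa using (h1.sub (h2.const_smul Complex.I)).add (h3.const_smul Complex.I)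

theorem integral_airyExp_eq (x r : ℝ) :
    (∫ t in (-r)..r, airyExp x t) =
      ((2 * ∫ t in (0 : ℝ)..r, Real.cos (t ^ 3 / 3 + x * t) : ℝ) : ℂ) := by
  have hc : Continuous fun t : ℝ => airyExp x t := (continuous_airyExp x).comp (by fun_prop)
  have hc' : Continuous fun t : ℝ => airyExp x (-t : ℝ) := hc.comp continuous_neg
  have h1 : (∫ t in (-r)..0, airyExp x t) = ∫ t in (0 : ℝ)..r, airyExp x (-t : ℝ) := by
    rw [intervalIntegral.integral_comp_neg (fun t : ℝ => airyExp x t)]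
    simp
  rw [← intervalIntegral.integral_add_adjacent_intervals (hc.intervalIntegrable _ 0)
    (hc.intervalIntegrable _ _), h1, ← intervalIntegral.integral_add
    (hc'.intervalIntegrable _ _) (hc.intervalIntegrable _ _), ← intervalIntegral.integral_const_mul,
    ← intervalIntegral.integral_ofReal]
  congr 1
  ext t
  push_cast
  rw [Complex.two_cos, airyExp, airyExp, add_comm]
  congr 2 <;> ring

theorem eq_airyContour {Ai : ℂ → ℂ} (hAi : Differentiable ℂ Ai)
    (hreal : ∀ x : ℝ, (Ai (x : ℂ)).im = 0)
    (hInt : ∀ x : ℝ, Tendsto (fun R : ℝ => ∫ t in (0:ℝ)..R, Real.cos (t ^ 3 / 3 + x * t))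
      atTop (nhds (Real.pi * (Ai (x : ℂ)).re))) (z : ℂ) :
    2 * Real.pi * Ai z = airyContour z := by
  have hR : ∀ x : ℝ, 2 * Real.pi * Ai x = airyContour x := by
    intro x
    have h1 := (Complex.continuous_ofReal.tendsto _).comp ((hInt x).const_mul 2)
    have h2 : Ai x = ((Ai x).re : ℂ) := by
      apply Complex.ext <;> simp [hreal]
    have h3 := tendsto_nhds_unique h1
      ((tendsto_integral_airyExp x).congr fun r => integral_airyExp_eq x r)
    rw [← h3, h2]
    push_cast
    simp only [Complex.ofReal_re]
    ring
  have hfun : (fun z => 2 * Real.pi * Ai z) = airyContour := by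
    refine AnalyticOnNhd.eq_of_frequently_eq (𝕜 := ℂ) (z₀ := 0)
      (fun z _ => (hAi.const_mul (2 * Real.pi : ℂ)).analyticAt z)
      (fun z _ => differentiable_airyContour.analyticAt z) ?_
    have ht : Tendsto (fun n : ℕ => (((1 / ((n : ℝ) + 1) : ℝ)) : ℂ)) atTop (nhdsWithin 0 {0}ᶜ) := by
      refine tendsto_nhdsWithin_iff.2 ⟨?_, Eventually.of_forall fun n => ?_⟩
      · exact ((Complex.continuous_ofReal.tendsto _).comp
          (tendsto_one_div_add_atTop_nhds_zero_nat (𝕜 := ℝ))).congr fun n => rfl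
      · have : (1 / ((n : ℝ) + 1)) ≠ 0 := by positivity
        simpa using (Complex.ofReal_ne_zero.2 this)
    exact ht.frequently (Eventually.of_forall fun n => hR _).frequently
  exact congrFun hfun z

theorem exists_airyContour_ne_zero : ∃ z, airyContour z ≠ 0 := by
  by_contra! h
  set k : ℝ → ℂ := fun t => airyExp 0 (t + Complex.I) with hk
  have hF : FourierTransform.fourier k = 0 := by
    ext w
    have h1 := h (((-2 * Real.pi * w : ℝ)) : ℂ)
    rw [Real.fourier_real_eq_integral_exp_smul]
    have h2 : ∀ v : ℝ, Complex.exp (((-2 * Real.pi * v * w : ℝ) : ℂ) * Complex.I) • k v =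
        Complex.exp (-2 * Real.pi * w) *
          airyExp (((-2 * Real.pi * w : ℝ)) : ℂ) (v + Complex.I) := by
      intro v
      rw [hk, smul_eq_mul]
      simp only [airyExp]
      rw [ ← Complex.exp_add, ← Complex.exp_add]
      congr 1
      push_cast
      linear_combination (2 * (Real.pi : ℂ) * w) * Complex.I_sq
    simp only [h2]
    rw [integral_const_mul]
    change _ * airyContour _ = _
    rw [h1, mul_zero]
    rfl
  have := (integrable_airyExp_add_I 0).fourierInv_fourier_eq (v := 0)
    (by rw [hF]; exact integrable_zero _ _ _) (continuous_airyExp_add_I 0).continuousAt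
  change FourierTransformInv.fourierInv (FourierTransform.fourier k) 0 = k 0 at this
  rw [hF] at this
  have h0 : FourierTransformInv.fourierInv (0 : ℝ → ℂ) (0 : ℝ) = 0 := by
    rw [Real.fourierInv_eq]
    simp
  rw [h0] at this
  exact Complex.exp_ne_zero _ this.symm

/-- `U` is a nontrivial solution of `U'' = (z / 2) U` decaying along horizontal rays to the
right, with derivative `U'`. -/
structure IsScaledAiry (U U' : ℂ → ℂ) : Prop where
  hasDerivAt : ∀ z, HasDerivAt U (U' z) z
  hasDerivAt' : ∀ z, HasDerivAt U' (z / 2 * U z) z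
  tendsto_zero : ∀ z : ℂ, Tendsto (fun y : ℝ => U (z + y)) atTop (nhds 0)
  exists_ne_zero : ∃ z, U z ≠ 0

theorem IsAiry.isScaledAiry {Ai Bi : ℂ → ℂ} (h : IsAiry Ai Bi) {a : ℝ} (ha : 0 < a)
    (ha3 : a ^ 3 = 1 / 2) :
    IsScaledAiry (fun z => Ai (a * z)) (fun z => a * deriv Ai (a * z)) := by
  obtain ⟨hd, -, hode, -, hreal, -, hInt, -⟩ := h
  have hW := eq_airyContour hd hreal hInt
  have hW' : ∀ z, Ai z = (2 * Real.pi : ℂ)⁻¹ * airyContour z := by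
    intro z
    rw [← hW z, inv_mul_cancel_left₀]
    exact mul_ne_zero two_ne_zero (Complex.ofReal_ne_zero.2 Real.pi_ne_zero)
  have hdd : Differentiable ℂ (deriv Ai) := hd.deriv
  have hlin : ∀ z : ℂ, HasDerivAt (fun z : ℂ => (a : ℂ) * z) a z := fun z => by
    simpa using (hasDerivAt_id z).const_mul (a : ℂ)
  have ha3' : (a : ℂ) ^ 3 = 1 / 2 := by
    rw [← Complex.ofReal_pow, ha3]
    norm_num
  refine ⟨fun z => ?_, fun z => ?_, fun z => ?_, ?_⟩
  · refine ((hd (a * z)).hasDerivAt.comp z (hlin z)).congr_deriv (mul_comm _ _)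
  · refine (((hdd (a * z)).hasDerivAt.comp z (hlin z)).const_mul (a : ℂ)).congr_deriv ?_
    rw [hode]
    linear_combination (z * Ai (a * z)) * ha3'
  · have h1 := ((tendsto_airyContour (a * z)).comp (tendsto_id.const_mul_atTop ha)).const_mul
      (2 * Real.pi : ℂ)⁻¹
    rw [mul_zero] at h1
    refine h1.congr fun y => ?_
    rw [hW']
    simp only [Function.comp_apply, id]
    push_cast
    rw [mul_add]
  · obtain ⟨z, hz⟩ := exists_airyContour_ne_zero
    refine ⟨z / a, ?_⟩
    rw [mul_div_cancel₀ _ (Complex.ofReal_ne_zero.2 ha.ne')]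
    intro h0
    rw [← hW z, h0, mul_zero] at hz
    exact hz rfl

/-- The ratio `U (l + 2 y) / U l`. -/
def airyRatio (U : ℂ → ℂ) (l : ℂ) (y : ℝ) : ℂ := U (l + 2 * y) / U l

/-- The derivative of `airyRatio U l`, where `U'` is the derivative of `U`. -/
def airyRatioDeriv (U U' : ℂ → ℂ) (l : ℂ) (y : ℝ) : ℂ := 2 * U' (l + 2 * y) / U l

theorem norm_deriv_le_of_second_deriv {k k' k'' : ℝ → ℂ} {y M N : ℝ}
    (hk : ∀ t, HasDerivAt k (k' t) t) (hk' : ∀ t, HasDerivAt k' (k'' t) t)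
    (hM : ∀ t, y ≤ t → ‖k'' t‖ ≤ M) (hN : ∀ t, y ≤ t → ‖k t‖ ≤ N) : ‖k' y‖ ≤ M + 2 * N := by
  have hM0 : 0 ≤ M := (norm_nonneg _).trans (hM y le_rfl)
  have h1 : ∀ t ∈ Icc y (y + 1), ‖k' t - k' y‖ ≤ M := by
    intro t ht
    refine (norm_image_sub_le_of_norm_deriv_le_segment' (C := M)
      (fun x _ => (hk' x).hasDerivWithinAt) (fun x hx => hM x hx.1) t ht).trans ?_
    exact mul_le_of_le_one_right hM0 (by linarith [ht.2])
  have h2 := norm_image_sub_le_of_norm_deriv_le_segment' (f := fun t => k t - (t : ℂ) * k' y)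
    (f' := fun t => k' t - 1 * k' y) (a := y) (b := y + 1) (C := M)
    (fun x _ => ((hk x).sub ((Complex.ofRealCLM.hasDerivAt (x := x)).mul_const
      (k' y))).hasDerivWithinAt)
    (fun x hx => by simpa using h1 x (Ico_subset_Icc_self hx)) (y + 1) (by simp)
  have h3 : k' y = k (y + 1) - k y -
      ((k (y + 1) - ((y + 1 : ℝ) : ℂ) * k' y) - (k y - (y : ℂ) * k' y)) := by
    push_cast
    ring
  rw [h3]
  refine (norm_sub_le _ _).trans ?_
  have h4 := norm_sub_le (k (y + 1)) (k y)
  have h5 := hN y le_rfl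
  have h6 := hN (y + 1) (by linarith)
  simp only [add_sub_cancel_left, mul_one] at h2
  linarith

namespace IsScaledAiry

variable {U U' : ℂ → ℂ}

theorem differentiable (h : IsScaledAiry U U') : Differentiable ℂ U :=
  fun z => (h.hasDerivAt z).differentiableAt

theorem differentiable' (h : IsScaledAiry U U') : Differentiable ℂ U' :=
  fun z => (h.hasDerivAt' z).differentiableAt

theorem hasDerivAt_ray (h : IsScaledAiry U U') (l : ℂ) (y : ℝ) :
    HasDerivAt (fun y : ℝ => U (l + 2 * y)) (2 * U' (l + 2 * y)) y := by
  have h1 : HasDerivAt (fun y : ℝ => l + 2 * (y : ℂ)) 2 y := by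
    simpa using ((Complex.ofRealCLM.hasDerivAt (x := y)).const_mul (2 : ℂ)).const_add l
  exact ((h.hasDerivAt _).comp y h1).congr_deriv (mul_comm _ _)

theorem hasDerivAt_ray' (h : IsScaledAiry U U') (l : ℂ) (y : ℝ) :
    HasDerivAt (fun y : ℝ => 2 * U' (l + 2 * y)) ((2 * l + 4 * y) * U (l + 2 * y)) y := by
  have h1 : HasDerivAt (fun y : ℝ => l + 2 * (y : ℂ)) 2 y := by
    simpa using ((Complex.ofRealCLM.hasDerivAt (x := y)).const_mul (2 : ℂ)).const_add l
  exact (((h.hasDerivAt' _).comp y h1).const_mul 2).congr_deriv (by ring)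

theorem decayingSolution (h : IsScaledAiry U U') {l : ℂ} (hl : 0 ≤ l.re) :
    DecayingSolution l.re l.im (fun y => (U (l + 2 * y)).re) (fun y => (U (l + 2 * y)).im)
      (fun y => (2 * U' (l + 2 * y)).re) (fun y => (2 * U' (l + 2 * y)).im) where
  nonneg := hl
  hp y := Complex.reCLM.hasFDerivAt.comp_hasDerivAt y (h.hasDerivAt_ray l y)
  hq y := Complex.imCLM.hasFDerivAt.comp_hasDerivAt y (h.hasDerivAt_ray l y)
  hp' y := (Complex.reCLM.hasFDerivAt.comp_hasDerivAt y (h.hasDerivAt_ray' l y)).congr_deriv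
    (by simp)
  hq' y := (Complex.imCLM.hasFDerivAt.comp_hasDerivAt y (h.hasDerivAt_ray' l y)).congr_deriv
    (by simp)
  tendsto := by
    have h1 := ((h.tendsto_zero l).comp (tendsto_id.const_mul_atTop (two_pos (α := ℝ)))).norm.pow 2
    simp only [norm_zero, ne_eq, OfNat.ofNat_ne_zero, not_false_eq_true, zero_pow] at h1
    refine h1.congr fun y => ?_
    rw [Complex.sq_norm, Complex.normSq_apply]
    simp
    ring

theorem sq_norm_eq (z : ℂ) : z.re ^ 2 + z.im ^ 2 = ‖z‖ ^ 2 := by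
  rw [Complex.sq_norm, Complex.normSq_apply]
  ring

theorem norm_le (h : IsScaledAiry U U') {l : ℂ} (hl : 0 ≤ l.re) {y : ℝ} (hy : 0 ≤ y) :
    ‖U (l + 2 * y)‖ ≤ ‖U l‖ := by
  have := (h.decayingSolution hl).antitoneOn_sq (mem_Ici.2 le_rfl) (mem_Ici.2 hy) hy
  simp only [sq_norm_eq, Complex.ofReal_zero, mul_zero, add_zero] at this
  exact (pow_le_pow_iff_left₀ (norm_nonneg _) (norm_nonneg _) two_ne_zero).1 this

theorem ne_zero (h : IsScaledAiry U U') {l : ℂ} (hl : 0 ≤ l.re) : U l ≠ 0 := by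
  intro h0
  obtain ⟨z, hz⟩ := h.exists_ne_zero
  have hfun : U = fun _ => 0 := by
    refine AnalyticOnNhd.eq_of_frequently_eq (𝕜 := ℂ) (z₀ := l)
      (fun z _ => h.differentiable.analyticAt z) (fun z _ => analyticAt_const) ?_
    have ht : Tendsto (fun n : ℕ => l + 2 * (((1 / ((n : ℝ) + 1) : ℝ)) : ℂ)) atTop
        (nhdsWithin l {l}ᶜ) := by
      refine tendsto_nhdsWithin_iff.2 ⟨?_, Eventually.of_forall fun n => ?_⟩
      · have := (((Complex.continuous_ofReal.tendsto _).comp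
          (tendsto_one_div_add_atTop_nhds_zero_nat (𝕜 := ℝ))).const_mul 2).const_add l
        simp only [Complex.ofReal_zero, mul_zero, add_zero] at this
        exact this.congr fun n => rfl
      · have : (1 / ((n : ℝ) + 1)) ≠ 0 := by positivity
        simpa using (Complex.ofReal_ne_zero.2 this)
    refine ht.frequently (Eventually.of_forall fun n => ?_).frequently
    have := h.norm_le hl (show 0 ≤ 1 / ((n : ℝ) + 1) by positivity)
    rw [h0, norm_zero] at this
    exact norm_le_zero_iff.1 this
  exact hz (by rw [hfun])

theorem norm_airyRatio_le_one (h : IsScaledAiry U U') {l : ℂ} (hl : 0 ≤ l.re) {y : ℝ}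
    (hy : 0 ≤ y) : ‖airyRatio U l y‖ ≤ 1 := by
  rw [airyRatio, norm_div]
  exact div_le_one_of_le₀ (h.norm_le hl hy) (norm_nonneg _)

theorem exists_norm_airyRatio_le (h : IsScaledAiry U U') {b K : ℝ} (hb : 0 < b) (hK : 0 ≤ K) :
    ∃ C : ℝ, 0 ≤ C ∧ ∀ l : ℂ, 0 ≤ l.re → ∀ y, b ≤ y →
      ‖airyRatio U l y‖ * (1 + ‖l‖) ^ 4 ≤ C * Real.exp (-(K * y)) := by
  obtain ⟨C, hC, hbd⟩ := DecayingSolution.exists_bound 8 hb (show 0 ≤ 2 * K by positivity)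
  refine ⟨Real.sqrt C, Real.sqrt_nonneg C, fun l hl y hy => ?_⟩
  have h1 := hbd (h.decayingSolution hl) y hy
  simp only [sq_norm_eq, Complex.ofReal_zero, mul_zero, add_zero] at h1
  have h2 : (1 + ‖l‖) ^ 8 ≤ (1 + l.re + |l.im|) ^ 8 := by
    have := Complex.norm_le_abs_re_add_abs_im l
    rw [abs_of_nonneg hl] at this
    gcongr ?_ ^ 8
    linarith
  have hU := norm_pos_iff.2 (h.ne_zero hl)
  have h3 : ‖U (l + 2 * y)‖ * (1 + ‖l‖) ^ 4 ≤ Real.sqrt C * Real.exp (-(K * y)) * ‖U l‖ := by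
    refine (pow_le_pow_iff_left₀ (by positivity) (by positivity) two_ne_zero).1 ?_
    calc (‖U (l + 2 * y)‖ * (1 + ‖l‖) ^ 4) ^ 2 = (1 + ‖l‖) ^ 8 * ‖U (l + 2 * y)‖ ^ 2 := by ring
      _ ≤ (1 + l.re + |l.im|) ^ 8 * ‖U (l + 2 * y)‖ ^ 2 := by gcongr
      _ ≤ C * Real.exp (-(2 * K * y)) * ‖U l‖ ^ 2 := h1
      _ = (Real.sqrt C * Real.exp (-(K * y)) * ‖U l‖) ^ 2 := by
        rw [mul_pow, mul_pow, Real.sq_sqrt hC, ← Real.exp_nat_mul]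
        congr 3
        push_cast
        ring
  rw [airyRatio, norm_div, div_mul_eq_mul_div, div_le_iff₀ hU]
  exact h3


theorem hasDerivAt_airyRatio (h : IsScaledAiry U U') (l : ℂ) (y : ℝ) :
    HasDerivAt (airyRatio U l) (airyRatioDeriv U U' l y) y :=
  (h.hasDerivAt_ray l y).div_const _

theorem hasDerivAt_airyRatioDeriv (h : IsScaledAiry U U') (l : ℂ) (y : ℝ) :
    HasDerivAt (airyRatioDeriv U U' l) ((2 * l + 4 * y) * airyRatio U l y) y :=
  ((h.hasDerivAt_ray' l y).div_const _).congr_deriv (mul_div_assoc _ _ _)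

theorem exists_norm_airyRatio_deriv_le (h : IsScaledAiry U U') {b : ℝ} (hb : 0 < b) :
    ∃ C : ℝ, 0 ≤ C ∧ ∀ l : ℂ, 0 ≤ l.re → ∀ y, b ≤ y →
      ‖airyRatio U l y‖ * (1 + ‖l‖) ^ 2 ≤ C ∧
      ‖airyRatioDeriv U U' l y‖ * (1 + ‖l‖) ^ 2 ≤ C ∧
      ‖(2 * l + 4 * y) * airyRatio U l y‖ * (1 + ‖l‖) ^ 2 ≤ C := by
  obtain ⟨C, hC, hbd⟩ := h.exists_norm_airyRatio_le hb zero_le_one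
  have h0 : ∀ l : ℂ, 0 ≤ l.re → ∀ y, b ≤ y → ‖airyRatio U l y‖ ≤ C / (1 + ‖l‖) ^ 2 := by
    intro l hl y hy
    rw [le_div_iff₀ (by positivity)]
    have h1 := hbd l hl y hy
    have h2 : Real.exp (-(1 * y)) ≤ 1 := Real.exp_le_one_iff.2 (by linarith)
    have h3 : (1 + ‖l‖) ^ 2 ≤ (1 + ‖l‖) ^ 4 :=
      pow_le_pow_right₀ (by linarith [norm_nonneg l]) (by norm_num)
    calc _ ≤ ‖airyRatio U l y‖ * (1 + ‖l‖) ^ 4 := by gcongr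
      _ ≤ C * Real.exp (-(1 * y)) := h1
      _ ≤ C := mul_le_of_le_one_right hC h2
  have h2 : ∀ l : ℂ, 0 ≤ l.re → ∀ y, b ≤ y →
      ‖(2 * l + 4 * y) * airyRatio U l y‖ ≤ 6 * C / (1 + ‖l‖) ^ 2 := by
    intro l hl y hy
    rw [le_div_iff₀ (by positivity), norm_mul]
    have h1 := hbd l hl y hy
    have hy0 : 0 ≤ y := hb.le.trans hy
    have h3 : ‖2 * l + 4 * (y : ℂ)‖ ≤ 2 * ‖l‖ + 4 * y := by
      refine (norm_add_le _ _).trans ?_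
      rw [norm_mul, norm_mul, Complex.norm_real, Real.norm_of_nonneg hy0]
      simp
    have h4 : y * Real.exp (-(1 * y)) ≤ 1 := by
      rw [one_mul, Real.exp_neg, ← div_eq_mul_inv, div_le_one (Real.exp_pos _)]
      linarith [Real.add_one_le_exp y]
    have h5 : Real.exp (-(1 * y)) ≤ 1 := Real.exp_le_one_iff.2 (by linarith)
    have hl0 := norm_nonneg l
    calc ‖2 * l + 4 * (y : ℂ)‖ * ‖airyRatio U l y‖ * (1 + ‖l‖) ^ 2
        ≤ (2 * ‖l‖ + 4 * y) * ‖airyRatio U l y‖ * (1 + ‖l‖) ^ 2 := by gcongr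
      _ = (2 * ‖l‖ + 4 * y) * (‖airyRatio U l y‖ * (1 + ‖l‖) ^ 4) / (1 + ‖l‖) ^ 2 := by
        field_simp
      _ ≤ (2 * ‖l‖ + 4 * y) * (C * Real.exp (-(1 * y))) / (1 + ‖l‖) ^ 2 := by gcongr
      _ ≤ 6 * C := by
        rw [div_le_iff₀ (by positivity)]
        have h6 : ‖l‖ * Real.exp (-(1 * y)) ≤ ‖l‖ := mul_le_of_le_one_right hl0 h5
        calc (2 * ‖l‖ + 4 * y) * (C * Real.exp (-(1 * y)))
            = C * (2 * (‖l‖ * Real.exp (-(1 * y))) + 4 * (y * Real.exp (-(1 * y)))) := by ring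
          _ ≤ C * (6 * (1 + ‖l‖) ^ 2) := by
            refine mul_le_mul_of_nonneg_left ?_ hC
            nlinarith
          _ = _ := by ring
  refine ⟨8 * C, by positivity, fun l hl y hy => ⟨?_, ?_, ?_⟩⟩
  · rw [← le_div_iff₀ (by positivity)]
    refine (h0 l hl y hy).trans ?_
    gcongr
    linarith
  · rw [← le_div_iff₀ (by positivity)]
    refine (norm_deriv_le_of_second_deriv (h.hasDerivAt_airyRatio l)
      (h.hasDerivAt_airyRatioDeriv l) (fun t ht => h2 l hl t (hy.trans ht))
      (fun t ht => h0 l hl t (hy.trans ht))).trans (le_of_eq ?_)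
    ring
  · rw [← le_div_iff₀ (by positivity)]
    refine (h2 l hl y hy).trans ?_
    gcongr
    linarith

end IsScaledAiry

theorem one_add_sq_le_one_add_norm_sq (v : ℝ) : 1 + v ^ 2 ≤ (1 + ‖Complex.I * (v : ℂ)‖) ^ 2 := by
  rw [norm_mul, Complex.norm_I, one_mul, Complex.norm_real, Real.norm_eq_abs]
  nlinarith [sq_abs v, abs_nonneg v]

theorem norm_le_mul_inv_of_mul_le {z : ℂ} {C v : ℝ}
    (h : ‖z‖ * (1 + ‖Complex.I * (v : ℂ)‖) ^ 2 ≤ C) : ‖z‖ ≤ C * (1 + v ^ 2)⁻¹ := by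
  rw [← div_eq_mul_inv, le_div_iff₀ (by positivity)]
  exact (mul_le_mul_of_nonneg_left (one_add_sq_le_one_add_norm_sq v) (norm_nonneg z)).trans h

/-- The integral along the imaginary axis of a holomorphic function of quadratic decay on the
right half-plane vanishes. -/
theorem integral_imaginary_axis_eq_zero {H : ℂ → ℂ} {C : ℝ}
    (hd : ∀ z : ℂ, 0 ≤ z.re → DifferentiableAt ℂ H z)
    (hC : ∀ z : ℂ, 0 ≤ z.re → ‖H z‖ * (1 + ‖z‖) ^ 2 ≤ C) :
    ∫ v : ℝ, H (Complex.I * v) = 0 := by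
  have hcont : Continuous fun v : ℝ => H (Complex.I * v) := by
    refine continuous_iff_continuousAt.2 fun v => ?_
    exact (hd (Complex.I * v) (by simp)).continuousAt.comp
      (f := fun v : ℝ => Complex.I * (v : ℂ)) (by fun_prop)
  have hInt : Integrable fun v : ℝ => H (Complex.I * v) :=
    (integrable_inv_one_add_sq.const_mul C).mono' hcont.aestronglyMeasurable
      (Eventually.of_forall fun v => norm_le_mul_inv_of_mul_le (hC _ (by simp)))
  have hC0 : 0 ≤ C := (by positivity : 0 ≤ ‖H 0‖ * (1 + ‖(0 : ℂ)‖) ^ 2).trans (hC 0 le_rfl)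
  have hle : ∀ z : ℂ, ∀ T : ℝ, 0 < T → 0 ≤ z.re → T ≤ ‖z‖ → ‖H z‖ ≤ C / T ^ 2 := by
    intro z T hT hz hTz
    rw [le_div_iff₀ (by positivity)]
    refine le_trans ?_ (hC z hz)
    gcongr
    linarith
  have h1 := intervalIntegral_tendsto_integral hInt tendsto_neg_atTop_atBot tendsto_id
  refine tendsto_nhds_unique h1 ?_
  have hlim : Tendsto (fun T : ℝ => 4 * C / T) atTop (nhds 0) :=
    tendsto_const_nhds.div_atTop tendsto_id
  refine squeeze_zero_norm' ?_ hlim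
  filter_upwards [eventually_gt_atTop 0] with T hT
  have hrect := Complex.integral_boundary_rect_eq_zero_of_differentiableOn H
    (((0 : ℝ) : ℂ) + ((-T : ℝ) : ℂ) * Complex.I) ((T : ℂ) + (T : ℂ) * Complex.I) (by
      intro z hz
      simp only [Complex.mem_reProdIm, Complex.add_re, Complex.ofReal_re, Complex.mul_re,
        Complex.I_re, mul_zero, Complex.ofReal_im, Complex.I_im, mul_one, sub_self, add_zero,
        uIcc_of_le hT.le] at hz
      exact (hd z hz.1.1).differentiableWithinAt)
  simp only [Complex.add_re, Complex.ofReal_re, Complex.mul_re,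
    Complex.I_re, mul_zero, Complex.ofReal_im, Complex.I_im, mul_one, sub_self, add_zero,
    Complex.add_im, Complex.mul_im, zero_add, Complex.ofReal_zero] at hrect
  have hb1 : ‖∫ x in (0 : ℝ)..T, H (x + ((-T : ℝ) : ℂ) * Complex.I)‖ ≤ C / T ^ 2 * |T - 0| := by
    refine intervalIntegral.norm_integral_le_of_norm_le_const fun x hx => ?_
    rw [uIoc_of_le hT.le] at hx
    refine hle _ T hT (by simpa using hx.1.le) ?_
    have := Complex.abs_im_le_norm (x + ((-T : ℝ) : ℂ) * Complex.I)
    simpa [abs_of_pos hT] using this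
  have hb2 : ‖∫ x in (0 : ℝ)..T, H (x + (T : ℂ) * Complex.I)‖ ≤ C / T ^ 2 * |T - 0| := by
    refine intervalIntegral.norm_integral_le_of_norm_le_const fun x hx => ?_
    rw [uIoc_of_le hT.le] at hx
    refine hle _ T hT (by simpa using hx.1.le) ?_
    have := Complex.abs_im_le_norm (x + (T : ℂ) * Complex.I)
    simpa [abs_of_pos hT] using this
  have hb3 : ‖∫ y in (-T)..T, H (T + (y : ℂ) * Complex.I)‖ ≤ C / T ^ 2 * |T - -T| := by
    refine intervalIntegral.norm_integral_le_of_norm_le_const fun y _ => ?_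
    refine hle _ T hT (by simpa using hT.le) ?_
    have := Complex.abs_re_le_norm (T + (y : ℂ) * Complex.I)
    simpa [abs_of_pos hT] using this
  simp only [id]
  simp only [mul_comm _ Complex.I] at hrect hb1 hb2 hb3
  have heq : ∫ y in (-T)..T, H (Complex.I * y) =
      (∫ y in (-T)..T, H (T + Complex.I * (y : ℂ))) -
      Complex.I * (∫ x in (0 : ℝ)..T, H (x + Complex.I * ((-T : ℝ) : ℂ))) +
      Complex.I * (∫ x in (0 : ℝ)..T, H (x + Complex.I * (T : ℂ))) := by
    simp only [smul_eq_mul] at hrect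
    linear_combination (Complex.I) * hrect + ((∫ y in (-T)..T, H (Complex.I * y)) -
      (∫ y in (-T)..T, H (T + Complex.I * (y : ℂ)))) * Complex.I_sq
  rw [heq]
  refine (norm_add_le _ _).trans ((add_le_add_left (norm_sub_le _ _) _).trans ?_)
  rw [norm_mul, norm_mul, Complex.norm_I, one_mul, one_mul]
  rw [sub_zero, abs_of_pos hT] at hb1 hb2
  rw [sub_neg_eq_add, abs_of_pos (by linarith)] at hb3
  have : 4 * C / T = C / T ^ 2 * T + C / T ^ 2 * T + C / T ^ 2 * (T + T) := by
    field_simp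
    ring
  linarith

/-- The one-sided Fourier transform `∫₀^∞ e^{itv} q(t) dt`. -/
def halfLineFourier (q : ℝ → ℝ) (v : ℝ) : ℂ :=
  ∫ t in Ioi (0 : ℝ), Complex.exp (Complex.I * t * v) * (q t : ℂ)

theorem norm_exp_I_mul_mul (t v : ℝ) : ‖Complex.exp (Complex.I * t * v)‖ = 1 := by
  rw [show Complex.I * t * v = ((t * v : ℝ) : ℂ) * Complex.I by push_cast; ring]
  exact Complex.norm_exp_ofReal_mul_I _

theorem integrableOn_exp_neg_const (A : ℝ) :
    IntegrableOn (fun t : ℝ => A * Real.exp (-t)) (Ioi 0) :=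
  (integrableOn_exp_neg_Ioi 0).const_mul A

theorem integrableOn_halfLineFourier {q : ℝ → ℝ} {A : ℝ} (hc : Continuous q)
    (hq : ∀ t, 0 ≤ t → |q t| ≤ A * Real.exp (-t)) (v : ℝ) :
    IntegrableOn (fun t : ℝ => Complex.exp (Complex.I * t * v) * (q t : ℂ)) (Ioi 0) := by
  refine (integrableOn_exp_neg_const A).mono' (by fun_prop) ?_
  filter_upwards [ae_restrict_mem measurableSet_Ioi] with t ht
  rw [norm_mul, norm_exp_I_mul_mul, one_mul, Complex.norm_real]
  exact hq t (le_of_lt ht)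

theorem norm_halfLineFourier_le {q : ℝ → ℝ} {A : ℝ}
    (hq : ∀ t, 0 ≤ t → |q t| ≤ A * Real.exp (-t)) (v : ℝ) :
    ‖halfLineFourier q v‖ ≤ A := by
  have h : ‖halfLineFourier q v‖ ≤ ∫ t in Ioi (0 : ℝ), A * Real.exp (-t) := by
    refine norm_integral_le_of_norm_le (integrableOn_exp_neg_const A) ?_
    filter_upwards [ae_restrict_mem measurableSet_Ioi] with t ht
    rw [norm_mul, norm_exp_I_mul_mul, one_mul, Complex.norm_real]
    exact hq t (le_of_lt ht)
  rwa [integral_const_mul, integral_exp_neg_Ioi_zero, mul_one] at h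

theorem continuous_halfLineFourier {q : ℝ → ℝ} {A : ℝ} (hc : Continuous q)
    (hq : ∀ t, 0 ≤ t → |q t| ≤ A * Real.exp (-t)) : Continuous (halfLineFourier q) := by
  refine continuous_of_dominated (bound := fun t => A * Real.exp (-t)) ?_ ?_
    (integrableOn_exp_neg_const A) ?_
  · intro v
    exact Continuous.aestronglyMeasurable (by fun_prop)
  · intro v
    filter_upwards [ae_restrict_mem measurableSet_Ioi] with t ht
    rw [norm_mul, norm_exp_I_mul_mul, one_mul, Complex.norm_real]
    exact hq t (le_of_lt ht)
  · filter_upwards with t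
    fun_prop

theorem I_mul_halfLineFourier {q q' : ℝ → ℝ} {A B : ℝ} (hq'c : Continuous q')
    (hd : ∀ t, HasDerivAt q (q' t) t)
    (hq : ∀ t, 0 ≤ t → |q t| ≤ A * Real.exp (-t)) (hq' : ∀ t, 0 ≤ t → |q' t| ≤ B * Real.exp (-t))
    (v : ℝ) :
    Complex.I * v * halfLineFourier q v = -(q 0 : ℂ) - halfLineFourier q' v := by
  have hqc : Continuous q := continuous_iff_continuousAt.2 fun t => (hd t).continuousAt
  have hi := integrableOn_halfLineFourier hqc hq v
  have hi' := integrableOn_halfLineFourier hq'c hq' v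
  have hD : ∀ t : ℝ, HasDerivAt (fun t : ℝ => Complex.exp (Complex.I * t * v) * (q t : ℂ))
      (Complex.I * v * (Complex.exp (Complex.I * t * v) * (q t : ℂ))
        + Complex.exp (Complex.I * t * v) * (q' t : ℂ)) t := by
    intro t
    have h1 : HasDerivAt (fun t : ℝ => Complex.I * (t : ℂ) * v) (Complex.I * 1 * v) t :=
      ((Complex.ofRealCLM.hasDerivAt (x := t)).const_mul Complex.I).mul_const (v : ℂ)
    refine (h1.cexp.mul (hd t).ofReal_comp).congr_deriv ?_
    ring
  have hlim : Tendsto (fun t : ℝ => Complex.exp (Complex.I * t * v) * (q t : ℂ)) atTop (nhds 0) := by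
    have h0 : Tendsto (fun t : ℝ => A * Real.exp (-t)) atTop (nhds 0) := by
      simpa using (Real.tendsto_exp_neg_atTop_nhds_zero).const_mul A
    refine squeeze_zero_norm' ?_ h0
    filter_upwards [eventually_ge_atTop 0] with t ht
    rw [norm_mul, norm_exp_I_mul_mul, one_mul, Complex.norm_real]
    exact hq t ht
  have key := integral_Ioi_of_hasDerivAt_of_tendsto' (a := 0) (fun t _ => hD t)
    ((hi.const_mul (Complex.I * v)).add hi') hlim
  rw [integral_add (hi.const_mul _) hi', integral_const_mul] at key
  unfold halfLineFourier
  rw [eq_sub_iff_add_eq, key]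
  simp

/-- The boundary datum `e^{-(2/3)u³}`. -/
def cubicExp (u : ℝ) : ℝ := Real.exp (-(2 / 3) * u ^ 3)

/-- The first derivative of `cubicExp`. -/
def cubicExpDeriv (u : ℝ) : ℝ := -2 * u ^ 2 * cubicExp u

/-- The second derivative of `cubicExp`. -/
def cubicExpDeriv2 (u : ℝ) : ℝ := (4 * u ^ 4 - 4 * u) * cubicExp u

theorem cubicExp_pos (u : ℝ) : 0 < cubicExp u := Real.exp_pos _

theorem continuous_cubicExp : Continuous cubicExp := by unfold cubicExp; fun_prop

theorem continuous_cubicExpDeriv : Continuous cubicExpDeriv := by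
  unfold cubicExpDeriv cubicExp; fun_prop

theorem continuous_cubicExpDeriv2 : Continuous cubicExpDeriv2 := by
  unfold cubicExpDeriv2 cubicExp; fun_prop

theorem hasDerivAt_cubicExp (u : ℝ) : HasDerivAt cubicExp (cubicExpDeriv u) u := by
  have h := ((hasDerivAt_pow 3 u).const_mul (-(2 / 3) : ℝ)).exp
  refine h.congr_deriv ?_
  unfold cubicExpDeriv cubicExp
  norm_num
  ring

theorem hasDerivAt_cubicExpDeriv (u : ℝ) :
    HasDerivAt cubicExpDeriv (cubicExpDeriv2 u) u := by
  have h := ((hasDerivAt_pow 2 u).const_mul (-2 : ℝ)).mul (hasDerivAt_cubicExp u)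
  refine h.congr_deriv ?_
  unfold cubicExpDeriv2 cubicExpDeriv
  norm_num
  ring

theorem exists_cubicExp_le (S : ℝ) :
    ∃ C, 0 ≤ C ∧ ∀ u, S ≤ u → (1 + u ^ 4) * cubicExp u ≤ C * Real.exp (-u) := by
  refine ⟨25 * Real.exp (2 * |S| + 2 + 2 / 3 * |S| ^ 3), by positivity, fun u hu => ?_⟩
  have h4 : 1 + u ^ 4 ≤ 25 * Real.exp |u| := by
    have h := Real.pow_div_factorial_le_exp |u| (abs_nonneg u) 4
    have h1 := Real.one_le_exp (abs_nonneg u)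
    rw [show |u| ^ 4 = u ^ 4 from by rw [show (4 : ℕ) = 2 * 2 from rfl, pow_mul, sq_abs, pow_mul]] at h
    norm_num [Nat.factorial] at h
    linarith
  have hexp : |u| + -(2 / 3) * u ^ 3 ≤ (2 * |S| + 2 + 2 / 3 * |S| ^ 3) + -u := by
    have hS := abs_nonneg S
    have hS3 : 0 ≤ |S| ^ 3 := by positivity
    rcases le_total 0 u with h | h
    · rw [abs_of_nonneg h]
      nlinarith [mul_nonneg h (sq_nonneg (u - 1)), sq_nonneg (u - 1)]
    · have h1 : |u| ≤ |S| := by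
        rw [abs_of_nonpos h]
        linarith [neg_abs_le S]
      have h2 : |u| ^ 3 ≤ |S| ^ 3 := pow_le_pow_left₀ (abs_nonneg u) h1 3
      have h3 : |u| ^ 3 = -u ^ 3 := by rw [abs_of_nonpos h]; ring
      have h4 : |u| = -u := abs_of_nonpos h
      linarith
  calc (1 + u ^ 4) * cubicExp u ≤ 25 * Real.exp |u| * cubicExp u :=
        mul_le_mul_of_nonneg_right h4 (cubicExp_pos u).le
    _ = 25 * Real.exp (|u| + -(2 / 3) * u ^ 3) := by rw [Real.exp_add, cubicExp, mul_assoc]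
    _ ≤ 25 * Real.exp ((2 * |S| + 2 + 2 / 3 * |S| ^ 3) + -u) := by gcongr
    _ = _ := by rw [Real.exp_add, mul_assoc]

/-- All three functions are bounded by multiples of `e^{-u}` on half-lines. -/
theorem exists_cubicExp_bounds (S : ℝ) :
    ∃ C, 0 ≤ C ∧ ∀ s, S ≤ s → ∀ t, 0 ≤ t →
      |cubicExp (s + t)| ≤ C * Real.exp (-s) * Real.exp (-t) ∧
      |cubicExpDeriv (s + t)| ≤ C * Real.exp (-s) * Real.exp (-t) ∧
      |cubicExpDeriv2 (s + t)| ≤ C * Real.exp (-s) * Real.exp (-t) := by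
  obtain ⟨C, hC, h⟩ := exists_cubicExp_le S
  refine ⟨8 * C, by positivity, fun s hs t ht => ?_⟩
  have hk := h (s + t) (by linarith)
  rw [neg_add, Real.exp_add, ← mul_assoc] at hk
  set u := s + t
  have hp := cubicExp_pos u
  have h1 : (1 : ℝ) ≤ 8 * (1 + u ^ 4) := by nlinarith [sq_nonneg (u ^ 2)]
  have h2 : |(-2 * u ^ 2)| ≤ 8 * (1 + u ^ 4) := by
    rw [abs_le]; constructor <;> nlinarith [sq_nonneg (u ^ 2 - 1), sq_nonneg (u ^ 2)]
  have h3 : |4 * u ^ 4 - 4 * u| ≤ 8 * (1 + u ^ 4) := by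
    rw [abs_le]
    constructor <;> nlinarith [sq_nonneg (u ^ 2 - 1), sq_nonneg (u ^ 2), sq_nonneg (u - 1),
      sq_nonneg (u + 1)]
  have hfin : ∀ c : ℝ, |c| ≤ 8 * (1 + u ^ 4) →
      |c * cubicExp u| ≤ 8 * C * Real.exp (-s) * Real.exp (-t) := by
    intro c hc
    rw [abs_mul, abs_of_pos hp]
    calc |c| * cubicExp u ≤ 8 * (1 + u ^ 4) * cubicExp u :=
          mul_le_mul_of_nonneg_right hc hp.le
      _ = 8 * ((1 + u ^ 4) * cubicExp u) := by ring
      _ ≤ 8 * (C * Real.exp (-s) * Real.exp (-t)) := by linarith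
      _ = _ := by ring
  refine ⟨?_, hfin _ h2, hfin _ h3⟩
  simpa using hfin 1 (by simpa using h1)

/-- `∫₀^∞ e^{itv - (2/3)(s+t)³} dt`. -/
def cubicTail (s v : ℝ) : ℂ := halfLineFourier (fun t => cubicExp (s + t)) v

/-- The derivative of `cubicTail` in `s`. -/
def cubicTailDeriv (s v : ℝ) : ℂ :=
  halfLineFourier (fun t => cubicExpDeriv (s + t)) v

theorem cubicTail_eq (s v : ℝ) :
    (∫ t in Ioi (0:ℝ), Complex.exp (Complex.I * t * v - (2/3) * ((s : ℂ) + t) ^ 3))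
      = cubicTail s v := by
  unfold cubicTail halfLineFourier cubicExp
  congr 1
  ext t
  rw [Complex.ofReal_exp, ← Complex.exp_add]
  congr 1
  push_cast
  ring

theorem exists_norm_cubicTail_le (S : ℝ) :
    ∃ C, 0 ≤ C ∧ ∀ s, S ≤ s → ∀ v, ‖cubicTail s v‖ ≤ C * Real.exp (-s) ∧
      ‖cubicTailDeriv s v‖ ≤ C * Real.exp (-s) := by
  obtain ⟨C, hC, h⟩ := exists_cubicExp_bounds S
  exact ⟨C, hC, fun s hs v => ⟨norm_halfLineFourier_le (fun t ht => (h s hs t ht).1) v,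
    norm_halfLineFourier_le (fun t ht => (h s hs t ht).2.1) v⟩⟩

theorem continuous_cubicExp_add (s : ℝ) : Continuous fun t => cubicExp (s + t) :=
  continuous_cubicExp.comp (by fun_prop)

theorem continuous_cubicExpDeriv_add (s : ℝ) : Continuous fun t => cubicExpDeriv (s + t) :=
  continuous_cubicExpDeriv.comp (by fun_prop)

theorem continuous_cubicExpDeriv2_add (s : ℝ) : Continuous fun t => cubicExpDeriv2 (s + t) :=
  continuous_cubicExpDeriv2.comp (by fun_prop)

theorem continuous_cubicTail (s : ℝ) : Continuous (cubicTail s) := by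
  obtain ⟨C, hC, h⟩ := exists_cubicExp_bounds s
  exact continuous_halfLineFourier (continuous_cubicExp_add s) fun t ht => (h s le_rfl t ht).1

theorem continuous_cubicTailDeriv (s : ℝ) : Continuous (cubicTailDeriv s) := by
  obtain ⟨C, hC, h⟩ := exists_cubicExp_bounds s
  exact continuous_halfLineFourier (continuous_cubicExpDeriv_add s)
    fun t ht => (h s le_rfl t ht).2.1

theorem cubicTailDeriv_eq (s v : ℝ) :
    cubicTailDeriv s v = -(Complex.I * v * cubicTail s v) - cubicExp s := by
  obtain ⟨C, hC, h⟩ := exists_cubicExp_bounds s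
  have := I_mul_halfLineFourier (continuous_cubicExpDeriv_add s)
    (fun t => (hasDerivAt_cubicExp (s + t)).comp_const_add s t)
    (fun t ht => (h s le_rfl t ht).1) (fun t ht => (h s le_rfl t ht).2.1) v
  unfold cubicTailDeriv cubicTail
  rw [this]
  simp

theorem hasDerivAt_cubicTail (s v : ℝ) :
    HasDerivAt (fun s => cubicTail s v) (cubicTailDeriv s v) s := by
  obtain ⟨C, hC, h⟩ := exists_cubicExp_bounds (s - 1)
  have hb : ∀ s' ∈ Ioi (s - 1), ∀ t : ℝ, 0 ≤ t →
      |cubicExpDeriv (s' + t)| ≤ C * Real.exp (-(s - 1)) * Real.exp (-t) := by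
    intro s' hs' t ht
    refine ((h s' (le_of_lt hs') t ht).2.1).trans ?_
    have : Real.exp (-s') ≤ Real.exp (-(s - 1)) :=
      Real.exp_le_exp.2 (by linarith [mem_Ioi.1 hs'])
    gcongr
  refine (hasDerivAt_integral_of_dominated_loc_of_deriv_le (Ioi_mem_nhds (sub_one_lt s))
    (F := fun s (t : ℝ) => Complex.exp (Complex.I * t * v) * (cubicExp (s + t) : ℂ))
    (F' := fun s (t : ℝ) => Complex.exp (Complex.I * t * v) * (cubicExpDeriv (s + t) : ℂ))
    (bound := fun t => C * Real.exp (-(s - 1)) * Real.exp (-t)) ?_ ?_ ?_ ?_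
    (integrableOn_exp_neg_const _) ?_).2
  · filter_upwards with s'
    have := continuous_cubicExp_add s'
    exact Continuous.aestronglyMeasurable (by fun_prop)
  · exact integrableOn_halfLineFourier (continuous_cubicExp_add s)
      (fun t ht => (h s (by linarith) t ht).1) v
  · have := continuous_cubicExpDeriv_add s
    exact Continuous.aestronglyMeasurable (by fun_prop)
  · filter_upwards [ae_restrict_mem measurableSet_Ioi] with t ht s' hs'
    rw [norm_mul, norm_exp_I_mul_mul, one_mul, Complex.norm_real]
    exact hb s' hs' t (le_of_lt ht)
  · filter_upwards with t s' _
    exact (((hasDerivAt_cubicExp (s' + t)).comp_add_const s' t).ofReal_comp).const_mul _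

/-- The Fourier transform of the continuous extension of `t ↦ e^{-(2/3)(s+t)³}` by
`e^{-(2/3)s³ + t}` to the negative half-line. -/
def cubicTailReg (s v : ℝ) : ℂ := cubicTail s v + cubicExp s / (1 + Complex.I * v)

theorem one_add_I_mul_ne_zero (v : ℝ) : (1 + Complex.I * v : ℂ) ≠ 0 := by
  intro h
  have := congrArg Complex.re h
  simp at this

theorem norm_one_add_I_mul_sq (v : ℝ) : ‖(1 + Complex.I * v : ℂ)‖ ^ 2 = 1 + v ^ 2 := by
  rw [← Complex.normSq_eq_norm_sq, Complex.normSq_apply]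
  simp
  ring

theorem continuous_cubicTailReg (s : ℝ) : Continuous (cubicTailReg s) := by
  have := continuous_cubicTail s
  unfold cubicTailReg
  exact this.add (continuous_const.div (by fun_prop) one_add_I_mul_ne_zero)

theorem exists_norm_cubicTailReg_le (S : ℝ) :
    ∃ C, 0 ≤ C ∧ ∀ s, S ≤ s → ∀ v, ‖cubicTailReg s v‖ ≤ C * (1 + v ^ 2)⁻¹ := by
  obtain ⟨C, hC, h⟩ := exists_cubicExp_bounds S
  refine ⟨6 * (C * Real.exp (-S)), by positivity, fun s hs v => ?_⟩
  have hb := h s hs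
  have e1 := I_mul_halfLineFourier (continuous_cubicExpDeriv_add s)
    (fun t => (hasDerivAt_cubicExp (s + t)).comp_const_add s t)
    (fun t ht => (hb t ht).1) (fun t ht => (hb t ht).2.1) v
  have e2 := I_mul_halfLineFourier (continuous_cubicExpDeriv2_add s)
    (fun t => (hasDerivAt_cubicExpDeriv (s + t)).comp_const_add s t)
    (fun t ht => (hb t ht).2.1) (fun t ht => (hb t ht).2.2) v
  have n0 := norm_halfLineFourier_le (fun t ht => (hb t ht).1) v
  have n1 := norm_halfLineFourier_le (fun t ht => (hb t ht).2.1) v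
  have n2 := norm_halfLineFourier_le (fun t ht => (hb t ht).2.2) v
  have b0 := (hb 0 le_rfl).1
  have b1 := (hb 0 le_rfl).2.1
  simp only [add_zero, neg_zero, Real.exp_zero, mul_one] at e1 e2 b0 b1
  set H0 := halfLineFourier (fun t => cubicExp (s + t)) v with hH0
  set H1 := halfLineFourier (fun t => cubicExpDeriv (s + t)) v
  set H2 := halfLineFourier (fun t => cubicExpDeriv2 (s + t)) v
  have hne := one_add_I_mul_ne_zero v
  have e3 : (1 + Complex.I * v) ^ 2 * cubicTailReg s v
      = H0 - H1 - H1 + H2 - cubicExp s + cubicExpDeriv s := by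
    have : (1 + Complex.I * v) * cubicTailReg s v = H0 - H1 := by
      unfold cubicTailReg cubicTail
      rw [← hH0, mul_add, mul_div_cancel₀ _ hne]
      linear_combination e1
    rw [sq, mul_assoc, this]
    linear_combination e1 - e2
  have hes : Real.exp (-s) ≤ Real.exp (-S) := Real.exp_le_exp.2 (by linarith)
  have hes' : C * Real.exp (-s) ≤ C * Real.exp (-S) := by gcongr
  have n3 : (1 + v ^ 2) * ‖cubicTailReg s v‖ ≤ 6 * (C * Real.exp (-S)) := by
    rw [← norm_one_add_I_mul_sq, ← norm_pow, ← norm_mul, e3]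
    have b0' : ‖(cubicExp s : ℂ)‖ ≤ C * Real.exp (-s) := by rwa [Complex.norm_real]
    have b1' : ‖(cubicExpDeriv s : ℂ)‖ ≤ C * Real.exp (-s) := by rwa [Complex.norm_real]
    have t1 := norm_add_le (H0 - H1 - H1 + H2 - cubicExp s) (cubicExpDeriv s : ℂ)
    have t2 := norm_sub_le (H0 - H1 - H1 + H2) (cubicExp s : ℂ)
    have t3 := norm_add_le (H0 - H1 - H1) H2
    have t4 := norm_sub_le (H0 - H1) H1
    have t5 := norm_sub_le H0 H1
    linarith
  rw [← div_eq_mul_inv, le_div_iff₀ (by positivity)]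
  linarith

theorem integrable_cubicTailReg (s : ℝ) : Integrable (cubicTailReg s) := by
  obtain ⟨C, hC, h⟩ := exists_norm_cubicTailReg_le s
  refine (integrable_inv_one_add_sq.const_mul C).mono'
    (continuous_cubicTailReg s).aestronglyMeasurable ?_
  filter_upwards with v using h s le_rfl v

open FourierTransform in
theorem integral_cubicTailReg (s : ℝ) :
    ∫ v, cubicTailReg s v = 2 * Real.pi * cubicExp s := by
  obtain ⟨C, hC, h⟩ := exists_cubicExp_bounds s
  set k : ℝ → ℂ := fun t => if t ≤ 0 then ((cubicExp s * Real.exp t : ℝ) : ℂ)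
    else (cubicExp (s + t) : ℂ) with hk
  have hkc : Continuous k := by
    have := continuous_cubicExp_add s
    refine Continuous.if_le (by fun_prop) (by fun_prop) continuous_id continuous_const ?_
    intro t ht
    rw [ht]
    simp
  have hInt : Integrable k := by
    rw [← integrableOn_univ, ← Iic_union_Ioi (a := (0 : ℝ))]
    refine IntegrableOn.union ?_ ?_
    · have h1 : IntegrableOn (fun t => ((cubicExp s * Real.exp t : ℝ) : ℂ)) (Iic 0) :=
        ((integrableOn_exp_Iic 0).const_mul (cubicExp s)).ofReal
      refine h1.congr_fun (fun t ht => ?_) measurableSet_Iic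
      simp only [hk, if_pos (mem_Iic.1 ht)]
    · refine (integrableOn_exp_neg_const (C * Real.exp (-s))).mono' hkc.aestronglyMeasurable ?_
      filter_upwards [ae_restrict_mem measurableSet_Ioi] with t ht
      simp only [hk, if_neg (not_le.2 (mem_Ioi.1 ht)), Complex.norm_real]
      exact (h s le_rfl t (le_of_lt ht)).1
  have hF : ∀ w, 𝓕 k w = cubicTailReg s (w * (-2 * Real.pi)) := by
    intro w
    rw [Real.fourier_real_eq_integral_exp_smul]
    set v := w * (-2 * Real.pi) with hv
    have hInt' : Integrable fun t : ℝ => Complex.exp (Complex.I * t * v) * k t := by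
      refine hInt.norm.mono' (by fun_prop) ?_
      filter_upwards with t
      rw [norm_mul, norm_exp_I_mul_mul, one_mul]
    have e0 : (∫ t : ℝ, Complex.exp (↑(-2 * Real.pi * t * w) * Complex.I) • k t)
        = ∫ t : ℝ, Complex.exp (Complex.I * t * v) * k t := by
      congr 1
      ext t
      rw [smul_eq_mul, hv]
      congr 2
      push_cast
      ring
    rw [e0, ← integral_add_compl measurableSet_Ioi hInt', compl_Ioi]
    unfold cubicTailReg cubicTail halfLineFourier
    congr 1
    · refine setIntegral_congr_fun measurableSet_Ioi fun t ht => ?_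
      simp only [hk, if_neg (not_le.2 (mem_Ioi.1 ht))]
    · have e1 : (∫ t in Iic (0:ℝ), Complex.exp (Complex.I * t * v) * k t)
          = ∫ t in Iic (0:ℝ), (cubicExp s : ℂ) * Complex.exp ((1 + Complex.I * v) * t) := by
        refine setIntegral_congr_fun measurableSet_Iic fun t ht => ?_
        simp only [hk, if_pos (mem_Iic.1 ht)]
        push_cast
        rw [mul_left_comm, ← Complex.exp_add]
        congr 2
        ring
      rw [e1, integral_const_mul, integral_exp_mul_complex_Iic (by simp)]
      simp [div_eq_mul_inv]
  have hFint : Integrable (𝓕 k) := by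
    have : 𝓕 k = fun w => cubicTailReg s (w * (-2 * Real.pi)) := funext hF
    rw [this]
    exact (integrable_cubicTailReg s).comp_mul_right' (by simp [Real.pi_ne_zero])
  have hinv := hInt.fourierInv_fourier_eq hFint (v := 0) hkc.continuousAt
  rw [Real.fourierInv_eq] at hinv
  simp only [inner_zero_right, hF] at hinv
  simp only [AddChar.map_zero_eq_one, one_smul] at hinv
  rw [Measure.integral_comp_mul_right (cubicTailReg s)] at hinv
  have hk0 : k 0 = cubicExp s := by simp [hk]
  rw [hk0] at hinv
  rw [← hinv]
  have hpi := Real.pi_pos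
  have habs : |(-2 * Real.pi)⁻¹| = (2 * Real.pi)⁻¹ := by
    rw [abs_inv, abs_mul, abs_of_pos hpi]; norm_num
  rw [habs, Complex.real_smul]
  push_cast
  have : (Real.pi : ℂ) ≠ 0 := by exact_mod_cast hpi.ne'
  field_simp

/-- The integral `∫ airyRatio U (iv) y · cubicTail s v dv`. -/
def airyTransform (U : ℂ → ℂ) (s y : ℝ) : ℂ :=
  ∫ v : ℝ, airyRatio U (Complex.I * v) y * cubicTail s v

/-- The first derivative of `airyTransform` in `y`. -/
def airyTransformDeriv (U U' : ℂ → ℂ) (s y : ℝ) : ℂ :=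
  ∫ v : ℝ, airyRatioDeriv U U' (Complex.I * v) y * cubicTail s v

/-- The second derivative of `airyTransform` in `y`. -/
def airyTransformDeriv2 (U : ℂ → ℂ) (s y : ℝ) : ℂ :=
  ∫ v : ℝ, ((2 * (Complex.I * v) + 4 * y) * airyRatio U (Complex.I * v) y) * cubicTail s v

theorem re_I_mul_nonneg (v : ℝ) : 0 ≤ (Complex.I * (v : ℂ)).re := by simp

namespace IsScaledAiry

variable {U U' : ℂ → ℂ}

theorem continuous_airyRatio (h : IsScaledAiry U U') (y : ℝ) :
    Continuous fun v : ℝ => airyRatio U (Complex.I * v) y := by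
  have := h.differentiable.continuous
  unfold airyRatio
  exact Continuous.div (by fun_prop) (by fun_prop) fun v => h.ne_zero (re_I_mul_nonneg v)

theorem continuous_airyRatioDeriv (h : IsScaledAiry U U') (y : ℝ) :
    Continuous fun v : ℝ => airyRatioDeriv U U' (Complex.I * v) y := by
  have := h.differentiable.continuous
  have := h.differentiable'.continuous
  unfold airyRatioDeriv
  exact Continuous.div (by fun_prop) (by fun_prop) fun v => h.ne_zero (re_I_mul_nonneg v)

theorem exists_norm_airyRatio_imaginary_le (h : IsScaledAiry U U') {b : ℝ} (hb : 0 < b) :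
    ∃ C, 0 ≤ C ∧ ∀ v y : ℝ, b ≤ y →
      ‖airyRatio U (Complex.I * v) y‖ ≤ C * (1 + v ^ 2)⁻¹ ∧
      ‖airyRatioDeriv U U' (Complex.I * v) y‖ ≤ C * (1 + v ^ 2)⁻¹ ∧
      ‖(2 * (Complex.I * v) + 4 * y) * airyRatio U (Complex.I * v) y‖ ≤ C * (1 + v ^ 2)⁻¹ := by
  obtain ⟨C, hC, hR⟩ := h.exists_norm_airyRatio_deriv_le hb
  refine ⟨C, hC, fun v y hy => ?_⟩
  obtain ⟨h1, h2, h3⟩ := hR _ (re_I_mul_nonneg v) y hy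
  exact ⟨norm_le_mul_inv_of_mul_le h1, norm_le_mul_inv_of_mul_le h2, norm_le_mul_inv_of_mul_le h3⟩

theorem integral_airyRatio_eq_zero (h : IsScaledAiry U U') {y : ℝ} (hy : 0 < y) :
    ∫ v : ℝ, airyRatio U (Complex.I * v) y = 0 := by
  obtain ⟨C, hC, hR⟩ := h.exists_norm_airyRatio_deriv_le hy
  refine integral_imaginary_axis_eq_zero (H := fun z => airyRatio U z y) (C := C) ?_
    fun z hz => (hR z hz y le_rfl).1
  intro z hz
  have := h.differentiable
  unfold airyRatio
  exact DifferentiableAt.div (by fun_prop) (by fun_prop) (h.ne_zero hz)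

theorem integral_airyRatio_div_eq_zero (h : IsScaledAiry U U') {y : ℝ} (hy : 0 < y) :
    ∫ v : ℝ, airyRatio U (Complex.I * v) y / (1 + Complex.I * v) = 0 := by
  obtain ⟨C, hC, hR⟩ := h.exists_norm_airyRatio_deriv_le hy
  have hn : ∀ z : ℂ, 0 ≤ z.re → 1 ≤ ‖1 + z‖ := fun z hz => by
    refine le_trans ?_ (Complex.re_le_norm _)
    simp [hz]
  refine integral_imaginary_axis_eq_zero (H := fun z => airyRatio U z y / (1 + z)) (C := C) ?_ ?_
  · intro z hz
    have := h.differentiable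
    have hz1 : (1 + z : ℂ) ≠ 0 := by
      rw [← norm_pos_iff]; linarith [hn z hz]
    unfold airyRatio
    exact (DifferentiableAt.div (by fun_prop) (by fun_prop) (h.ne_zero hz)).div (by fun_prop) hz1
  · intro z hz
    refine le_trans ?_ (hR z hz y le_rfl).1
    rw [norm_div]
    exact mul_le_mul_of_nonneg_right (div_le_self (norm_nonneg _) (hn z hz)) (by positivity)

theorem integrable_mul {Φ Ψ : ℝ → ℂ} {A B : ℝ} (hΦ : Continuous Φ) (hΨ : Continuous Ψ)
    (hA : ∀ v, ‖Φ v‖ ≤ A * (1 + v ^ 2)⁻¹) (hB : ∀ v, ‖Ψ v‖ ≤ B) :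
    Integrable fun v => Φ v * Ψ v := by
  refine ((integrable_inv_one_add_sq.const_mul A).mul_const B).mono'
    (hΦ.mul hΨ).aestronglyMeasurable ?_
  filter_upwards with v
  rw [norm_mul]
  exact mul_le_mul (hA v) (hB v) (norm_nonneg _) ((norm_nonneg _).trans (hA v))

theorem airyTransform_eq (h : IsScaledAiry U U') (s : ℝ) {y : ℝ} (hy : 0 < y) :
    airyTransform U s y = ∫ v : ℝ, airyRatio U (Complex.I * v) y * cubicTailReg s v := by
  obtain ⟨C, hC, hR⟩ := h.exists_norm_airyRatio_imaginary_le hy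
  obtain ⟨D, hD, hL⟩ := exists_norm_cubicTail_le s
  have hi := integrable_mul (h.continuous_airyRatio y) (continuous_cubicTail s)
    (fun v => (hR v y le_rfl).1) fun v => (hL s le_rfl v).1
  have hi2 : Integrable fun v : ℝ => airyRatio U (Complex.I * v) y * (1 + Complex.I * v)⁻¹ := by
    refine integrable_mul (h.continuous_airyRatio y)
      (Continuous.inv₀ (by fun_prop) one_add_I_mul_ne_zero)
      (fun v => (hR v y le_rfl).1) (B := 1) fun v => ?_
    rw [norm_inv]
    refine inv_le_one_of_one_le₀ (le_trans ?_ (Complex.re_le_norm _))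
    simp
  have e : ∀ v : ℝ, airyRatio U (Complex.I * v) y * cubicTailReg s v
      = airyRatio U (Complex.I * v) y * cubicTail s v
        + airyRatio U (Complex.I * v) y * (1 + Complex.I * v)⁻¹ * cubicExp s := by
    intro v
    unfold cubicTailReg
    ring
  simp_rw [e]
  rw [integral_add hi (hi2.mul_const _), integral_mul_const]
  have hz := h.integral_airyRatio_div_eq_zero hy
  simp_rw [div_eq_mul_inv] at hz
  rw [hz, zero_mul, add_zero, airyTransform]

theorem hasDerivAt_airyTransform (h : IsScaledAiry U U') (s : ℝ) {y : ℝ} (hy : 0 < y) :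
    HasDerivAt (airyTransform U s) (airyTransformDeriv U U' s y) y := by
  obtain ⟨C, hC, hR⟩ := h.exists_norm_airyRatio_imaginary_le (half_pos hy)
  obtain ⟨D, hD, hL⟩ := exists_norm_cubicTail_le s
  refine (hasDerivAt_integral_of_dominated_loc_of_deriv_le (Ioi_mem_nhds (half_lt_self hy))
    (F := fun y (v : ℝ) => airyRatio U (Complex.I * v) y * cubicTail s v)
    (F' := fun y (v : ℝ) => airyRatioDeriv U U' (Complex.I * v) y * cubicTail s v)
    (bound := fun v => C * (1 + v ^ 2)⁻¹ * (D * Real.exp (-s))) ?_ ?_ ?_ ?_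
    ((integrable_inv_one_add_sq.const_mul C).mul_const _) ?_).2
  · filter_upwards with y'
    exact ((h.continuous_airyRatio y').mul (continuous_cubicTail s)).aestronglyMeasurable
  · exact integrable_mul (h.continuous_airyRatio y) (continuous_cubicTail s)
      (fun v => (hR v y (by linarith)).1) fun v => (hL s le_rfl v).1
  · exact ((h.continuous_airyRatioDeriv y).mul (continuous_cubicTail s)).aestronglyMeasurable
  · filter_upwards with v y' hy'
    rw [norm_mul]
    exact mul_le_mul (hR v y' (le_of_lt hy')).2.1 (hL s le_rfl v).1 (norm_nonneg _)
      (by positivity)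
  · filter_upwards with v y' _
    exact (h.hasDerivAt_airyRatio _ y').mul_const _

theorem hasDerivAt_airyTransformDeriv (h : IsScaledAiry U U') (s : ℝ) {y : ℝ} (hy : 0 < y) :
    HasDerivAt (airyTransformDeriv U U' s) (airyTransformDeriv2 U s y) y := by
  obtain ⟨C, hC, hR⟩ := h.exists_norm_airyRatio_imaginary_le (half_pos hy)
  obtain ⟨D, hD, hL⟩ := exists_norm_cubicTail_le s
  refine (hasDerivAt_integral_of_dominated_loc_of_deriv_le (Ioi_mem_nhds (half_lt_self hy))
    (F := fun y (v : ℝ) => airyRatioDeriv U U' (Complex.I * v) y * cubicTail s v)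
    (F' := fun y (v : ℝ) =>
      ((2 * (Complex.I * v) + 4 * y) * airyRatio U (Complex.I * v) y) * cubicTail s v)
    (bound := fun v => C * (1 + v ^ 2)⁻¹ * (D * Real.exp (-s))) ?_ ?_ ?_ ?_
    ((integrable_inv_one_add_sq.const_mul C).mul_const _) ?_).2
  · filter_upwards with y'
    exact ((h.continuous_airyRatioDeriv y').mul (continuous_cubicTail s)).aestronglyMeasurable
  · exact integrable_mul (h.continuous_airyRatioDeriv y) (continuous_cubicTail s)
      (fun v => (hR v y (by linarith)).2.1) fun v => (hL s le_rfl v).1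
  · have := h.continuous_airyRatio y
    have := continuous_cubicTail s
    exact Continuous.aestronglyMeasurable (by fun_prop)
  · filter_upwards with v y' hy'
    rw [norm_mul]
    exact mul_le_mul (hR v y' (le_of_lt hy')).2.2 (hL s le_rfl v).1 (norm_nonneg _)
      (by positivity)
  · filter_upwards with v y' _
    exact (h.hasDerivAt_airyRatioDeriv _ y').mul_const _

theorem exists_norm_cubicTail_le_nhds (s : ℝ) :
    ∃ C, 0 ≤ C ∧ ∀ s', s - 1 ≤ s' → ∀ v, ‖cubicTail s' v‖ ≤ C ∧ ‖cubicTailDeriv s' v‖ ≤ C := by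
  obtain ⟨D, hD, hL⟩ := exists_norm_cubicTail_le (s - 1)
  refine ⟨D * Real.exp (-(s - 1)), by positivity, fun s' hs' v => ?_⟩
  have : D * Real.exp (-s') ≤ D * Real.exp (-(s - 1)) :=
    mul_le_mul_of_nonneg_left (Real.exp_le_exp.2 (by linarith)) hD
  exact ⟨(hL s' hs' v).1.trans this, (hL s' hs' v).2.trans this⟩

theorem hasDerivAt_airyTransform_left (h : IsScaledAiry U U') (s : ℝ) {y : ℝ} (hy : 0 < y) :
    HasDerivAt (fun s => airyTransform U s y)
      (-(1 / 2) * airyTransformDeriv2 U s y + 2 * y * airyTransform U s y) s := by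
  obtain ⟨C, hC, hR⟩ := h.exists_norm_airyRatio_imaginary_le hy
  obtain ⟨D, hD, hL⟩ := exists_norm_cubicTail_le_nhds s
  have hi : Integrable fun v : ℝ => airyRatio U (Complex.I * v) y * cubicTail s v :=
    integrable_mul (h.continuous_airyRatio y) (continuous_cubicTail s)
      (fun v => (hR v y le_rfl).1) fun v => (hL s (by linarith) v).1
  have key := (hasDerivAt_integral_of_dominated_loc_of_deriv_le (Ioi_mem_nhds (sub_one_lt s))
    (F := fun s (v : ℝ) => airyRatio U (Complex.I * v) y * cubicTail s v)
    (F' := fun s (v : ℝ) => airyRatio U (Complex.I * v) y * cubicTailDeriv s v)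
    (μ := volume)
    (bound := fun v => C * (1 + v ^ 2)⁻¹ * D) ?_ hi ?_ ?_
    ((integrable_inv_one_add_sq.const_mul C).mul_const _) ?_).2
  rotate_left
  · filter_upwards with s'
    exact ((h.continuous_airyRatio y).mul (continuous_cubicTail s')).aestronglyMeasurable
  · exact ((h.continuous_airyRatio y).mul (continuous_cubicTailDeriv s)).aestronglyMeasurable
  · filter_upwards with v s' hs'
    rw [norm_mul]
    exact mul_le_mul (hR v y le_rfl).1 (hL s' (le_of_lt hs') v).2 (norm_nonneg _)
      (by positivity)
  · filter_upwards with v s' _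
    exact (hasDerivAt_cubicTail s' v).const_mul _
  refine key.congr_deriv ?_
  have hc := h.continuous_airyRatio y
  have hi2 : Integrable fun v : ℝ =>
      ((2 * (Complex.I * v) + 4 * y) * airyRatio U (Complex.I * v) y) * cubicTail s v :=
    integrable_mul (by fun_prop) (continuous_cubicTail s)
      (fun v => (hR v y le_rfl).2.2) fun v => (hL s (by linarith) v).1
  have hi3 : Integrable fun v : ℝ => airyRatio U (Complex.I * v) y := by
    refine (integrable_inv_one_add_sq.const_mul C).mono' hc.aestronglyMeasurable ?_
    filter_upwards with v using (hR v y le_rfl).1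
  have e : ∀ v : ℝ, airyRatio U (Complex.I * v) y * cubicTailDeriv s v
      = (-(1 / 2) * (((2 * (Complex.I * v) + 4 * y) * airyRatio U (Complex.I * v) y)
          * cubicTail s v) + 2 * y * (airyRatio U (Complex.I * v) y * cubicTail s v))
        - airyRatio U (Complex.I * v) y * cubicExp s := by
    intro v
    rw [cubicTailDeriv_eq]
    ring
  have hi4 : Integrable fun v : ℝ =>
      -(1 / 2) * (((2 * (Complex.I * v) + 4 * y) * airyRatio U (Complex.I * v) y) * cubicTail s v)
        + 2 * y * (airyRatio U (Complex.I * v) y * cubicTail s v) :=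
    (hi2.const_mul _).add (hi.const_mul _)
  simp_rw [e]
  rw [integral_sub hi4 (hi3.mul_const _),
    integral_add (hi2.const_mul _) (hi.const_mul _), integral_const_mul, integral_const_mul,
    integral_mul_const, h.integral_airyRatio_eq_zero hy, zero_mul, sub_zero, airyTransformDeriv2,
    airyTransform]

theorem continuousAt_airyTransform (h : IsScaledAiry U U') (s : ℝ) {y : ℝ} (hy : 0 < y) :
    ContinuousAt (fun p : ℝ × ℝ => airyTransform U p.1 p.2) (s, y) := by
  obtain ⟨C, hC, hR⟩ := h.exists_norm_airyRatio_imaginary_le (half_pos hy)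
  obtain ⟨D, hD, hL⟩ := exists_norm_cubicTail_le_nhds s
  have hn : ∀ᶠ p : ℝ × ℝ in nhds (s, y), s - 1 < p.1 ∧ y / 2 < p.2 :=
    (continuousAt_fst.eventually (lt_mem_nhds (sub_one_lt s))).and
      (continuousAt_snd.eventually (lt_mem_nhds (half_lt_self hy)))
  refine continuousAt_of_dominated (bound := fun v => C * (1 + v ^ 2)⁻¹ * D) ?_ ?_
    ((integrable_inv_one_add_sq.const_mul C).mul_const _) ?_
  · filter_upwards with p
    exact ((h.continuous_airyRatio p.2).mul (continuous_cubicTail p.1)).aestronglyMeasurable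
  · filter_upwards [hn] with p hp
    filter_upwards with v
    rw [norm_mul]
    exact mul_le_mul (hR v p.2 hp.2.le).1 (hL p.1 hp.1.le v).1 (norm_nonneg _) (by positivity)
  · filter_upwards with v
    have h1 : ContinuousAt (fun p : ℝ × ℝ => airyRatio U (Complex.I * v) p.2) (s, y) :=
      ContinuousAt.comp (f := fun p : ℝ × ℝ => p.2) (x := (s, y))
        (h.hasDerivAt_airyRatio _ y).continuousAt continuousAt_snd
    have h2 : ContinuousAt (fun p : ℝ × ℝ => cubicTail p.1 v) (s, y) :=
      ContinuousAt.comp (f := fun p : ℝ × ℝ => p.1) (x := (s, y))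
        (g := fun s => cubicTail s v) (hasDerivAt_cubicTail s v).continuousAt continuousAt_fst
    exact h1.mul h2

theorem airyRatio_zero (h : IsScaledAiry U U') {l : ℂ} (hl : 0 ≤ l.re) : airyRatio U l 0 = 1 := by
  unfold airyRatio
  simp [h.ne_zero hl]

/-- The boundary values at `y = 0` are attained uniformly for `s ≥ S`. -/
theorem exists_norm_airyTransform_sub_lt (h : IsScaledAiry U U') (S : ℝ) {ε : ℝ} (hε : 0 < ε) :
    ∃ δ > 0, ∀ y, 0 < y → y < δ → ∀ s, S ≤ s →
      ‖airyTransform U s y - 2 * Real.pi * cubicExp s‖ < ε := by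
  obtain ⟨C, hC, hk⟩ := exists_norm_cubicTailReg_le S
  have hlim : Tendsto (fun y : ℝ => ∫ v : ℝ,
      ‖airyRatio U (Complex.I * v) y - 1‖ * (C * (1 + v ^ 2)⁻¹)) (nhdsWithin 0 (Ioi 0))
      (nhds (∫ v : ℝ, 0)) := by
    refine tendsto_integral_filter_of_dominated_convergence
      (fun v => 2 * (C * (1 + v ^ 2)⁻¹)) ?_ ?_
      ((integrable_inv_one_add_sq.const_mul C).const_mul _) ?_
    · filter_upwards with y
      have := h.continuous_airyRatio y
      have h1 : Continuous fun v : ℝ => (1 + v ^ 2)⁻¹ :=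
        Continuous.inv₀ (by fun_prop) fun v => by positivity
      exact Continuous.aestronglyMeasurable (by fun_prop)
    · filter_upwards [self_mem_nhdsWithin] with y hy
      filter_upwards with v
      rw [norm_mul, norm_norm, Real.norm_of_nonneg (by positivity : 0 ≤ C * (1 + v ^ 2)⁻¹)]
      refine mul_le_mul_of_nonneg_right ?_ (by positivity)
      refine (norm_sub_le _ _).trans ?_
      have := h.norm_airyRatio_le_one (re_I_mul_nonneg v) (le_of_lt hy)
      rw [norm_one]
      linarith
    · filter_upwards with v
      have h1 : ContinuousAt (fun y : ℝ =>
          ‖airyRatio U (Complex.I * v) y - 1‖ * (C * (1 + v ^ 2)⁻¹)) 0 :=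
        (((h.hasDerivAt_airyRatio _ 0).continuousAt.sub continuousAt_const).norm).mul
          continuousAt_const
      have h2 := h1.tendsto
      simp only [h.airyRatio_zero (re_I_mul_nonneg v), sub_self, norm_zero, zero_mul] at h2
      exact h2.mono_left nhdsWithin_le_nhds
  rw [integral_zero] at hlim
  have hev := hlim.eventually (gt_mem_nhds hε)
  rw [eventually_nhdsWithin_iff, Metric.eventually_nhds_iff] at hev
  obtain ⟨δ, hδ, hev⟩ := hev
  refine ⟨δ, hδ, fun y hy hyδ s hs => ?_⟩
  have hy' := hev (y := y) (by rw [Real.dist_eq, sub_zero, abs_of_pos hy]; exact hyδ) hy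
  refine lt_of_le_of_lt ?_ hy'
  have hc := h.continuous_airyRatio y
  have hi1 : Integrable fun v : ℝ => airyRatio U (Complex.I * v) y * cubicTailReg s v := by
    refine (integrable_inv_one_add_sq.const_mul C).mono'
      (hc.mul (continuous_cubicTailReg s)).aestronglyMeasurable ?_
    filter_upwards with v
    rw [norm_mul]
    calc _ ≤ 1 * ‖cubicTailReg s v‖ := mul_le_mul_of_nonneg_right
            (h.norm_airyRatio_le_one (re_I_mul_nonneg v) hy.le) (norm_nonneg _)
      _ ≤ _ := by rw [one_mul]; exact hk s hs v
  rw [h.airyTransform_eq s hy, ← integral_cubicTailReg,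
    ← integral_sub hi1 (integrable_cubicTailReg s)]
  refine norm_integral_le_of_norm_le ?_ ?_
  · refine ((integrable_inv_one_add_sq.const_mul C).const_mul 2).mono' ?_ ?_
    · have h1 : Continuous fun v : ℝ => (1 + v ^ 2)⁻¹ :=
        Continuous.inv₀ (by fun_prop) fun v => by positivity
      exact Continuous.aestronglyMeasurable (by fun_prop)
    · filter_upwards with v
      rw [norm_mul, norm_norm, Real.norm_of_nonneg (by positivity : 0 ≤ C * (1 + v ^ 2)⁻¹)]
      refine mul_le_mul_of_nonneg_right ?_ (by positivity)
      refine (norm_sub_le _ _).trans ?_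
      have := h.norm_airyRatio_le_one (re_I_mul_nonneg v) hy.le
      rw [norm_one]
      linarith
  · filter_upwards with v
    rw [show airyRatio U (Complex.I * v) y * cubicTailReg s v - cubicTailReg s v
      = (airyRatio U (Complex.I * v) y - 1) * cubicTailReg s v by ring, norm_mul]
    exact mul_le_mul_of_nonneg_left (hk s hs v) (norm_nonneg _)

theorem exists_norm_airyTransform_le (h : IsScaledAiry U U') (S : ℝ) {b K : ℝ} (hb : 0 < b)
    (hK : 0 ≤ K) :
    ∃ C, 0 ≤ C ∧ ∀ s, S ≤ s → ∀ y, b ≤ y →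
      ‖airyTransform U s y‖ ≤ C * Real.exp (-s) * Real.exp (-(K * y)) := by
  obtain ⟨C, hC, hR⟩ := h.exists_norm_airyRatio_le hb hK
  obtain ⟨D, hD, hL⟩ := exists_norm_cubicTail_le S
  refine ⟨C * D * Real.pi, by positivity, fun s hs y hy => ?_⟩
  have hb : ∀ v : ℝ, ‖airyRatio U (Complex.I * v) y * cubicTail s v‖
      ≤ C * Real.exp (-(K * y)) * (1 + v ^ 2)⁻¹ * (D * Real.exp (-s)) := by
    intro v
    have h1 : ‖airyRatio U (Complex.I * v) y‖ * (1 + ‖Complex.I * (v : ℂ)‖) ^ 2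
        ≤ C * Real.exp (-(K * y)) := by
      refine le_trans ?_ (hR _ (re_I_mul_nonneg v) y hy)
      refine mul_le_mul_of_nonneg_left (pow_le_pow_right₀ ?_ (by norm_num)) (norm_nonneg _)
      linarith [norm_nonneg (Complex.I * (v : ℂ))]
    rw [norm_mul]
    exact mul_le_mul (norm_le_mul_inv_of_mul_le h1) (hL s hs v).1 (norm_nonneg _) (by positivity)
  have := norm_integral_le_of_norm_le
    ((integrable_inv_one_add_sq.const_mul (C * Real.exp (-(K * y)))).mul_const
      (D * Real.exp (-s))) (Eventually.of_forall hb)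
  rw [integral_mul_const, integral_const_mul, integral_univ_inv_one_add_sq] at this
  refine this.trans (le_of_eq ?_)
  ring

end IsScaledAiry

theorem nonneg_second_deriv_of_isLocalMin {f f' : ℝ → ℝ} {f'' x : ℝ}
    (hf : ∀ᶠ y in nhds x, HasDerivAt f (f' y) y) (hf' : HasDerivAt f' f'' x)
    (hmin : IsLocalMin f x) : 0 ≤ f'' := by
  by_contra! hneg
  have hd : deriv f =ᶠ[nhds x] f' := hf.mono fun y hy => hy.deriv
  have hdd : deriv (deriv f) x = f'' := by rw [hd.deriv_eq, hf'.deriv]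
  have hmax : IsLocalMax f x :=
    isLocalMax_of_deriv_deriv_neg (by rwa [hdd]) hmin.deriv_eq_zero hf.self_of_nhds.continuousAt
  have hconst : f =ᶠ[nhds x] fun _ => f x := by
    filter_upwards [hmin, hmax] with y h1 h2 using le_antisymm h2 h1
  have hzero : deriv (deriv f) x = 0 := by
    rw [hconst.deriv.deriv_eq]
    simp
  linarith

theorem nonneg_deriv_of_le_right {f : ℝ → ℝ} {f' x : ℝ} (hf : HasDerivAt f f' x)
    (hmin : ∀ y, x < y → f x ≤ f y) : 0 ≤ f' := by
  have h := (hasDerivWithinAt_iff_tendsto_slope' self_notMem_Ioi).1 (hf.hasDerivWithinAt (s := Ioi x))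
  refine ge_of_tendsto h ?_
  filter_upwards [self_mem_nhdsWithin] with y hy
  rw [slope_def_field]
  exact div_nonneg (sub_nonneg.2 (hmin y hy)) (sub_nonneg.2 (le_of_lt hy))

/-- A maximum principle for `∂D/∂s = -(1/2) ∂²D/∂y² + 2yD` on `[S, ∞) × (0, ∞)`. -/
theorem nonneg_of_backward_parabolic {D D1 D2 : ℝ → ℝ → ℝ} {S : ℝ}
    (h1 : ∀ s y, 0 < y → HasDerivAt (D s) (D1 s y) y)
    (h2 : ∀ s y, 0 < y → HasDerivAt (D1 s) (D2 s y) y)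
    (h3 : ∀ s y, 0 < y →
      HasDerivAt (fun s => D s y) (-(1 / 2) * D2 s y + 2 * y * D s y) s)
    (hc : ∀ s y, 0 < y → ContinuousAt (fun p : ℝ × ℝ => D p.1 p.2) (s, y))
    (hK : ∀ ε > 0, ∃ T δ X, 0 < δ ∧ ∀ s y, S ≤ s → 0 < y → (T < s ∨ y < δ ∨ X < y) →
      -ε < D s y) {s y : ℝ} (hs : S ≤ s) (hy : 0 < y) : 0 ≤ D s y := by
  by_contra! hneg
  obtain ⟨T, δ, X, hδ, hout⟩ := hK (-D s y) (by linarith)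
  have hmem : ∀ s' y', S ≤ s' → 0 < y' → D s' y' ≤ D s y →
      (s', y') ∈ Icc S T ×ˢ Icc δ X := by
    intro s' y' hs' hy' hle
    by_contra hnot
    have hor : T < s' ∨ y' < δ ∨ X < y' := by
      by_contra! hcon
      exact hnot ⟨⟨hs', hcon.1⟩, ⟨hcon.2.1, hcon.2.2⟩⟩
    have := hout s' y' hs' hy' hor
    linarith
  obtain ⟨⟨s0, y0⟩, ⟨hs0, hy0⟩, hmin⟩ := (isCompact_Icc.prod isCompact_Icc).exists_isMinOn
    ⟨(s, y), hmem s y hs hy le_rfl⟩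
    (f := fun p : ℝ × ℝ => D p.1 p.2) fun p hp =>
      (hc p.1 p.2 (lt_of_lt_of_le hδ hp.2.1)).continuousWithinAt
  have hle : D s0 y0 ≤ D s y := hmin (hmem s y hs hy le_rfl)
  have hy0pos : 0 < y0 := lt_of_lt_of_le hδ hy0.1
  have hglob : ∀ s' y', S ≤ s' → 0 < y' → D s0 y0 ≤ D s' y' := by
    intro s' y' hs' hy'
    rcases le_total (D s' y') (D s y) with h | h
    · exact hmin (hmem s' y' hs' hy' h)
    · exact hle.trans h
  have hD2 : 0 ≤ D2 s0 y0 := by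
    refine nonneg_second_deriv_of_isLocalMin (f := D s0) (f' := D1 s0) ?_ (h2 s0 y0 hy0pos) ?_
    · filter_upwards [lt_mem_nhds hy0pos] with y' hy' using h1 s0 y' hy'
    · filter_upwards [lt_mem_nhds hy0pos] with y' hy' using hglob s0 y' hs0.1 hy'
  have hDs := nonneg_deriv_of_le_right (h3 s0 y0 hy0pos)
    fun s' hs' => hglob s' y0 (hs0.1.trans hs'.le) hy0pos
  have : 0 < y0 * -D s0 y0 := mul_pos hy0pos (by linarith)
  linarith

/-- The real-valued transform in the coordinate `y = -x`. -/
def airySolution (U : ℂ → ℂ) (s y : ℝ) : ℝ :=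
  (1 / (2 * Real.pi)) * (airyTransform U s y).re

/-- The exact solution `e^{2sy - (2/3)s³}` of the parabolic equation. -/
def expSolution (s y : ℝ) : ℝ := Real.exp (2 * s * y) * cubicExp s

namespace IsScaledAiry

variable {U U' : ℂ → ℂ}

theorem hasDerivAt_re {F : ℝ → ℂ} {F' : ℂ} {x : ℝ} (h : HasDerivAt F F' x) :
    HasDerivAt (fun x => (F x).re) F'.re x :=
  (Complex.reCLM.hasFDerivAt.comp_hasDerivAt x h)

theorem hasDerivAt_airySolution (h : IsScaledAiry U U') (s : ℝ) {y : ℝ} (hy : 0 < y) :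
    HasDerivAt (airySolution U s)
      ((1 / (2 * Real.pi)) * (airyTransformDeriv U U' s y).re) y :=
  (hasDerivAt_re (h.hasDerivAt_airyTransform s hy)).const_mul _

theorem hasDerivAt_airySolution_deriv (h : IsScaledAiry U U') (s : ℝ) {y : ℝ} (hy : 0 < y) :
    HasDerivAt (fun y => (1 / (2 * Real.pi)) * (airyTransformDeriv U U' s y).re)
      ((1 / (2 * Real.pi)) * (airyTransformDeriv2 U s y).re) y :=
  (hasDerivAt_re (h.hasDerivAt_airyTransformDeriv s hy)).const_mul _

theorem hasDerivAt_airySolution_left (h : IsScaledAiry U U') (s : ℝ) {y : ℝ} (hy : 0 < y) :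
    HasDerivAt (fun s => airySolution U s y)
      (-(1 / 2) * ((1 / (2 * Real.pi)) * (airyTransformDeriv2 U s y).re)
        + 2 * y * airySolution U s y) s := by
  refine ((hasDerivAt_re (h.hasDerivAt_airyTransform_left s hy)).const_mul
    (1 / (2 * Real.pi))).congr_deriv ?_
  rw [show (-(1 / 2) * airyTransformDeriv2 U s y + 2 * y * airyTransform U s y : ℂ)
    = ((-(1 / 2) : ℝ) : ℂ) * airyTransformDeriv2 U s y + ((2 * y : ℝ) : ℂ) * airyTransform U s y by
      push_cast; ring, Complex.add_re, Complex.re_ofReal_mul, Complex.re_ofReal_mul, airySolution]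
  ring

theorem continuousAt_airySolution (h : IsScaledAiry U U') (s : ℝ) {y : ℝ} (hy : 0 < y) :
    ContinuousAt (fun p : ℝ × ℝ => airySolution U p.1 p.2) (s, y) :=
  continuousAt_const.mul
    (Complex.continuous_re.continuousAt.comp (h.continuousAt_airyTransform s hy))

theorem abs_inv_two_pi_mul_re_le (z : ℂ) : |(1 / (2 * Real.pi)) * z.re| ≤ ‖z‖ := by
  have hpi := Real.pi_gt_three
  rw [abs_mul, abs_of_pos (by positivity)]
  have h1 : 1 / (2 * Real.pi) ≤ 1 := by
    rw [div_le_one (by positivity)]; linarith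
  calc _ ≤ 1 * |z.re| := mul_le_mul_of_nonneg_right h1 (abs_nonneg _)
    _ ≤ _ := by rw [one_mul]; exact Complex.abs_re_le_norm z

theorem exists_abs_airySolution_sub_lt (h : IsScaledAiry U U') (S : ℝ) {ε : ℝ} (hε : 0 < ε) :
    ∃ δ > 0, ∀ y, 0 < y → y < δ → ∀ s, S ≤ s → |airySolution U s y - cubicExp s| < ε := by
  obtain ⟨δ, hδ, hd⟩ := h.exists_norm_airyTransform_sub_lt S hε
  refine ⟨δ, hδ, fun y hy hyδ s hs => lt_of_le_of_lt ?_ (hd y hy hyδ s hs)⟩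
  refine le_trans (le_of_eq ?_) (abs_inv_two_pi_mul_re_le _)
  rw [show (2 * Real.pi * cubicExp s : ℂ) = ((2 * Real.pi * cubicExp s : ℝ) : ℂ) by push_cast; ring,
    Complex.sub_re, Complex.ofReal_re, airySolution]
  have := Real.pi_pos
  congr 1
  field_simp

theorem exists_abs_airySolution_le (h : IsScaledAiry U U') (S : ℝ) {b K : ℝ} (hb : 0 < b)
    (hK : 0 ≤ K) :
    ∃ C, 0 ≤ C ∧ ∀ s, S ≤ s → ∀ y, b ≤ y →
      |airySolution U s y| ≤ C * Real.exp (-s) * Real.exp (-(K * y)) := by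
  obtain ⟨C, hC, hd⟩ := h.exists_norm_airyTransform_le S hb hK
  exact ⟨C, hC, fun s hs y hy => (abs_inv_two_pi_mul_re_le _).trans (hd s hs y hy)⟩

theorem tendsto_const_mul_exp_neg (C : ℝ) :
    Tendsto (fun s => C * Real.exp (-s)) atTop (nhds 0) := by
  simpa using Real.tendsto_exp_neg_atTop_nhds_zero.const_mul C

/-- Away from `y = 0`, the solution is small near infinity. -/
theorem exists_abs_airySolution_lt (h : IsScaledAiry U U') (S : ℝ) {b ε : ℝ} (hb : 0 < b)
    (hε : 0 < ε) :
    ∃ T, ∀ s y, S ≤ s → b ≤ y → (T < s ∨ T < y) → |airySolution U s y| < ε := by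
  obtain ⟨C, hC, hd⟩ := h.exists_abs_airySolution_le S hb zero_le_one
  obtain ⟨T1, hT1⟩ := eventually_atTop.1
    ((tendsto_const_mul_exp_neg C).eventually (gt_mem_nhds hε))
  obtain ⟨T2, hT2⟩ := eventually_atTop.1
    ((tendsto_const_mul_exp_neg (C * Real.exp (-S))).eventually (gt_mem_nhds hε))
  refine ⟨max T1 T2, fun s y hs hy hor => ?_⟩
  refine lt_of_le_of_lt (hd s hs y hy) ?_
  rcases hor with hor | hor
  · refine lt_of_le_of_lt ?_ (hT1 s ((le_max_left _ _).trans hor.le))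
    refine mul_le_of_le_one_right (by positivity) (Real.exp_le_one_iff.2 ?_)
    linarith
  · refine lt_of_le_of_lt ?_ (hT2 y ((le_max_right _ _).trans hor.le))
    rw [one_mul]
    have : Real.exp (-s) ≤ Real.exp (-S) := Real.exp_le_exp.2 (by linarith)
    gcongr

theorem airySolution_nonneg (h : IsScaledAiry U U') (s : ℝ) {y : ℝ} (hy : 0 < y) :
    0 ≤ airySolution U s y := by
  refine nonneg_of_backward_parabolic (S := s) (fun s y hy => h.hasDerivAt_airySolution s hy)
    (fun s y hy => h.hasDerivAt_airySolution_deriv s hy)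
    (fun s y hy => h.hasDerivAt_airySolution_left s hy)
    (fun s y hy => h.continuousAt_airySolution s hy) (fun ε hε => ?_) le_rfl hy
  obtain ⟨δ, hδ, hnear⟩ := h.exists_abs_airySolution_sub_lt s hε
  obtain ⟨T, hfar⟩ := h.exists_abs_airySolution_lt s hδ hε
  refine ⟨T, δ, T, hδ, fun s' y' hs' hy' hor => ?_⟩
  rcases lt_or_ge y' δ with hlt | hge
  · have := (abs_lt.1 (hnear y' hy' hlt s' hs')).1
    linarith [cubicExp_pos s']
  · refine (abs_lt.1 (hfar s' y' hs' hge ?_)).1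
    rcases hor with h1 | h1 | h1
    · exact Or.inl h1
    · exact absurd h1 (not_lt.2 hge)
    · exact Or.inr h1

theorem expSolution_pos (s y : ℝ) : 0 < expSolution s y :=
  mul_pos (Real.exp_pos _) (cubicExp_pos s)

theorem hasDerivAt_expSolution (s y : ℝ) :
    HasDerivAt (expSolution s) (2 * s * expSolution s y) y := by
  have h := (((hasDerivAt_id y).const_mul (2 * s)).exp).mul_const (cubicExp s)
  refine h.congr_deriv ?_
  unfold expSolution
  simp only [id]
  ring

theorem hasDerivAt_expSolution_left (s y : ℝ) :
    HasDerivAt (fun s => expSolution s y)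
      (-(1 / 2) * (2 * s * (2 * s * expSolution s y)) + 2 * y * expSolution s y) s := by
  have h := ((((hasDerivAt_id s).const_mul 2).mul_const y).exp).mul (hasDerivAt_cubicExp s)
  refine h.congr_deriv ?_
  unfold expSolution cubicExpDeriv
  simp only [id]
  ring

theorem continuous_expSolution : Continuous fun p : ℝ × ℝ => expSolution p.1 p.2 := by
  unfold expSolution cubicExp
  fun_prop

theorem exists_cubicExp_sub_expSolution_lt (S : ℝ) {ε : ℝ} (hε : 0 < ε) :
    ∃ δ > 0, ∀ s y, S ≤ s → 0 < y → y < δ → cubicExp s - expSolution s y < ε := by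
  have hlim : Tendsto (fun y => (1 - Real.exp (-(2 * |S| * y))) * cubicExp (-|S|)) (nhds 0)
      (nhds 0) := by
    have : Continuous fun y => (1 - Real.exp (-(2 * |S| * y))) * cubicExp (-|S|) := by fun_prop
    simpa using this.tendsto 0
  obtain ⟨δ, hδ, hd⟩ := Metric.eventually_nhds_iff.1 (hlim.eventually (gt_mem_nhds hε))
  refine ⟨δ, hδ, fun s y hs hy hyδ => lt_of_le_of_lt ?_
    (hd (y := y) (by rw [Real.dist_eq, sub_zero, abs_of_pos hy]; exact hyδ))⟩
  have hsS : -|S| ≤ s := (neg_abs_le S).trans hs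
  have h1 : Real.exp (-(2 * |S| * y)) ≤ Real.exp (2 * s * y) :=
    Real.exp_le_exp.2 (by nlinarith)
  have h2 : cubicExp s ≤ cubicExp (-|S|) := by
    refine Real.exp_le_exp.2 ?_
    have : (-|S|) ^ 3 ≤ s ^ 3 := (Odd.strictMono_pow (by decide)).monotone hsS
    linarith
  have h3 : 0 ≤ 1 - Real.exp (-(2 * |S| * y)) :=
    sub_nonneg.2 (Real.exp_le_one_iff.2 (by have := abs_nonneg S; nlinarith [mul_nonneg this hy.le]))
  calc cubicExp s - expSolution s y = (1 - Real.exp (2 * s * y)) * cubicExp s := by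
        unfold expSolution; ring
    _ ≤ (1 - Real.exp (-(2 * |S| * y))) * cubicExp s :=
        mul_le_mul_of_nonneg_right (by linarith) (cubicExp_pos s).le
    _ ≤ _ := mul_le_mul_of_nonneg_left h2 h3

theorem airySolution_le (h : IsScaledAiry U U') (s : ℝ) {y : ℝ} (hy : 0 < y) :
    airySolution U s y ≤ expSolution s y := by
  rw [← sub_nonneg]
  refine nonneg_of_backward_parabolic (S := s) (D := fun s y => expSolution s y - airySolution U s y)
    (fun s y hy => (hasDerivAt_expSolution s y).sub (h.hasDerivAt_airySolution s hy))
    (fun s y hy => ((hasDerivAt_expSolution s y).const_mul (2 * s)).sub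
      (h.hasDerivAt_airySolution_deriv s hy))
    (fun s y hy => ((hasDerivAt_expSolution_left s y).sub
      (h.hasDerivAt_airySolution_left s hy)).congr_deriv (by ring))
    (fun s y hy => continuous_expSolution.continuousAt.sub (h.continuousAt_airySolution s hy))
    (fun ε hε => ?_) le_rfl hy
  obtain ⟨δ1, hδ1, hnear1⟩ := h.exists_abs_airySolution_sub_lt s (half_pos hε)
  obtain ⟨δ2, hδ2, hnear2⟩ := exists_cubicExp_sub_expSolution_lt s (half_pos hε)
  have hδ : 0 < min δ1 δ2 := lt_min hδ1 hδ2
  obtain ⟨T, hfar⟩ := h.exists_abs_airySolution_lt s hδ hε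
  refine ⟨T, min δ1 δ2, T, hδ, fun s' y' hs' hy' hor => ?_⟩
  rcases lt_or_ge y' (min δ1 δ2) with hlt | hge
  · have h1 := (abs_lt.1 (hnear1 y' hy' (hlt.trans_le (min_le_left _ _)) s' hs')).2
    have h2 := hnear2 s' y' hs' hy' (hlt.trans_le (min_le_right _ _))
    linarith
  · have hT : |airySolution U s' y'| < ε := by
      refine hfar s' y' hs' hge ?_
      rcases hor with h1 | h1 | h1
      · exact Or.inl h1
      · exact absurd h1 (not_lt.2 hge)
      · exact Or.inr h1
    have h1 := (abs_lt.1 hT).2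
    linarith [expSolution_pos s' y']

end IsScaledAiry

theorem two_rpow_neg_third_pos : 0 < (2 : ℝ) ^ (-(1 / 3) : ℝ) := by positivity

theorem two_rpow_neg_third_pow_three : ((2 : ℝ) ^ (-(1 / 3) : ℝ)) ^ 3 = 1 / 2 := by
  rw [← Real.rpow_natCast, ← Real.rpow_mul (by norm_num)]
  norm_num

theorem four_rpow_third : (4 : ℝ) ^ ((1 : ℝ) / 3) = 2 * (2 : ℝ) ^ (-(1 / 3) : ℝ) := by
  have h : (2 : ℝ) * (2 : ℝ) ^ (-(1 / 3) : ℝ) = (2 : ℝ) ^ (1 + -(1 / 3) : ℝ) := by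
    rw [Real.rpow_add (by norm_num), Real.rpow_one]
  rw [h, show (4 : ℝ) = (2 : ℝ) ^ (2 : ℝ) by norm_num, ← Real.rpow_mul (by norm_num)]
  norm_num

/-- Lemma 2.1 of the paper. The function
`f(s,x) = (1/2π) ∫_ℝ [Ai(i2^{-1/3}v - 4^{1/3}x)/Ai(i2^{-1/3}v)] (∫₀^∞ e^{itv-(2/3)(s+t)³} dt) dv`
satisfies `∂f/∂s = -(1/2) ∂²f/∂x² - 2xf` on `ℝ × (-∞,0)`, the bounds
`0 ≤ f(s,x) ≤ e^{-2sx-(2/3)s³}`, and the boundary conditions `lim_{x↑0} f(s,x) = e^{-(2/3)s³}`,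
`lim_{s→∞} f(s,x) = 0` and `lim_{x→-∞} e^{2sx} f(s,x) = 0`. -/
theorem chernoff_stmt_2
    (Ai Bi : ℂ → ℂ) (hAiry : IsAiry Ai Bi)
    (f : ℝ → ℝ → ℝ)
    (hf : ∀ s x : ℝ, x < 0 →
      Complex.ofReal (f s x)
        = (1 / (2 * Real.pi)) *
            ∫ v : ℝ,
              (Ai (Complex.I * Complex.ofReal ((2:ℝ) ^ (-(1/3) : ℝ)) * v
                    - Complex.ofReal ((4:ℝ) ^ ((1:ℝ)/3)) * x)
                / Ai (Complex.I * Complex.ofReal ((2:ℝ) ^ (-(1/3) : ℝ)) * v)) *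
              ∫ t in Set.Ioi (0:ℝ),
                Complex.exp (Complex.I * t * v - (2/3) * ((s : ℂ) + t) ^ 3)) :
    (∀ s x : ℝ, x < 0 →
        DifferentiableAt ℝ (fun y => f s y) x ∧
        DifferentiableAt ℝ (fun y => deriv (fun z => f s z) y) x ∧
        HasDerivAt (fun s' => f s' x)
          (-(1/2) * deriv (fun y => deriv (fun z => f s z) y) x - 2 * x * f s x) s) ∧
    (∀ s x : ℝ, x < 0 → 0 ≤ f s x ∧ f s x ≤ Real.exp (-2 * s * x - (2/3) * s ^ 3)) ∧
    (∀ s : ℝ, Tendsto (fun x => f s x) (nhdsWithin 0 (Set.Iio 0))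
        (nhds (Real.exp (-(2/3) * s ^ 3)))) ∧
    (∀ x : ℝ, x < 0 → Tendsto (fun s => f s x) atTop (nhds 0)) ∧
    (∀ s : ℝ, Tendsto (fun x => Real.exp (2 * s * x) * f s x) atBot (nhds 0)) := by
  set a : ℝ := (2 : ℝ) ^ (-(1 / 3) : ℝ) with ha
  set U : ℂ → ℂ := fun z => Ai (a * z) with hU
  have h : IsScaledAiry U fun z => a * deriv Ai (a * z) :=
    hAiry.isScaledAiry two_rpow_neg_third_pos two_rpow_neg_third_pow_three
  have hfU : ∀ s x : ℝ, x < 0 → f s x = airySolution U s (-x) := by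
    intro s x hx
    have e : Complex.ofReal (f s x) = ((1 / (2 * Real.pi) : ℝ) : ℂ) * airyTransform U s (-x) := by
      rw [hf s x hx, airyTransform]
      simp_rw [cubicTail_eq]
      congr 1
      · push_cast
        ring
      · congr 1
        ext v
        congr 1
        unfold airyRatio
        rw [hU, four_rpow_third, ← ha]
        push_cast
        congr 2 <;> ring
    have := congrArg Complex.re e
    rwa [Complex.ofReal_re, Complex.re_ofReal_mul] at this
  have hd1 : ∀ s x : ℝ, x < 0 → HasDerivAt (fun z => f s z) (-((1 / (2 * Real.pi)) *
      (airyTransformDeriv U (fun z => a * deriv Ai (a * z)) s (-x)).re)) x := by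
    intro s x hx
    have := HasDerivAt.comp x (h.hasDerivAt_airySolution s (neg_pos.2 hx)) (hasDerivAt_neg x)
    rw [mul_neg_one] at this
    refine this.congr_of_eventuallyEq ?_
    filter_upwards [gt_mem_nhds hx] with z hz using hfU s z hz
  have hd2 : ∀ s x : ℝ, x < 0 → HasDerivAt (fun y => deriv (fun z => f s z) y)
      ((1 / (2 * Real.pi)) * (airyTransformDeriv2 U s (-x)).re) x := by
    intro s x hx
    have := (HasDerivAt.comp x (h.hasDerivAt_airySolution_deriv s (neg_pos.2 hx))
      (hasDerivAt_neg x)).neg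
    rw [mul_neg_one, neg_neg] at this
    refine this.congr_of_eventuallyEq ?_
    filter_upwards [gt_mem_nhds hx] with z hz using (hd1 s z hz).deriv
  refine ⟨fun s x hx => ⟨(hd1 s x hx).differentiableAt, (hd2 s x hx).differentiableAt, ?_⟩,
    fun s x hx => ?_, fun s => ?_, fun x hx => ?_, fun s => ?_⟩
  · rw [(hd2 s x hx).deriv, hfU s x hx]
    have e : (fun s' => f s' x) = fun s' => airySolution U s' (-x) := funext fun s' => hfU s' x hx
    rw [e]
    exact (h.hasDerivAt_airySolution_left s (neg_pos.2 hx)).congr_deriv (by ring)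
  · rw [hfU s x hx]
    refine ⟨h.airySolution_nonneg s (neg_pos.2 hx),
      (h.airySolution_le s (neg_pos.2 hx)).trans (le_of_eq ?_)⟩
    rw [expSolution, cubicExp, ← Real.exp_add]
    congr 1
    ring
  · rw [Metric.tendsto_nhdsWithin_nhds]
    intro ε hε
    obtain ⟨δ, hδ, hd⟩ := h.exists_abs_airySolution_sub_lt s hε
    refine ⟨δ, hδ, fun x hx hxδ => ?_⟩
    have hx0 : x < 0 := hx
    rw [Real.dist_eq, sub_zero, abs_of_neg hx0] at hxδ
    rw [Real.dist_eq, hfU s x hx0]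
    exact hd (-x) (neg_pos.2 hx0) hxδ s le_rfl
  · rw [Metric.tendsto_atTop]
    intro ε hε
    obtain ⟨T, hT⟩ := h.exists_abs_airySolution_lt 0 (neg_pos.2 hx) hε
    refine ⟨max 0 (T + 1), fun s hs => ?_⟩
    rw [Real.dist_eq, sub_zero, hfU s x hx]
    exact hT s (-x) ((le_max_left _ _).trans hs) le_rfl
      (Or.inl (by linarith [(le_max_right 0 (T + 1)).trans hs]))
  · obtain ⟨C, hC, hd⟩ := h.exists_abs_airySolution_le s one_pos
      (by positivity : 0 ≤ 2 * |s| + 1)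
    have hlim : Tendsto (fun x => C * Real.exp (-s) * Real.exp x) atBot (nhds 0) := by
      simpa using Real.tendsto_exp_atBot.const_mul (C * Real.exp (-s))
    refine squeeze_zero_norm' ?_ hlim
    filter_upwards [eventually_le_atBot (-1 : ℝ)] with x hx
    have hx0 : x < 0 := by linarith
    rw [norm_mul, Real.norm_of_nonneg (Real.exp_pos _).le, hfU s x hx0, Real.norm_eq_abs]
    calc Real.exp (2 * s * x) * |airySolution U s (-x)|
        ≤ Real.exp (2 * s * x) * (C * Real.exp (-s) * Real.exp (-((2 * |s| + 1) * -x))) :=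
          mul_le_mul_of_nonneg_left (hd s le_rfl (-x) (by linarith)) (Real.exp_pos _).le
      _ = C * Real.exp (-s) * Real.exp (2 * s * x + -((2 * |s| + 1) * -x)) := by
          rw [Real.exp_add]
          ring
      _ ≤ C * Real.exp (-s) * Real.exp x := by
          refine mul_le_mul_of_nonneg_left (Real.exp_le_exp.2 ?_) (by positivity)
          nlinarith [neg_abs_le s]

end
end

section
/- For each s ∈ ℝ, the function x ↦ g̃(s,x) on (0,∞) satisfies the first-order differential equation ∂g̃/∂x (s,x) = s·g̃(s,x) + (1/(2π)) ∫_{u=−∞}^{∞} e^{−isu} Ai(iu+x)/Ai(iu)² du. -/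
open MeasureTheory ProbabilityTheory Filter Set

noncomputable section

/-- A cooperative differential system of four unknowns, coupled cyclically, preserves positivity. -/
theorem cooperative_pos {A P B Q A' P' B' Q' : ℝ → ℝ} {a : ℝ}
    (hA : ∀ u, HasDerivAt A (A' u) u) (hP : ∀ u, HasDerivAt P (P' u) u)
    (hB : ∀ u, HasDerivAt B (B' u) u) (hQ : ∀ u, HasDerivAt Q (Q' u) u)
    (hAP : ∀ u, a ≤ u → 0 ≤ P u → 0 ≤ A' u) (hPB : ∀ u, a ≤ u → 0 ≤ B u → 0 ≤ P' u)
    (hBQ : ∀ u, a ≤ u → 0 ≤ Q u → 0 ≤ B' u) (hQA : ∀ u, a ≤ u → 0 ≤ A u → 0 ≤ Q' u)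
    (hA0 : 0 < A a) (hP0 : 0 ≤ P a) (hB0 : 0 < B a) (hQ0 : 0 < Q a) {u : ℝ} (hu : a ≤ u) :
    0 < A u ∧ 0 ≤ P u ∧ 0 < B u ∧ 0 < Q u := by
  have mono : ∀ {f f' : ℝ → ℝ} {T : ℝ}, (∀ u, HasDerivAt f (f' u) u) →
      (∀ u, a ≤ u → u < T → 0 ≤ f' u) → ∀ t, a ≤ t → t ≤ T → f a ≤ f t := by
    intro f f' T hf hf' t h1 h2
    have : MonotoneOn f (Icc a T) := by
      apply monotoneOn_of_deriv_nonneg (convex_Icc a T)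
      · exact fun x _ => (hf x).continuousAt.continuousWithinAt
      · exact fun x _ => (hf x).differentiableAt.differentiableWithinAt
      · intro x hx
        rw [interior_Icc] at hx
        rw [(hf x).deriv]
        exact hf' x hx.1.le hx.2
    exact this ⟨le_rfl, h1.trans h2⟩ ⟨h1, h2⟩ h1
  have step : ∀ T, a ≤ T → (∀ t, a ≤ t → t < T → 0 ≤ A t ∧ 0 ≤ B t ∧ 0 ≤ Q t) →
      0 < A T ∧ 0 ≤ P T ∧ 0 < B T ∧ 0 < Q T := by
    intro T haT h
    have hP' := mono hP fun t h1 h2 => hPB t h1 (h t h1 h2).2.1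
    have hA' := mono hA fun t h1 h2 => hAP t h1 (hP0.trans (hP' t h1 h2.le))
    have hB' := mono hB fun t h1 h2 => hBQ t h1 (h t h1 h2).2.2
    have hQ' := mono hQ fun t h1 h2 => hQA t h1 (h t h1 h2).1
    exact ⟨hA0.trans_le (hA' T haT le_rfl), hP0.trans (hP' T haT le_rfl),
      hB0.trans_le (hB' T haT le_rfl), hQ0.trans_le (hQ' T haT le_rfl)⟩
  refine step u hu ?_
  by_contra! hcon
  obtain ⟨t, hat, -, ht⟩ := hcon
  have cA : Continuous A := continuous_iff_continuousAt.2 fun x => (hA x).continuousAt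
  have cB : Continuous B := continuous_iff_continuousAt.2 fun x => (hB x).continuousAt
  have cQ : Continuous Q := continuous_iff_continuousAt.2 fun x => (hQ x).continuousAt
  set S : Set ℝ := {t | a ≤ t ∧ min (A t) (min (B t) (Q t)) ≤ 0} with hS
  have hSc : IsClosed S :=
    (isClosed_le continuous_const continuous_id).inter
      (isClosed_le (cA.min (cB.min cQ)) continuous_const)
  have hSne : S.Nonempty := by
    refine ⟨t, hat, ?_⟩
    by_contra! hpos
    simp only [lt_min_iff] at hpos
    exact absurd (ht hpos.1.le hpos.2.1.le) (not_lt.2 hpos.2.2.le)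
  have hSb : BddBelow S := ⟨a, fun _ h => h.1⟩
  have hT := hSc.csInf_mem hSne hSb
  have := step (sInf S) hT.1 fun r hr1 hr2 => by
    have : r ∉ S := fun h => absurd (csInf_le hSb h) (not_le.2 hr2)
    have h2 : 0 < min (A r) (min (B r) (Q r)) := by
      by_contra! h3
      exact this ⟨hr1, h3⟩
    simp only [lt_min_iff] at h2
    exact ⟨h2.1.le, h2.2.1.le, h2.2.2.le⟩
  exact absurd hT.2 (not_le.2 (lt_min this.1 (lt_min this.2.2.1 this.2.2.2)))

/-- Growth of the solutions of `f'' = -iσu f` with `σ = ±1` whose initial data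
correspond to a function that is positive and decreasing transversally at `0`. -/
theorem exp_le_norm_of_airy_imag {f f₁ : ℝ → ℂ} {σ : ℝ} (hσ : σ * σ = 1)
    (hf : ∀ u, HasDerivAt f (f₁ u) u)
    (hf₁ : ∀ u : ℝ, HasDerivAt f₁ (-(Complex.I * σ * u) * f u) u)
    (hP0 : (f₁ 0).re * (f 0).re + (f₁ 0).im * (f 0).im = 0)
    (hQ0 : 0 < -σ * ((f₁ 0).im * (f 0).re - (f₁ 0).re * (f 0).im)) :
    (∃ c > 0, ∀ u, 0 ≤ u → c * Real.exp (2 * u) ≤ ‖f u‖) ∧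
      ∃ C > 0, ∀ u, 0 ≤ u → ‖f₁ u‖ ≤ C * Real.exp u * ‖f u‖ := by
  have hre : ∀ {g : ℝ → ℂ} {g' : ℂ} {u : ℝ}, HasDerivAt g g' u →
      HasDerivAt (fun t => (g t).re) g'.re u := fun {g g' u} h =>
    (Complex.reCLM.hasFDerivAt.comp_hasDerivAt u h)
  have him : ∀ {g : ℝ → ℂ} {g' : ℂ} {u : ℝ}, HasDerivAt g g' u →
      HasDerivAt (fun t => (g t).im) g'.im u := fun {g g' u} h =>
    (Complex.imCLM.hasFDerivAt.comp_hasDerivAt u h)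
  set A : ℝ → ℝ := fun u => (f u).re * (f u).re + (f u).im * (f u).im with hAdef
  set P : ℝ → ℝ := fun u => (f₁ u).re * (f u).re + (f₁ u).im * (f u).im with hPdef
  set B : ℝ → ℝ := fun u => (f₁ u).re * (f₁ u).re + (f₁ u).im * (f₁ u).im with hBdef
  set Q : ℝ → ℝ := fun u => -σ * ((f₁ u).im * (f u).re - (f₁ u).re * (f u).im) with hQdef
  have hA : ∀ u, HasDerivAt A (2 * P u) u := fun u => by
    refine (((hre (hf u)).mul (hre (hf u))).add ((him (hf u)).mul (him (hf u)))).congr_deriv ?_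
    simp only [hPdef]; ring
  have hP : ∀ u, HasDerivAt P (B u) u := fun u => by
    refine (((hre (hf₁ u)).mul (hre (hf u))).add
      ((him (hf₁ u)).mul (him (hf u)))).congr_deriv ?_
    simp [hBdef]; ring
  have hB : ∀ u, HasDerivAt B (2 * u * Q u) u := fun u => by
    refine (((hre (hf₁ u)).mul (hre (hf₁ u))).add
      ((him (hf₁ u)).mul (him (hf₁ u)))).congr_deriv ?_
    simp [hQdef]; ring
  have hQ : ∀ u, HasDerivAt Q (u * A u) u := fun u => by
    refine ((((him (hf₁ u)).mul (hre (hf u))).sub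
      ((hre (hf₁ u)).mul (him (hf u)))).const_mul (-σ)).congr_deriv ?_
    simp [hAdef]; linear_combination (u * ((f u).re * (f u).re + (f u).im * (f u).im)) * hσ
  have hAB : ∀ u, A u * B u = P u ^ 2 + Q u ^ 2 := fun u => by
    simp only [hAdef, hPdef, hBdef, hQdef]
    linear_combination (-((f₁ u).im * (f u).re - (f₁ u).re * (f u).im) ^ 2) * hσ
  have hAn : ∀ u, A u = ‖f u‖ ^ 2 := fun u => by
    rw [← Complex.normSq_eq_norm_sq, Complex.normSq_apply]
  have hBn : ∀ u, B u = ‖f₁ u‖ ^ 2 := fun u => by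
    rw [← Complex.normSq_eq_norm_sq, Complex.normSq_apply]
  have hAge : ∀ u, 0 ≤ A u := fun u => by rw [hAn]; positivity
  have hBge : ∀ u, 0 ≤ B u := fun u => by rw [hBn]; positivity
  have hAB0 : 0 < A 0 * B 0 := by
    rw [hAB]; have : 0 < Q 0 := hQ0; positivity
  have hA0 : 0 < A 0 := (hAge 0).lt_of_ne fun h => by simp [← h] at hAB0
  have hB0 : 0 < B 0 := (hBge 0).lt_of_ne fun h => by simp [← h] at hAB0
  have pos : ∀ u, 0 ≤ u → 0 < A u ∧ 0 ≤ P u ∧ 0 < B u ∧ 0 < Q u := fun u hu =>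
    cooperative_pos hA hP hB hQ (fun u _ h => by positivity) (fun u _ h => h)
      (fun u hu h => by positivity) (fun u hu h => by positivity) hA0 hP0.ge hB0 hQ0 hu
  constructor
  · have hP8 : 0 < P 8 := by
      have : StrictMonoOn P (Icc 0 8) := by
        apply strictMonoOn_of_deriv_pos (convex_Icc _ _)
        · exact fun x _ => (hP x).continuousAt.continuousWithinAt
        · intro x hx
          rw [interior_Icc] at hx
          rw [(hP x).deriv]
          exact (pos x hx.1.le).2.2.1
      have h := this (by norm_num) (by norm_num) (by norm_num : (0:ℝ) < 8)
      exact hP0.symm.trans_lt h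
    obtain ⟨hA8, -, hB8, hQ8⟩ := pos 8 (by norm_num)
    obtain ⟨ε, hε, hεA, hεP, hεB, hεQ⟩ : ∃ ε > 0, ε * Real.exp (4 * 8) < A 8 ∧
        2 * (ε * Real.exp (4 * 8)) < P 8 ∧ 8 * (ε * Real.exp (4 * 8)) < B 8 ∧
        2 * (ε * Real.exp (4 * 8)) < Q 8 := by
      set m := min (A 8) (min (P 8) (min (B 8) (Q 8))) with hm
      have hm0 : 0 < m := lt_min hA8 (lt_min hP8 (lt_min hB8 hQ8))
      have h1 : m ≤ A 8 := min_le_left _ _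
      have h2 : m ≤ P 8 := (min_le_right _ _).trans (min_le_left _ _)
      have h3 : m ≤ B 8 := (min_le_right _ _).trans ((min_le_right _ _).trans (min_le_left _ _))
      have h4 : m ≤ Q 8 := (min_le_right _ _).trans ((min_le_right _ _).trans (min_le_right _ _))
      refine ⟨m / 16 / Real.exp (4 * 8), by positivity, ?_⟩
      rw [div_mul_cancel₀ _ (Real.exp_pos _).ne']
      refine ⟨?_, ?_, ?_, ?_⟩ <;> linarith
    have hE : ∀ u : ℝ, HasDerivAt (fun u => ε * Real.exp (4 * u)) (4 * (ε * Real.exp (4 * u))) u :=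
      fun u => by
        refine ((((hasDerivAt_id u).const_mul 4).exp).const_mul ε).congr_deriv ?_
        simp only [id]; ring
    have hEpos : ∀ u : ℝ, 0 < ε * Real.exp (4 * u) := fun u => by positivity
    have key : ∀ u, 8 ≤ u → ε * Real.exp (4 * u) ≤ A u := fun u hu => by
      have := cooperative_pos (a := 8) (fun u => (hA u).sub (hE u))
        (fun u => (hP u).sub ((hE u).const_mul 2))
        (fun u => (hB u).sub ((hE u).const_mul 8)) (fun u => (hQ u).sub ((hE u).const_mul 2))
        (fun u _ h => by simp only [Pi.sub_apply] at h; linarith)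
        (fun u _ h => by simp only [Pi.sub_apply] at h; linarith)
        (fun u hu h => by simp only [Pi.sub_apply] at h; nlinarith [hEpos u])
        (fun u hu h => by simp only [Pi.sub_apply] at h; nlinarith [hEpos u])
        (by simpa using hεA) (by simpa using hεP.le) (by simpa using hεB) (by simpa using hεQ) hu
      simpa using this.1.le
    have hAmono : ∀ u, 0 ≤ u → A 0 ≤ A u := fun u hu => by
      have : MonotoneOn A (Ici 0) := by
        apply monotoneOn_of_deriv_nonneg (convex_Ici 0)
        · exact fun x _ => (hA x).continuousAt.continuousWithinAt
        · exact fun x _ => (hA x).differentiableAt.differentiableWithinAt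
        · intro x hx
          rw [interior_Ici] at hx
          rw [(hA x).deriv]
          linarith [(pos x (le_of_lt hx)).2.1]
      exact this self_mem_Ici hu hu
    obtain ⟨c, hc, hcA⟩ : ∃ c > 0, ∀ u, 0 ≤ u → c * Real.exp (4 * u) ≤ A u := by
      refine ⟨min ε (A 0 / Real.exp (4 * 8)), by positivity, fun u hu => ?_⟩
      rcases le_total 8 u with h | h
      · exact (mul_le_mul_of_nonneg_right (min_le_left _ _) (Real.exp_pos _).le).trans (key u h)
      · refine le_trans ?_ (hAmono u hu)
        calc _ ≤ A 0 / Real.exp (4 * 8) * Real.exp (4 * 8) := by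
              gcongr
              exact min_le_right _ _
          _ = A 0 := div_mul_cancel₀ _ (Real.exp_pos _).ne'
    refine ⟨√c, Real.sqrt_pos.2 hc, fun u hu => ?_⟩
    refine le_of_sq_le_sq ?_ (norm_nonneg _)
    rw [mul_pow, Real.sq_sqrt hc.le, ← Real.exp_nat_mul, ← hAn]
    rw [show ((2 : ℕ) : ℝ) * (2 * u) = 4 * u by push_cast; ring]
    exact hcA u hu
  · set C := 1 + B 0 / A 0 with hC
    have hC1 : 1 ≤ C := by rw [hC]; linarith [div_pos hB0 hA0]
    have hh : ∀ u : ℝ, HasDerivAt (fun u => Real.exp (-u) * (C * (Real.exp (2 * u) * A u) - B u))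
        (Real.exp (-u) * (C * (Real.exp (2 * u) * A u) + 2 * C * (Real.exp (2 * u) * P u)
          - 2 * u * Q u + B u)) u := fun u => by
      have e1 : HasDerivAt (fun u : ℝ => Real.exp (-u)) (-Real.exp (-u)) u := by
        simpa using (hasDerivAt_id u).neg.exp
      have e2 : HasDerivAt (fun u : ℝ => Real.exp (2 * u)) (Real.exp (2 * u) * 2) u := by
        simpa using ((hasDerivAt_id u).const_mul 2).exp
      refine (e1.mul (((e2.mul (hA u)).const_mul C).sub (hB u))).congr_deriv ?_
      simp only [Pi.mul_apply, Pi.sub_apply]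
      ring
    have hmono : MonotoneOn (fun u => Real.exp (-u) * (C * (Real.exp (2 * u) * A u) - B u))
        (Ici 0) := by
      apply monotoneOn_of_deriv_nonneg (convex_Ici 0)
      · exact fun x _ => (hh x).continuousAt.continuousWithinAt
      · exact fun x _ => (hh x).differentiableAt.differentiableWithinAt
      · intro u hu
        rw [interior_Ici] at hu
        have hu0 : 0 ≤ u := le_of_lt hu
        rw [(hh u).deriv]
        obtain ⟨hA1, hP1, hB1, hQ1⟩ := pos u hu0
        have hexp : u ^ 2 ≤ Real.exp (2 * u) := by
          have h1 : u ≤ Real.exp u := by linarith [Real.add_one_le_exp u]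
          calc u ^ 2 ≤ Real.exp u ^ 2 := by gcongr
            _ = Real.exp (2 * u) := by rw [← Real.exp_nat_mul]; norm_num
        have h2 : 2 * u * Q u ≤ u ^ 2 * A u + B u := by
          have hq : Q u ^ 2 ≤ A u * B u := by rw [hAB]; nlinarith [sq_nonneg (P u)]
          refine le_of_sq_le_sq ?_ (by positivity)
          nlinarith [sq_nonneg (u ^ 2 * A u - B u), mul_nonneg (sq_nonneg u) (sub_nonneg.2 hq)]
        have h3 : u ^ 2 * A u ≤ C * (Real.exp (2 * u) * A u) := by
          have : Real.exp (2 * u) * A u ≤ C * (Real.exp (2 * u) * A u) :=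
            le_mul_of_one_le_left (by positivity) hC1
          exact (mul_le_mul_of_nonneg_right hexp hA1.le).trans this
        have h4 : 0 ≤ 2 * C * (Real.exp (2 * u) * P u) := by positivity
        exact mul_nonneg (Real.exp_pos _).le (by linarith)
    refine ⟨√C, Real.sqrt_pos.2 (by linarith), fun u hu => ?_⟩
    have h1 := hmono self_mem_Ici hu hu
    have h2 : 0 ≤ Real.exp (-u) * (C * (Real.exp (2 * u) * A u) - B u) := by
      refine le_trans ?_ h1
      have : C * A 0 = A 0 + B 0 := by rw [hC]; field_simp
      simp [this]; linarith
    have h3 := nonneg_of_mul_nonneg_right h2 (Real.exp_pos _)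
    refine le_of_sq_le_sq ?_ (by positivity)
    rw [mul_pow, mul_pow, Real.sq_sqrt (by linarith), ← Real.exp_nat_mul, ← hAn, ← hBn]
    push_cast
    linarith

theorem integrableOn_pow_mul_exp_neg_cube (k : ℕ) {b : ℝ} (hb : 0 < b) :
    IntegrableOn (fun r : ℝ => r ^ k * Real.exp (-b * r ^ 3)) (Ioi 0) := by
  have h := integrableOn_rpow_mul_exp_neg_mul_rpow (p := 3) (s := k) (b := b)
    (by have : (0:ℝ) ≤ k := Nat.cast_nonneg k
        linarith) (by norm_num) hb
  refine h.congr_fun (fun r _ => ?_) measurableSet_Ioi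
  simp only [Real.rpow_natCast]
  norm_cast

theorem integrableOn_pow_mul_exp_cubic (k : ℕ) :
    IntegrableOn (fun r : ℝ => r ^ k * Real.exp (-(r ^ 3) / 3 + r)) (Ioi 0) := by
  refine Integrable.mono' ((integrableOn_pow_mul_exp_neg_cube k (b := 1 / 6)
    (by norm_num)).const_mul (Real.exp 3)) (by fun_prop) ?_
  refine (ae_restrict_iff' measurableSet_Ioi).2 (ae_of_all _ fun r hr => ?_)
  have hr : 0 < r := hr
  rw [Real.norm_of_nonneg (by positivity), mul_left_comm, ← Real.exp_add]
  refine mul_le_mul_of_nonneg_left (Real.exp_le_exp.2 ?_) (by positivity)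
  nlinarith [sq_nonneg (r - 5 / 4), mul_nonneg hr.le (sq_nonneg (r - 2))]

/-- The Laplace-type integral `∫₀^∞ exp(-r³/3 + ar) dr`, which is `π` times the Scorer function
`Hi`. -/
def scorer (a : ℂ) : ℂ := ∫ r : ℝ in Ioi 0, Complex.exp (-(r ^ 3 : ℂ) / 3 + a * r)

theorem norm_exp_cubic_le {a : ℂ} (ha : ‖a‖ ≤ 1) {r : ℝ} (hr : 0 < r) :
    ‖Complex.exp (-(r ^ 3 : ℂ) / 3 + a * r)‖ ≤ Real.exp (-(r ^ 3) / 3 + r) := by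
  rw [Complex.norm_exp]
  gcongr
  have h1 : (-(r ^ 3 : ℂ) / 3 + a * r).re = -(r ^ 3) / 3 + a.re * r := by
    have : (-(r ^ 3 : ℂ) / 3 + a * r) = ((-(r ^ 3) / 3 : ℝ) : ℂ) + a * r := by push_cast; ring
    rw [this, Complex.add_re, Complex.re_mul_ofReal, Complex.ofReal_re]
  rw [h1]
  have := (Complex.re_le_norm a).trans ha
  nlinarith

theorem hasDerivAt_scorer_zero :
    HasDerivAt scorer ((∫ r : ℝ in Ioi 0, r * Real.exp (-(1 / 3) * r ^ 3) : ℝ) : ℂ) 0 := by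
  have h := (hasDerivAt_integral_of_dominated_loc_of_deriv_le (𝕜 := ℂ)
    (μ := volume.restrict (Ioi (0 : ℝ))) (s := Metric.ball (0 : ℂ) 1) (x₀ := 0)
    (F := fun a r => Complex.exp (-(r ^ 3 : ℂ) / 3 + a * r))
    (F' := fun a r => r * Complex.exp (-(r ^ 3 : ℂ) / 3 + a * r))
    (bound := fun r => r ^ 1 * Real.exp (-(r ^ 3) / 3 + r))
    (Metric.ball_mem_nhds 0 one_pos) (Eventually.of_forall fun a => by fun_prop)
    ?_ (by fun_prop) ?_ (integrableOn_pow_mul_exp_cubic 1) ?_).2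
  · convert! h using 1
    rw [← integral_complex_ofReal]
    refine setIntegral_congr_fun measurableSet_Ioi fun r _ => ?_
    push_cast
    congr 2
    ring
  · refine Integrable.mono' (integrableOn_pow_mul_exp_cubic 0) (by fun_prop) ?_
    refine (ae_restrict_iff' measurableSet_Ioi).2 (ae_of_all _ fun r hr => ?_)
    simpa using norm_exp_cubic_le (a := 0) (by simp) hr
  · refine (ae_restrict_iff' measurableSet_Ioi).2 (ae_of_all _ fun r hr a ha => ?_)
    have hr' : 0 < r := hr
    rw [norm_mul, Complex.norm_real, Real.norm_of_nonneg hr'.le, pow_one]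
    gcongr
    exact norm_exp_cubic_le (mem_ball_zero_iff.1 ha).le hr
  · refine ae_of_all _ fun r a _ => ?_
    refine (((hasDerivAt_id a).mul_const (r : ℂ)).const_add _).cexp.congr_deriv ?_
    simp only [id]; ring

theorem scorer_zero :
    scorer 0 = ((∫ r : ℝ in Ioi 0, Real.exp (-(1 / 3) * r ^ 3) : ℝ) : ℂ) := by
  rw [scorer, ← integral_complex_ofReal]
  refine setIntegral_congr_fun measurableSet_Ioi fun r _ => ?_
  push_cast
  congr 1
  ring

theorem integral_mul_integral_exp_neg_cube :
    (∫ r : ℝ in Ioi 0, Real.exp (-(1 / 3) * r ^ 3)) *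
      (∫ r : ℝ in Ioi 0, r * Real.exp (-(1 / 3) * r ^ 3)) = 2 * Real.pi / (3 * √3) := by
  have h0 := integral_rpow_mul_exp_neg_mul_rpow (p := 3) (q := 0) (b := 1 / 3)
    (by norm_num) (by norm_num) (by norm_num)
  have h1 := integral_rpow_mul_exp_neg_mul_rpow (p := 3) (q := 1) (b := 1 / 3)
    (by norm_num) (by norm_num) (by norm_num)
  have e0 : (∫ r : ℝ in Ioi 0, Real.exp (-(1 / 3) * r ^ 3)) =
      ∫ r : ℝ in Ioi 0, r ^ (0 : ℝ) * Real.exp (-(1 / 3) * r ^ (3 : ℝ)) := by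
    refine setIntegral_congr_fun measurableSet_Ioi fun r _ => ?_
    simp only [Real.rpow_zero, one_mul]
    norm_cast
  have e1 : (∫ r : ℝ in Ioi 0, r * Real.exp (-(1 / 3) * r ^ 3)) =
      ∫ r : ℝ in Ioi 0, r ^ (1 : ℝ) * Real.exp (-(1 / 3) * r ^ (3 : ℝ)) := by
    refine setIntegral_congr_fun measurableSet_Ioi fun r _ => ?_
    simp only [Real.rpow_one]
    norm_cast
  have hG := Real.Gamma_mul_Gamma_one_sub (1 / 3)
  have hb : (1 / 3 : ℝ) ^ (-(0 + 1) / 3 : ℝ) * (1 / 3 : ℝ) ^ (-(1 + 1) / 3 : ℝ) = 3 := by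
    rw [← Real.rpow_add (by norm_num)]
    norm_num
  rw [show (1 : ℝ) - 1 / 3 = (1 + 1) / 3 by norm_num,
    show Real.pi * (1 / 3) = Real.pi / 3 by ring, Real.sin_pi_div_three] at hG
  rw [e0, e1, h0, h1]
  have h3 : √3 ≠ 0 := by positivity
  calc _ = ((1 / 3 : ℝ) ^ (-(0 + 1) / 3 : ℝ) * (1 / 3 : ℝ) ^ (-(1 + 1) / 3 : ℝ)) * (1 / 9) *
        (Real.Gamma (1 / 3) * Real.Gamma ((1 + 1) / 3)) := by
        rw [show ((0 : ℝ) + 1) / 3 = 1 / 3 by norm_num]; ring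
    _ = _ := by rw [hb, hG]; field_simp; norm_num

theorem integral_exp_neg_cube_pos : 0 < ∫ r : ℝ in Ioi 0, Real.exp (-(1 / 3) * r ^ 3) := by
  have hnn : 0 ≤ ∫ r : ℝ in Ioi 0, Real.exp (-(1 / 3) * r ^ 3) :=
    setIntegral_nonneg measurableSet_Ioi fun r _ => (Real.exp_pos _).le
  refine hnn.lt_of_ne fun h => ?_
  have := integral_mul_integral_exp_neg_cube
  rw [← h, zero_mul] at this
  have : 0 < 2 * Real.pi / (3 * √3) := by positivity
  linarith

theorem exp_I_mul_pi_div_six :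
    Complex.exp (Complex.I * (Real.pi / 6 : ℝ)) = (√3 / 2 : ℝ) + (1 / 2 : ℝ) * Complex.I := by
  rw [mul_comm, Complex.exp_mul_I, ← Complex.ofReal_cos, ← Complex.ofReal_sin,
    Real.cos_pi_div_six, Real.sin_pi_div_six]

/-- Rotation of the contour of the oscillatory Airy integral by `π/6`. -/
theorem tendsto_integral_airy_phase {x : ℝ} (hx : 0 ≤ x) :
    Tendsto (fun R : ℝ => ∫ t in (0 : ℝ)..R, Complex.exp (Complex.I * (t ^ 3 / 3 + x * t))) atTop
      (nhds (Complex.exp (Complex.I * (Real.pi / 6 : ℝ)) *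
        scorer (Complex.I * Complex.exp (Complex.I * (Real.pi / 6 : ℝ)) * x))) := by
  set c : ℂ := Complex.exp (Complex.I * (Real.pi / 6 : ℝ)) with hc
  have hcv := exp_I_mul_pi_div_six
  rw [← hc] at hcv
  have hc3 : c ^ 3 = Complex.I := by
    rw [hc, ← Complex.exp_nat_mul]
    convert Complex.exp_pi_div_two_mul_I using 2
    push_cast; ring
  have h3 : √3 * √3 = 3 := Real.mul_self_sqrt (by norm_num)
  have h3' : 0 < √3 := by positivity
  set h : ℂ → ℂ := fun z => Complex.exp (Complex.I * (z ^ 3 / 3 + x * z)) with hh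
  have hd : Differentiable ℂ h := by fun_prop
  obtain ⟨F, hF⟩ := hd.isExactOn_univ
  replace hF : ∀ z, HasDerivAt F (h z) z := fun z => hF z (mem_univ z)
  have line : ∀ (z w : ℂ) (t : ℝ), HasDerivAt (fun t : ℝ => F (z + w * t)) (w * h (z + w * t)) t := by
    intro z w t
    have h1 : HasDerivAt (fun t : ℝ => z + w * t) w t := by
      simpa using ((Complex.ofRealCLM.hasDerivAt (x := t)).const_mul w).const_add z
    have := (hF (z + w * t)).comp t h1
    rwa [mul_comm] at this
  have hcont : Continuous h := hd.continuous
  have seg : ∀ (w : ℂ) (R : ℝ), ∫ t in (0 : ℝ)..R, w * h (w * t) = F (w * R) - F 0 := by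
    intro w R
    rw [intervalIntegral.integral_eq_sub_of_hasDerivAt (f := fun t : ℝ => F (0 + w * t))]
    · simp
    · intro t _
      simpa using line 0 w t
    · exact Continuous.intervalIntegrable (by fun_prop) _ _
  have hray : Tendsto (fun ρ : ℝ => F (c * ρ) - F 0) atTop (nhds (c * scorer (Complex.I * c * x))) := by
    have hint : IntegrableOn (fun r : ℝ =>
        Complex.exp (-(r ^ 3 : ℂ) / 3 + Complex.I * c * x * r)) (Ioi 0) := by
      refine Integrable.mono' (integrableOn_pow_mul_exp_neg_cube 0 (b := 1 / 3) (by norm_num))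
        (by fun_prop) ?_
      refine (ae_restrict_iff' measurableSet_Ioi).2 (ae_of_all _ fun r hr => ?_)
      have hr : 0 < r := hr
      rw [Complex.norm_exp, pow_zero, one_mul, hcv]
      have : (-(r ^ 3 : ℂ) / 3 + Complex.I * ((√3 / 2 : ℝ) + (1 / 2 : ℝ) * Complex.I) * x * r) =
          ((-(r ^ 3) / 3 - x * r / 2 : ℝ) : ℂ) + ((√3 / 2 * x * r : ℝ) : ℂ) * Complex.I := by
        push_cast
        linear_combination (1 / 2 * (x : ℂ) * r) * Complex.I_mul_I
      rw [this]
      simp only [Complex.add_re, Complex.ofReal_re, Complex.re_ofReal_mul, Complex.I_re, mul_zero,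
        add_zero]
      gcongr
      nlinarith [mul_nonneg hx hr.le]
    have h1 := (intervalIntegral_tendsto_integral_Ioi 0 hint tendsto_id).const_mul c
    refine h1.congr fun ρ => ?_
    rw [← seg c ρ, ← intervalIntegral.integral_const_mul]
    refine intervalIntegral.integral_congr fun r _ => ?_
    simp only [hh]
    congr 2
    linear_combination (-Complex.I * (r : ℂ) ^ 3 / 3) * hc3 - (r : ℂ) ^ 3 / 3 * Complex.I_mul_I
  have hscale : Tendsto (fun R : ℝ => 2 / √3 * R) atTop atTop :=
    tendsto_id.const_mul_atTop (by positivity)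
  have hvert : Tendsto (fun R : ℝ => F (R + Complex.I * (R / √3 : ℝ)) - F R) atTop (nhds 0) := by
    have hlim : Tendsto (fun R : ℝ => 1 / (8 / 9 * R ^ 2)) atTop (nhds 0) := by
      have : Tendsto (fun R : ℝ => 8 / 9 * R ^ 2) atTop atTop :=
        (tendsto_pow_atTop two_ne_zero).const_mul_atTop (by norm_num)
      simp only [one_div]
      exact this.inv_tendsto_atTop
    refine squeeze_zero_norm' ?_ hlim
    filter_upwards [eventually_gt_atTop 0] with R hR
    set k := 8 / 9 * R ^ 2 with hk
    have hk0 : 0 < k := by positivity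
    have hB : ∀ η : ℝ, HasDerivAt (fun η : ℝ => (1 - Real.exp (-k * η)) / k)
        (Real.exp (-k * η)) η := fun η => by
      refine (((((hasDerivAt_id η).const_mul (-k)).exp).const_sub 1).div_const k).congr_deriv ?_
      simp only [id]; field_simp
    have hb := image_norm_le_of_norm_deriv_right_le_deriv_boundary
      (f := fun η : ℝ => F (R + Complex.I * η) - F R) (a := 0) (b := R / √3)
      (fun η _ => ((line R Complex.I η).sub_const _).continuousAt.continuousWithinAt)
      (fun η _ => ((line R Complex.I η).sub_const _).hasDerivWithinAt)
      (by simp) hB (fun η hη => ?_) (x := R / √3) ⟨by positivity, le_rfl⟩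
    · refine hb.trans ?_
      gcongr
      linarith [Real.exp_pos (-k * (R / √3))]
    · rw [norm_mul, Complex.norm_I, one_mul, hh]
      simp only [Complex.norm_exp]
      gcongr
      have : Complex.I * ((R + Complex.I * η) ^ 3 / 3 + x * (R + Complex.I * η)) =
          ((-(R ^ 2 * η - η ^ 3 / 3) - x * η : ℝ) : ℂ) +
            ((R ^ 3 / 3 - R * η ^ 2 + x * R : ℝ) : ℂ) * Complex.I := by
        push_cast
        have h2 := Complex.I_sq
        have h4 : Complex.I ^ 4 = 1 := Complex.I_pow_four
        have h5 : Complex.I ^ 3 = -Complex.I := Complex.I_pow_three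
        ring_nf
        simp only [h2, h4, h5]
        ring
      rw [this]
      simp only [Complex.add_re, Complex.ofReal_re, Complex.re_ofReal_mul, Complex.I_re, mul_zero,
        add_zero]
      have hη0 : 0 ≤ η := hη.1
      have hη2 : η ^ 2 ≤ R ^ 2 / 3 := by
        calc η ^ 2 ≤ (R / √3) ^ 2 := by gcongr; exact hη.2.le
          _ = R ^ 2 / 3 := by rw [div_pow, Real.sq_sqrt (by norm_num)]
      rw [hk]
      nlinarith [mul_le_mul_of_nonneg_left hη2 hη0, mul_nonneg hx hη0]
  have hfinal := (hray.comp hscale).sub hvert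
  rw [sub_zero] at hfinal
  refine hfinal.congr fun R => ?_
  have h1 := seg 1 R
  simp only [one_mul] at h1
  rw [show (∫ t in (0 : ℝ)..R, Complex.exp (Complex.I * (t ^ 3 / 3 + x * t))) = F R - F 0 from h1]
  have : c * ((2 / √3 * R : ℝ) : ℂ) = R + Complex.I * (R / √3 : ℝ) := by
    have hne : (√3 : ℂ) ≠ 0 := by exact_mod_cast h3'.ne'
    rw [hcv]; push_cast; field_simp
  simp only [Function.comp_apply, this]
  ring

theorem tendsto_integral_cos_and_sin_airy_phase {x : ℝ} (hx : 0 ≤ x) :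
    Tendsto (fun R : ℝ => ∫ t in (0 : ℝ)..R, Real.cos (t ^ 3 / 3 + x * t)) atTop
      (nhds (Complex.exp (Complex.I * (Real.pi / 6 : ℝ)) *
        scorer (Complex.I * Complex.exp (Complex.I * (Real.pi / 6 : ℝ)) * x)).re) ∧
    Tendsto (fun R : ℝ => ∫ t in (0 : ℝ)..R, Real.sin (t ^ 3 / 3 + x * t)) atTop
      (nhds (Complex.exp (Complex.I * (Real.pi / 6 : ℝ)) *
        scorer (Complex.I * Complex.exp (Complex.I * (Real.pi / 6 : ℝ)) * x)).im) := by
  have h := tendsto_integral_airy_phase hx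
  have hsplit : ∀ R : ℝ, ∫ t in (0 : ℝ)..R, Complex.exp (Complex.I * (t ^ 3 / 3 + x * t)) =
      ((∫ t in (0 : ℝ)..R, Real.cos (t ^ 3 / 3 + x * t) : ℝ) : ℂ) +
        ((∫ t in (0 : ℝ)..R, Real.sin (t ^ 3 / 3 + x * t) : ℝ) : ℂ) * Complex.I := fun R => by
    rw [← intervalIntegral.integral_ofReal, ← intervalIntegral.integral_ofReal,
      ← intervalIntegral.integral_mul_const, ← intervalIntegral.integral_add
        (Continuous.intervalIntegrable (by fun_prop) _ _)
        (Continuous.intervalIntegrable (by fun_prop) _ _)]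
    refine intervalIntegral.integral_congr fun t _ => ?_
    rw [mul_comm, Complex.exp_mul_I]
    push_cast
    rfl
  simp only [hsplit] at h
  constructor
  · exact ((Complex.continuous_re.tendsto _).comp h).congr fun R => by simp
  · exact ((Complex.continuous_im.tendsto _).comp h).congr fun R => by simp

theorem tendsto_integral_exp_cubic {x : ℝ} (hx : 0 ≤ x) (hx1 : x ≤ 1) :
    Tendsto (fun R : ℝ => ∫ t in (0 : ℝ)..R, Real.exp (-(t ^ 3) / 3 + x * t)) atTop
      (nhds (scorer x).re) := by
  have hint : IntegrableOn (fun r : ℝ => Complex.exp (-(r ^ 3 : ℂ) / 3 + x * r)) (Ioi 0) := by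
    refine Integrable.mono' (integrableOn_pow_mul_exp_cubic 0) (by fun_prop) ?_
    refine (ae_restrict_iff' measurableSet_Ioi).2 (ae_of_all _ fun r hr => ?_)
    simpa using norm_exp_cubic_le (a := x) (by simpa [abs_of_nonneg hx] using hx1) hr
  have h := (Complex.continuous_re.tendsto _).comp
    (intervalIntegral_tendsto_integral_Ioi 0 hint tendsto_id)
  refine h.congr fun R => ?_
  simp only [Function.comp_apply, id]
  rw [← Complex.ofReal_re (∫ t in (0 : ℝ)..R, _), ← intervalIntegral.integral_ofReal]
  congr 1
  refine intervalIntegral.integral_congr fun t _ => ?_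
  push_cast
  rfl

/-- The derivative at `0` of an entire function that is real on the real axis is determined by its
real part on `[0, 1]`. -/
theorem value_and_deriv_zero_of_eqOn {f : ℂ → ℂ} (hf : Differentiable ℂ f)
    (him : ∀ x : ℝ, (f x).im = 0) {g : ℝ → ℝ} {g' : ℝ} (hg : HasDerivAt g g' 0)
    (hfg : ∀ x : ℝ, 0 ≤ x → x ≤ 1 → (f x).re = g x) :
    f 0 = (g 0 : ℝ) ∧ deriv f 0 = (g' : ℝ) := by
  have h1 : HasDerivAt (fun x : ℝ => f x) (deriv f 0) 0 := by
    have := (hf ((0 : ℝ) : ℂ)).hasDerivAt.comp_ofReal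
    simpa using this
  have hre : HasDerivAt (fun x : ℝ => (f x).re) (deriv f 0).re 0 :=
    Complex.reCLM.hasFDerivAt.comp_hasDerivAt 0 h1
  have him' : HasDerivAt (fun x : ℝ => (f x).im) (deriv f 0).im 0 :=
    Complex.imCLM.hasFDerivAt.comp_hasDerivAt 0 h1
  have e1 : (deriv f 0).im = 0 := by
    simp only [him] at him'
    exact him'.unique (hasDerivAt_const _ _)
  have e2 : (deriv f 0).re = g' := by
    have hu : UniqueDiffWithinAt ℝ (Icc (0 : ℝ) 1) 0 :=
      uniqueDiffOn_Icc one_pos 0 ⟨le_rfl, zero_le_one⟩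
    refine hu.eq_deriv _ hre.hasDerivWithinAt ?_
    exact hg.hasDerivWithinAt.congr (fun x hx => hfg x hx.1 hx.2) (hfg 0 le_rfl zero_le_one)
  refine ⟨Complex.ext ?_ ?_, Complex.ext (by simpa using e2) (by simpa using e1)⟩
  · simpa using hfg 0 le_rfl zero_le_one
  · simpa using him 0

/-- The values of the Airy functions and of their derivatives at the origin. -/
theorem IsAiry.values_zero {Ai Bi : ℂ → ℂ} (h : IsAiry Ai Bi) :
    ∃ a b : ℝ, 0 < a ∧ 0 < b ∧ a * b = 2 * Real.pi / (3 * √3) ∧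
      Ai 0 = (√3 / 2 * a / Real.pi : ℝ) ∧ deriv Ai 0 = (-(√3 / 2 * b) / Real.pi : ℝ) ∧
      Bi 0 = (3 / 2 * a / Real.pi : ℝ) ∧ deriv Bi 0 = (3 / 2 * b / Real.pi : ℝ) := by
  obtain ⟨hA, hB, -, -, hAim, hBim, hAlim, hBlim⟩ := h
  set a := ∫ r : ℝ in Ioi 0, Real.exp (-(1 / 3) * r ^ 3) with ha
  set b := ∫ r : ℝ in Ioi 0, r * Real.exp (-(1 / 3) * r ^ 3) with hb
  have hab : a * b = 2 * Real.pi / (3 * √3) := integral_mul_integral_exp_neg_cube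
  have ha0 : 0 < a := integral_exp_neg_cube_pos
  have hb0 : 0 < b := by
    have : 0 < a * b := by rw [hab]; positivity
    exact (pos_iff_pos_of_mul_pos this).1 ha0
  have hcv := exp_I_mul_pi_div_six
  set c : ℂ := Complex.exp (Complex.I * (Real.pi / 6 : ℝ)) with hc
  have h3 : √3 * √3 = 3 := Real.mul_self_sqrt (by norm_num)
  have hs0 : scorer 0 = (a : ℂ) := scorer_zero
  have hS : ∀ w : ℂ, HasDerivAt (fun x : ℝ => scorer (w * x)) (w * b) 0 := fun w => by
    have h1 : HasDerivAt (fun x : ℝ => w * (x : ℂ)) w 0 := by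
      simpa using (Complex.ofRealCLM.hasDerivAt (x := 0)).const_mul w
    have h2 : HasDerivAt scorer (b : ℂ) (w * ((0 : ℝ) : ℂ)) := by
      rw [Complex.ofReal_zero, mul_zero]
      exact hasDerivAt_scorer_zero
    have := h2.comp (0 : ℝ) h1
    rwa [mul_comm] at this
  have hre : ∀ {g : ℝ → ℂ} {g' : ℂ} {u : ℝ}, HasDerivAt g g' u →
      HasDerivAt (fun t => (g t).re) g'.re u := fun {g g' u} h =>
    (Complex.reCLM.hasFDerivAt.comp_hasDerivAt u h)
  have him : ∀ {g : ℝ → ℂ} {g' : ℂ} {u : ℝ}, HasDerivAt g g' u →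
      HasDerivAt (fun t => (g t).im) g'.im u := fun {g g' u} h =>
    (Complex.imCLM.hasFDerivAt.comp_hasDerivAt u h)
  have hcs := (hS (Complex.I * c)).const_mul c
  have hderiv : c * (Complex.I * c * b) = (-(√3 / 2 * b) : ℝ) + (b / 2 : ℝ) * Complex.I := by
    have h3' : (√3 : ℂ) * √3 = 3 := by exact_mod_cast h3
    rw [hcv]; push_cast
    linear_combination (√3 / 2 * b + b / 4 * Complex.I : ℂ) * Complex.I_mul_I +
      (b / 4 * Complex.I : ℂ) * h3'
  rw [hderiv] at hcs
  have valA := value_and_deriv_zero_of_eqOn hA hAim ((hre hcs).div_const Real.pi) (fun x hx _ => by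
    rw [eq_div_iff Real.pi_ne_zero, mul_comm]
    exact tendsto_nhds_unique (hAlim x) (tendsto_integral_cos_and_sin_airy_phase hx).1)
  have hs1 : HasDerivAt (fun x : ℝ => scorer x) (b : ℂ) 0 := by simpa using hS 1
  have valB := value_and_deriv_zero_of_eqOn hB hBim
    (((hre hs1).add (him hcs)).div_const Real.pi) (fun x hx hx1 => by
      rw [eq_div_iff Real.pi_ne_zero, mul_comm]
      refine tendsto_nhds_unique (hBlim x) ?_
      refine ((tendsto_integral_exp_cubic hx hx1).add
        (tendsto_integral_cos_and_sin_airy_phase hx).2).congr fun R => ?_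
      rw [intervalIntegral.integral_add (Continuous.intervalIntegrable (by fun_prop) _ _)
        (Continuous.intervalIntegrable (by fun_prop) _ _)])
  refine ⟨a, b, ha0, hb0, hab, ?_, ?_, ?_, ?_⟩
  · rw [valA.1]
    simp [hs0, hcv]
  · rw [valA.2]
    simp
  · rw [valB.1]
    simp [hs0, hcv]
    ring
  · rw [valB.2]
    simp
    ring

theorem IsAiry.wronskian {Ai Bi : ℂ → ℂ} (h : IsAiry Ai Bi) (z : ℂ) :
    Ai z * deriv Bi z - deriv Ai z * Bi z = 1 / Real.pi := by
  obtain ⟨a, b, ha, hb, hab, hA0, hA1, hB0, hB1⟩ := h.values_zero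
  obtain ⟨hA, hB, hA2, hB2, -⟩ := h
  have hd : ∀ z, HasDerivAt (fun z => Ai z * deriv Bi z - deriv Ai z * Bi z) 0 z := fun z => by
    refine (((hA z).hasDerivAt.mul (hB.deriv z).hasDerivAt).sub
      ((hA.deriv z).hasDerivAt.mul (hB z).hasDerivAt)).congr_deriv ?_
    rw [hA2, hB2]; ring
  have hconst := is_const_of_deriv_eq_zero (fun z => (hd z).differentiableAt)
    (fun z => (hd z).deriv) z 0
  rw [hconst, hA0, hA1, hB0, hB1]
  have hpi := Real.pi_ne_zero
  have h3 : √3 ≠ 0 := by positivity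
  have : √3 / 2 * a / Real.pi * (3 / 2 * b / Real.pi) -
      -(√3 / 2 * b) / Real.pi * (3 / 2 * a / Real.pi) = 1 / Real.pi := by
    have e : √3 / 2 * a / Real.pi * (3 / 2 * b / Real.pi) -
      -(√3 / 2 * b) / Real.pi * (3 / 2 * a / Real.pi) = 3 / 2 * √3 * (a * b) / Real.pi ^ 2 := by
      field_simp; ring
    rw [e, hab]; field_simp
  exact_mod_cast this

theorem IsAiry.growth_ray {Ai Bi : ℂ → ℂ} (h : IsAiry Ai Bi) {σ : ℝ} (hσ : σ * σ = 1) :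
    (∃ c > 0, ∀ u : ℝ, 0 ≤ u → c * Real.exp (2 * u) ≤ ‖Ai (Complex.I * (σ * u : ℝ))‖) ∧
      ∃ C > 0, ∀ u : ℝ, 0 ≤ u → ‖deriv Ai (Complex.I * (σ * u : ℝ))‖ ≤
        C * Real.exp u * ‖Ai (Complex.I * (σ * u : ℝ))‖ := by
  obtain ⟨a, b, ha, hb, -, hA0, hA1, -⟩ := h.values_zero
  obtain ⟨hA, -, hA2, -⟩ := h
  have hline : ∀ u : ℝ, HasDerivAt (fun u : ℝ => Complex.I * ((σ * u : ℝ) : ℂ))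
      (Complex.I * σ) u := fun u => by
    have h1 : HasDerivAt (fun u : ℝ => ((u : ℝ) : ℂ)) 1 u := Complex.ofRealCLM.hasDerivAt
    have := h1.const_mul (Complex.I * σ)
    simpa [mul_assoc] using this
  have hσc : (σ : ℂ) * σ = 1 := by exact_mod_cast hσ
  have hnorm : ‖Complex.I * (σ : ℂ)‖ = 1 := by
    rw [norm_mul, Complex.norm_I, one_mul, Complex.norm_real, Real.norm_eq_abs]
    have : |σ| * |σ| = 1 := by rw [abs_mul_abs_self, hσ]
    nlinarith [abs_nonneg σ]
  have key := exp_le_norm_of_airy_imag (σ := σ) (f := fun u => Ai (Complex.I * (σ * u : ℝ)))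
    (f₁ := fun u => deriv Ai (Complex.I * (σ * u : ℝ)) * (Complex.I * σ)) hσ
    (fun u => (hA _).hasDerivAt.comp u (hline u))
    (fun u => by
      refine (((hA.deriv _).hasDerivAt.comp u (hline u)).mul_const _).congr_deriv ?_
      rw [hA2]; push_cast
      linear_combination (Complex.I * σ * u * Ai (Complex.I * (σ * u)) * σ * σ) *
        Complex.I_mul_I - (Complex.I * σ * u * Ai (Complex.I * (σ * u))) * hσc)
    (by
      simp only [mul_zero, Complex.ofReal_zero, hA0, hA1]
      simp [-Complex.ofReal_mul, -Complex.ofReal_div, -Complex.ofReal_neg])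
    (by
      simp only [mul_zero, Complex.ofReal_zero, hA0, hA1]
      have : 0 < √3 / 2 * b / Real.pi * (√3 / 2 * a / Real.pi) * (σ * σ) := by
        rw [hσ]; positivity
      simp only [Complex.mul_re, Complex.mul_im,
        Complex.ofReal_re, Complex.ofReal_im, Complex.I_re, Complex.I_im]
      refine this.trans_eq ?_
      ring)
  simpa only [norm_mul (deriv Ai _), hnorm, mul_one] using key

/-- On the imaginary axis, `Ai` grows faster than `exp (2|u|)` and its logarithmic derivative grows
at most like `exp |u|`. -/
theorem IsAiry.growth {Ai Bi : ℂ → ℂ} (h : IsAiry Ai Bi) :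
    ∃ c C : ℝ, 0 < c ∧ 0 < C ∧ ∀ u : ℝ, c * Real.exp (2 * |u|) ≤ ‖Ai (Complex.I * u)‖ ∧
      ‖deriv Ai (Complex.I * u)‖ ≤ C * Real.exp |u| * ‖Ai (Complex.I * u)‖ := by
  obtain ⟨⟨c, hc, hcA⟩, C, hC, hCA⟩ := h.growth_ray (σ := 1) (by norm_num)
  obtain ⟨⟨d, hd, hdA⟩, D, hD, hDA⟩ := h.growth_ray (σ := -1) (by norm_num)
  refine ⟨min c d, max C D, lt_min hc hd, lt_max_of_lt_left hC, fun u => ?_⟩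
  rcases le_total 0 u with hu | hu
  · have h1 := hcA |u| (abs_nonneg u)
    have h2 := hCA |u| (abs_nonneg u)
    rw [show 1 * |u| = u by rw [abs_of_nonneg hu, one_mul]] at h1 h2
    refine ⟨le_trans ?_ h1, h2.trans ?_⟩
    · gcongr; exact min_le_left _ _
    · gcongr; exact le_max_left _ _
  · have h1 := hdA |u| (abs_nonneg u)
    have h2 := hDA |u| (abs_nonneg u)
    rw [show -1 * |u| = u by rw [abs_of_nonpos hu]; ring] at h1 h2
    refine ⟨le_trans ?_ h1, h2.trans ?_⟩
    · gcongr; exact min_le_right _ _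
    · gcongr; exact le_max_right _ _

/-- Growth of the solutions of `w'' = (z + t) w` along `[0, X]`, for `z` on the imaginary axis. -/
theorem norm_le_of_shifted_airy {w w₁ : ℝ → ℂ} {u X M x : ℝ}
    (hw : ∀ t, HasDerivAt w (w₁ t) t)
    (hw₁ : ∀ t : ℝ, HasDerivAt w₁ ((Complex.I * u + t) * w t) t)
    (h0 : (|u| + X + 1) * ‖w 0‖ ≤ M) (h1 : ‖w₁ 0‖ ≤ M) (hx : 0 ≤ x) (hxX : x ≤ X) :
    ‖w x‖ ≤ M * Real.exp ((|u| + X + 1 + X ^ 2) / 2) ∧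
      ‖w₁ x‖ ≤ M * Real.exp ((|u| + X + 1 + X ^ 2) / 2) := by
  have hX : 0 ≤ X := hx.trans hxX
  set K := √(|u| + X + 1) with hK
  have hK2 : K ^ 2 = |u| + X + 1 := Real.sq_sqrt (by positivity)
  have hK1 : 1 ≤ K := by rw [hK]; exact Real.one_le_sqrt.2 (by linarith [abs_nonneg u])
  have hM : 0 ≤ M := (norm_nonneg _).trans h1
  have hv : ∀ t : ℝ, HasDerivAt (fun t => (K * w t, w₁ t) : ℝ → ℂ × ℂ)
      (K * w₁ t, (Complex.I * u + t) * w t) t := fun t =>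
    ((hw t).const_mul (K : ℂ)).prodMk (hw₁ t)
  have hnK : ‖(K : ℂ)‖ = K := by
    rw [Complex.norm_real, Real.norm_of_nonneg (by linarith)]
  have hg := norm_le_gronwallBound_of_norm_deriv_right_le (δ := M) (K := K) (ε := 0)
    (a := 0) (b := X) (fun t _ => (hv t).continuousAt.continuousWithinAt)
    (fun t _ => (hv t).hasDerivWithinAt)
    (by
      refine norm_prod_le_iff.2 ⟨?_, h1⟩
      rw [norm_mul, hnK]
      refine le_trans ?_ h0
      rw [← hK2]
      gcongr
      nlinarith)
    (fun t ht => by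
      rw [add_zero]
      have e1 : ‖(K : ℂ) * w t‖ ≤ ‖((K * w t, w₁ t) : ℂ × ℂ)‖ :=
        norm_fst_le ((K * w t, w₁ t) : ℂ × ℂ)
      have e2 : ‖w₁ t‖ ≤ ‖((K * w t, w₁ t) : ℂ × ℂ)‖ :=
        norm_snd_le ((K * w t, w₁ t) : ℂ × ℂ)
      rw [norm_mul, hnK] at e1
      refine norm_prod_le_iff.2 ⟨?_, ?_⟩
      · simp only [norm_mul, hnK]
        gcongr
      · have h2 : ‖Complex.I * u + t‖ ≤ K ^ 2 := by
          rw [hK2]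
          refine (norm_add_le _ _).trans ?_
          rw [norm_mul, Complex.norm_I, one_mul, Complex.norm_real, Complex.norm_real,
            Real.norm_eq_abs, Real.norm_of_nonneg ht.1]
          linarith [ht.2]
        calc ‖(Complex.I * u + t) * w t‖ ≤ K ^ 2 * ‖w t‖ := by rw [norm_mul]; gcongr
          _ = K * (K * ‖w t‖) := by ring
          _ ≤ _ := by gcongr)
    x ⟨hx, hxX⟩
  rw [gronwallBound_ε0, sub_zero] at hg
  have hg' : ‖((K * w x, w₁ x) : ℂ × ℂ)‖ ≤ M * Real.exp ((|u| + X + 1 + X ^ 2) / 2) := by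
    refine hg.trans ?_
    gcongr
    rw [← hK2]
    nlinarith [sq_nonneg (K - X), mul_le_mul_of_nonneg_left hxX (zero_le_one.trans hK1)]
  obtain ⟨e1, e2⟩ := norm_prod_le_iff.1 hg'
  refine ⟨le_trans ?_ e1, e2⟩
  simp only [norm_mul, hnK]
  exact le_mul_of_one_le_left (norm_nonneg _) hK1

theorem integrable_exp_neg_abs_div_two : Integrable fun u : ℝ => Real.exp (-|u| / 2) := by
  rw [← integrableOn_univ, ← Iic_union_Ioi (a := (0 : ℝ))]
  refine IntegrableOn.union ?_ ?_
  · refine (integrableOn_exp_mul_Iic (a := 1 / 2) (by norm_num) 0).congr_fun (fun u hu => ?_)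
      measurableSet_Iic
    simp only [abs_of_nonpos (show u ≤ 0 from hu)]
    congr 1; ring
  · refine (integrableOn_exp_mul_Ioi (a := -(1 / 2)) (by norm_num) 0).congr_fun (fun u hu => ?_)
      measurableSet_Ioi
    simp only [abs_of_pos (show 0 < u from hu)]
    congr 1; ring

theorem norm_exp_neg_I_mul (s u : ℝ) : ‖Complex.exp (-Complex.I * s * u)‖ = 1 := by
  rw [show -Complex.I * s * u = ((-(s * u) : ℝ) : ℂ) * Complex.I by push_cast; ring]
  exact Complex.norm_exp_ofReal_mul_I _

/-- Uniform bounds, for `y` in a compact interval, of the three integrands by an integrable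
function of `u`. -/
theorem IsAiry.norm_quotients_le {Ai Bi : ℂ → ℂ} (h : IsAiry Ai Bi) (X : ℝ) :
    ∃ D : ℝ, ∀ u y : ℝ, 0 ≤ y → y ≤ X →
      ‖(Ai (Complex.I * u) * Bi (Complex.I * u + y)
        - Bi (Complex.I * u) * Ai (Complex.I * u + y)) / Ai (Complex.I * u)‖
          ≤ D * Real.exp (-|u| / 2) ∧
      ‖(Ai (Complex.I * u) * deriv Bi (Complex.I * u + y)
        - Bi (Complex.I * u) * deriv Ai (Complex.I * u + y)) / Ai (Complex.I * u)‖
          ≤ D * Real.exp (-|u| / 2) ∧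
      ‖Ai (Complex.I * u + y) / Ai (Complex.I * u) ^ 2‖ ≤ D * Real.exp (-|u| / 2) := by
  obtain ⟨c, C, hc, hC, hgr⟩ := h.growth
  have hW := h.wronskian
  obtain ⟨hA, hB, hA2, hB2, -⟩ := h
  set L := Real.exp ((X + 1 + X ^ 2) / 2) with hL
  have hL0 : 0 < L := Real.exp_pos _
  refine ⟨max (1 / Real.pi * L / c) ((C + |X| + 1) * L / c), fun u y hy hyX => ?_⟩
  have hX : 0 ≤ X := hy.trans hyX
  rw [abs_of_nonneg hX]
  obtain ⟨hlow, hup⟩ := hgr u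
  set z : ℂ := Complex.I * u with hz
  have hAz : 0 < ‖Ai z‖ := lt_of_lt_of_le (by positivity) hlow
  have hline : ∀ t : ℝ, HasDerivAt (fun t : ℝ => z + (t : ℂ)) 1 t := fun t =>
    (Complex.ofRealCLM.hasDerivAt (x := t)).const_add z
  have dA : ∀ t : ℝ, HasDerivAt (fun t : ℝ => Ai (z + t)) (deriv Ai (z + t)) t := fun t =>
    ((hA (z + t)).hasDerivAt.comp t (hline t)).congr_deriv (mul_one _)
  have dB : ∀ t : ℝ, HasDerivAt (fun t : ℝ => Bi (z + t)) (deriv Bi (z + t)) t := fun t =>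
    ((hB (z + t)).hasDerivAt.comp t (hline t)).congr_deriv (mul_one _)
  have dA1 : ∀ t : ℝ, HasDerivAt (fun t : ℝ => deriv Ai (z + t)) ((z + t) * Ai (z + t)) t :=
    fun t => by
      have := (hA.deriv (z + t)).hasDerivAt.comp t (hline t)
      rw [hA2, mul_one] at this
      exact this
  have dB1 : ∀ t : ℝ, HasDerivAt (fun t : ℝ => deriv Bi (z + t)) ((z + t) * Bi (z + t)) t :=
    fun t => by
      have := (hB.deriv (z + t)).hasDerivAt.comp t (hline t)
      rw [hB2, mul_one] at this
      exact this
  have hEL : Real.exp ((|u| + X + 1 + X ^ 2) / 2) = Real.exp (|u| / 2) * L := by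
    rw [hL, ← Real.exp_add]; congr 1; ring
  have hpi : (0 : ℝ) < 1 / Real.pi := by positivity
  have hw := norm_le_of_shifted_airy (M := 1 / Real.pi) (u := u) (X := X)
    (w := fun t => Ai z * Bi (z + t) - Bi z * Ai (z + t))
    (w₁ := fun t => Ai z * deriv Bi (z + t) - Bi z * deriv Ai (z + t))
    (fun t => ((dB t).const_mul _).sub ((dA t).const_mul _))
    (fun t => (((dB1 t).const_mul _).sub ((dA1 t).const_mul _)).congr_deriv (by ring))
    (by simp only [Complex.ofReal_zero, add_zero]
        rw [mul_comm (Ai z), sub_self, norm_zero, mul_zero]; exact hpi.le)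
    (by simp only [Complex.ofReal_zero, add_zero]
        rw [mul_comm (Bi z), hW z]; simp [abs_of_pos Real.pi_pos]) hy hyX
  have hwA := norm_le_of_shifted_airy (M := (C + X + 1) * Real.exp |u| * ‖Ai z‖) (u := u) (X := X)
    (w := fun t => Ai (z + t)) (w₁ := fun t => deriv Ai (z + t)) dA dA1
    (by
      simp only [Complex.ofReal_zero, add_zero]
      gcongr
      have h1 := Real.add_one_le_exp |u|
      nlinarith [abs_nonneg u, mul_nonneg hX (abs_nonneg u), mul_pos hC (Real.exp_pos |u|)])
    (by
      simp only [Complex.ofReal_zero, add_zero]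
      refine hup.trans ?_
      gcongr
      linarith) hy hyX
  rw [hEL] at hw hwA
  have hexp : Real.exp (|u| / 2) / Real.exp (2 * |u|) ≤ Real.exp (-|u| / 2) := by
    rw [← Real.exp_sub]
    gcongr
    linarith [abs_nonneg u]
  have hq : ∀ v : ℂ, ‖v‖ ≤ 1 / Real.pi * (Real.exp (|u| / 2) * L) →
      ‖v / Ai z‖ ≤ 1 / Real.pi * L / c * Real.exp (-|u| / 2) := fun v hv => by
    rw [norm_div]
    calc ‖v‖ / ‖Ai z‖ ≤ 1 / Real.pi * (Real.exp (|u| / 2) * L) / (c * Real.exp (2 * |u|)) := by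
          gcongr
      _ = 1 / Real.pi * L / c * (Real.exp (|u| / 2) / Real.exp (2 * |u|)) := by field_simp
      _ ≤ _ := by gcongr
  refine ⟨(hq _ hw.1).trans ?_, (hq _ hw.2).trans ?_, ?_⟩
  · gcongr; exact le_max_left _ _
  · gcongr; exact le_max_left _ _
  · have : ‖Ai (z + y) / Ai z ^ 2‖ ≤ (C + X + 1) * L / c * Real.exp (-|u| / 2) := by
      rw [norm_div, norm_pow]
      calc ‖Ai (z + y)‖ / ‖Ai z‖ ^ 2 ≤
            (C + X + 1) * Real.exp |u| * ‖Ai z‖ * (Real.exp (|u| / 2) * L) / ‖Ai z‖ ^ 2 := by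
            gcongr
            exact hwA.1
        _ = (C + X + 1) * Real.exp |u| * (Real.exp (|u| / 2) * L) / ‖Ai z‖ := by field_simp
        _ ≤ (C + X + 1) * Real.exp |u| * (Real.exp (|u| / 2) * L) / (c * Real.exp (2 * |u|)) := by
            gcongr
        _ = (C + X + 1) * L / c * (Real.exp (|u| + |u| / 2 - 2 * |u|)) := by
            rw [Real.exp_sub, Real.exp_add]; field_simp
        _ = _ := by congr 2; ring
    refine this.trans ?_
    gcongr; exact le_max_right _ _

theorem IsAiry.hasDerivAt_quotient {Ai Bi : ℂ → ℂ} (h : IsAiry Ai Bi) (s x u : ℝ) :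
    HasDerivAt (fun u : ℝ => Complex.exp (-Complex.I * s * u) *
        ((Ai (Complex.I * u) * Bi (Complex.I * u + x)
          - Bi (Complex.I * u) * Ai (Complex.I * u + x)) / Ai (Complex.I * u)))
      (-Complex.I * s * (Complex.exp (-Complex.I * s * u) *
          ((Ai (Complex.I * u) * Bi (Complex.I * u + x)
            - Bi (Complex.I * u) * Ai (Complex.I * u + x)) / Ai (Complex.I * u)))
        + Complex.I * (Complex.exp (-Complex.I * s * u) *
          ((Ai (Complex.I * u) * deriv Bi (Complex.I * u + x)
            - Bi (Complex.I * u) * deriv Ai (Complex.I * u + x)) / Ai (Complex.I * u)))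
        - Complex.I / Real.pi * (Complex.exp (-Complex.I * s * u) *
          (Ai (Complex.I * u + x) / Ai (Complex.I * u) ^ 2))) u := by
  obtain ⟨c, C, hc, hC, hgr⟩ := h.growth
  have hW := h.wronskian (Complex.I * u)
  obtain ⟨hA, hB, -⟩ := h
  have hne : Ai (Complex.I * u) ≠ 0 := norm_pos_iff.1 (lt_of_lt_of_le (by positivity) (hgr u).1)
  have hlin : ∀ w : ℂ, HasDerivAt (fun u : ℝ => w * (u : ℂ)) w u := fun w => by
    simpa using (Complex.ofRealCLM.hasDerivAt (x := u)).const_mul w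
  have dA := (hA _).hasDerivAt.comp u (hlin Complex.I)
  have dB := (hB _).hasDerivAt.comp u (hlin Complex.I)
  have dAx := (hA (Complex.I * u + x)).hasDerivAt.comp u ((hlin Complex.I).add_const (x : ℂ))
  have dBx := (hB (Complex.I * u + x)).hasDerivAt.comp u ((hlin Complex.I).add_const (x : ℂ))
  refine ((hlin (-Complex.I * s)).cexp.mul
    (((dA.mul dBx).sub (dB.mul dAx)).div dA hne)).congr_deriv ?_
  rw [show Complex.I / Real.pi = Complex.I * (1 / Real.pi) by ring, ← hW]
  simp only [Function.comp_apply, Pi.mul_apply, Pi.sub_apply, Pi.div_apply]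
  field_simp
  ring

/-- Lemma B.1 of the paper. For each `s ∈ ℝ`, the function
`g̃(s,x) = (1/2) ∫_ℝ e^{-isu} [Ai(iu)Bi(iu+x) - Bi(iu)Ai(iu+x)]/Ai(iu) du` satisfies, on
`(0,∞)`, the first-order differential equation
`∂g̃/∂x (s,x) = s g̃(s,x) + (1/2π) ∫_ℝ e^{-isu} Ai(iu+x)/Ai(iu)² du`. -/
theorem chernoff_stmt_12
    (Ai Bi : ℂ → ℂ) (hAiry : IsAiry Ai Bi) :
    ∀ s x : ℝ, 0 < x →
      HasDerivAt
        (fun y : ℝ => (1/2 : ℂ) *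
          ∫ u : ℝ, Complex.exp (-Complex.I * s * u) *
            ((Ai (Complex.I * u) * Bi (Complex.I * u + y)
                - Bi (Complex.I * u) * Ai (Complex.I * u + y)) / Ai (Complex.I * u)))
        ((s : ℂ) * ((1/2 : ℂ) *
            ∫ u : ℝ, Complex.exp (-Complex.I * s * u) *
              ((Ai (Complex.I * u) * Bi (Complex.I * u + x)
                  - Bi (Complex.I * u) * Ai (Complex.I * u + x)) / Ai (Complex.I * u)))
          + (1 / (2 * Real.pi)) *
              ∫ u : ℝ, Complex.exp (-Complex.I * s * u) *
                (Ai (Complex.I * u + x) / Ai (Complex.I * u) ^ 2))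
        x := by
  intro s x hx
  obtain ⟨c, C, hc, hC, hgr⟩ := hAiry.growth
  obtain ⟨D, hD⟩ := hAiry.norm_quotients_le (x + 1)
  have hder := hAiry.hasDerivAt_quotient s x
  obtain ⟨hA, hB, -⟩ := hAiry
  have hne : ∀ u : ℝ, Ai (Complex.I * u) ≠ 0 := fun u =>
    norm_pos_iff.1 (lt_of_lt_of_le (by positivity) (hgr u).1)
  have cA := hA.continuous
  have cB := hB.continuous
  have cA1 := hA.deriv.continuous
  have cB1 := hB.deriv.continuous
  set F : ℝ → ℝ → ℂ := fun y u => Complex.exp (-Complex.I * s * u) *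
    ((Ai (Complex.I * u) * Bi (Complex.I * u + y)
      - Bi (Complex.I * u) * Ai (Complex.I * u + y)) / Ai (Complex.I * u)) with hF
  set G : ℝ → ℝ → ℂ := fun y u => Complex.exp (-Complex.I * s * u) *
    ((Ai (Complex.I * u) * deriv Bi (Complex.I * u + y)
      - Bi (Complex.I * u) * deriv Ai (Complex.I * u + y)) / Ai (Complex.I * u)) with hG
  set N : ℝ → ℂ := fun u => Complex.exp (-Complex.I * s * u) *
    (Ai (Complex.I * u + x) / Ai (Complex.I * u) ^ 2) with hN
  have cF : ∀ y, Continuous (F y) := fun y =>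
    (by fun_prop : Continuous fun u : ℝ => Complex.exp (-Complex.I * s * u)).mul
      (Continuous.div (by fun_prop) (by fun_prop) hne)
  have cG : ∀ y, Continuous (G y) := fun y =>
    (by fun_prop : Continuous fun u : ℝ => Complex.exp (-Complex.I * s * u)).mul
      (Continuous.div (by fun_prop) (by fun_prop) hne)
  have cN : Continuous N :=
    (by fun_prop : Continuous fun u : ℝ => Complex.exp (-Complex.I * s * u)).mul
      (Continuous.div (by fun_prop) (by fun_prop) fun u => pow_ne_zero 2 (hne u))
  have hint := integrable_exp_neg_abs_div_two.const_mul D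
  have bF : ∀ y, 0 ≤ y → y ≤ x + 1 → ∀ u, ‖F y u‖ ≤ D * Real.exp (-|u| / 2) :=
    fun y h0 h1 u => by
      rw [hF, norm_mul, norm_exp_neg_I_mul, one_mul]; exact (hD u y h0 h1).1
  have bG : ∀ y, 0 ≤ y → y ≤ x + 1 → ∀ u, ‖G y u‖ ≤ D * Real.exp (-|u| / 2) :=
    fun y h0 h1 u => by
      rw [hG, norm_mul, norm_exp_neg_I_mul, one_mul]; exact (hD u y h0 h1).2.1
  have bN : ∀ u, ‖N u‖ ≤ D * Real.exp (-|u| / 2) := fun u => by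
    rw [hN, norm_mul, norm_exp_neg_I_mul, one_mul]; exact (hD u x hx.le (by linarith)).2.2
  have iF : Integrable (F x) := hint.mono' (cF x).aestronglyMeasurable
    (ae_of_all _ (bF x hx.le (by linarith)))
  have iN : Integrable N := hint.mono' cN.aestronglyMeasurable (ae_of_all _ bN)
  obtain ⟨iG, hmain⟩ := hasDerivAt_integral_of_dominated_loc_of_deriv_le (𝕜 := ℝ)
    (μ := volume) (F := F) (F' := G) (x₀ := x) (s := Ioo 0 (x + 1))
    (bound := fun u => D * Real.exp (-|u| / 2)) (Ioo_mem_nhds hx (by linarith))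
    (Eventually.of_forall fun y => (cF y).aestronglyMeasurable) iF
    (cG x).aestronglyMeasurable
    (ae_of_all _ fun u y hy => bG y hy.1.le hy.2.le u) hint
    (ae_of_all _ fun u y _ => by
      have hlin : HasDerivAt (fun y : ℝ => Complex.I * u + (y : ℂ)) 1 y :=
        (Complex.ofRealCLM.hasDerivAt (x := y)).const_add _
      have dA : HasDerivAt (fun y : ℝ => Ai (Complex.I * u + y)) (deriv Ai (Complex.I * u + y)) y :=
        ((hA (Complex.I * u + y)).hasDerivAt.comp y hlin).congr_deriv (mul_one _)
      have dB : HasDerivAt (fun y : ℝ => Bi (Complex.I * u + y)) (deriv Bi (Complex.I * u + y)) y :=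
        ((hB (Complex.I * u + y)).hasDerivAt.comp y hlin).congr_deriv (mul_one _)
      exact (((dB.const_mul _).sub (dA.const_mul _)).div_const _).const_mul _)
  have hzero := integral_eq_zero_of_hasDerivAt_of_integrable hder
    (((iF.const_mul (-Complex.I * s)).add (iG.const_mul Complex.I)).sub
      (iN.const_mul (Complex.I / Real.pi))) iF
  have hsplit : -Complex.I * s * (∫ u, F x u) + Complex.I * (∫ u, G x u)
      - Complex.I / Real.pi * (∫ u, N u) = 0 := by
    have e1 := integral_add (iF.const_mul (-Complex.I * s)) (iG.const_mul Complex.I)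
    have e2 := integral_sub ((iF.const_mul (-Complex.I * s)).add (iG.const_mul Complex.I))
      (iN.const_mul (Complex.I / Real.pi))
    simp only [Pi.add_apply, integral_const_mul] at e1 e2
    rw [← e1, ← e2]
    exact hzero
  refine (hmain.const_mul (1 / 2 : ℂ)).congr_deriv ?_
  have hpi : (Real.pi : ℂ) ≠ 0 := by exact_mod_cast Real.pi_ne_zero
  have hI : ∀ v : ℂ, Complex.I * v = 0 → v = 0 := fun v hv =>
    (mul_eq_zero.1 hv).resolve_left Complex.I_ne_zero
  have h2 := hI ((∫ u, G x u) - s * (∫ u, F x u) - 1 / Real.pi * (∫ u, N u)) (by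
    rw [← hsplit]; ring)
  linear_combination (1 / 2 : ℂ) * h2

end
end
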